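/- Let 1 ≤ r ≤ s ≤ p and suppose the data X is an n×p matrix with rows i.i.d. N(0,Σ) for Σ ∈ Θ₀(s,p,r,λ) with noise variance σ² = 1 replaced by general σ² (i.e., Σ = VΛV' + σ²I_p). Assume λ/σ² ≥ c₁·√(log n / n), s − r ≥ c₂·(s ∧ log(ep/s)), and n ≥ c₃·(s·log(ep/s) ∨ log(λ/σ²)) for suitable absolute constants c₁,c₂,c₃ > 0. Then there exist absolute constants c, C > 0 such that, whenever the quantity R := ((λ/σ² + 1)/(n·(λ/σ²)²))·(r(s−r) + s·log(ep/s)) is at most some absolute constant, the minimax risk satisfies c·R ≤ inf_{V̂} sup_{Σ ∈ Θ₀(s,p,r,λ)} E‖V̂V̂' − VV'‖_F² ≤ C·R, where the infimum is over all estimators V̂ = V̂(X) with values in O(p,r). -/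

import Mathlib

open MeasureTheory ProbabilityTheory Matrix Real
open scoped BigOperators ENNReal NNReal

noncomputable section

namespace SparsePCA

/-- The measure on `ι → ℝ` with i.i.d. standard normal coordinates. -/
def stdGaussian (ι : Type*) [Fintype ι] : Measure (ι → ℝ) :=
  Measure.pi fun _ => gaussianReal 0 1

/-- The measure on `Fin n → Fin m → ℝ` whose entries are i.i.d. standard normal. -/
def gaussianMatrix (n m : ℕ) : Measure (Fin n → Fin m → ℝ) :=
  Measure.pi fun _ => stdGaussian (Fin m)

/-- `V` has orthonormal columns, i.e. `V ∈ O(p,r)`. -/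
def IsOrthonormalCols {p r : ℕ} (V : Matrix (Fin p) (Fin r) ℝ) : Prop :=
  Vᵀ * V = 1

/-- Squared Frobenius norm. -/
def frobSq {m k : Type*} [Fintype m] [Fintype k] (A : Matrix m k ℝ) : ℝ :=
  ∑ i, ∑ j, (A i j) ^ 2

/-- Subspace estimation loss `‖V Vᵀ - W Wᵀ‖_F²`. -/
def loss {p r : ℕ} (V W : Matrix (Fin p) (Fin r) ℝ) : ℝ :=
  frobSq (V * Vᵀ - W * Wᵀ)

/-- Euclidean norm of row `j` of `V`. -/
def rowNorm {p r : ℕ} (V : Matrix (Fin p) (Fin r) ℝ) (j : Fin p) : ℝ :=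
  Real.sqrt (∑ i, (V j i) ^ 2)

/-- The `j`-th largest row norm of `V` (zero-based: `j = 0` is the largest). -/
def sortedRowNorm {p r : ℕ} (V : Matrix (Fin p) (Fin r) ℝ) (j : Fin p) : ℝ :=
  rowNorm V ((Tuple.sort (fun i => - rowNorm V i)) j)

/-- Weak `ℓ_q` radius `‖V‖_{q,w} = max_j j ‖V_{(j)*}‖^q`, with the convention
`0 ^ q = 0` (so that for `q = 0` this is the number of nonzero rows). -/
def weakLq {p r : ℕ} (q : ℝ) (V : Matrix (Fin p) (Fin r) ℝ) : ℝ :=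
  ⨆ j : Fin p, ((j : ℕ) + 1 : ℝ) *
    (if sortedRowNorm V j = 0 then 0 else (sortedRowNorm V j) ^ q)

/-- `h(λ) = λ² / (λ + 1)`. -/
def hfun (lam : ℝ) : ℝ := lam ^ 2 / (lam + 1)

/-- The rate function `Ψ(k,p,r,n,λ)`. -/
def Psi (k p r n : ℕ) (lam : ℝ) : ℝ :=
  ((r : ℝ) * k + k * Real.log (Real.exp 1 * p / k)) / (n * hfun lam)

/-- The rate function `Ψ₀(k,p,r,n,λ)`. -/
def Psi0 (k p r n : ℕ) (lam : ℝ) : ℝ :=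
  ((r : ℝ) * ((k : ℝ) - r) + k * Real.log (Real.exp 1 * p / k)) / (n * hfun lam)

/-- `x_q(s,p,r,n,λ)`. -/
def xq (q s : ℝ) (p r n : ℕ) (lam : ℝ) : ℝ :=
  sSup {x : ℝ | 0 ≤ x ∧ x ≤ p ∧
    x ≤ s * (n * hfun lam / ((r : ℝ) + Real.log (Real.exp 1 * p / x))) ^ (q / 2)}

/-- Effective dimension `k*_q = ⌈x_q⌉`. -/
def kq (q s : ℝ) (p r n : ℕ) (lam : ℝ) : ℕ := ⌈xq q s p r n lam⌉₊

/-- Membership of `Σ = V Λ Vᵀ + I` in `Θ_q(s,p,r,λ)` with constant `κ`,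
phrased in terms of the pair `(V, Λ)`. -/
def InTheta (q s : ℝ) (p r : ℕ) (lam κ : ℝ)
    (V : Matrix (Fin p) (Fin r) ℝ) (Λ : Fin r → ℝ) : Prop :=
  IsOrthonormalCols V ∧ weakLq q V ≤ s ∧ Antitone Λ ∧
    (∀ i, 0 < lam ∧ lam ≤ Λ i ∧ Λ i ≤ κ * lam)

/-- The distribution of the data matrix `X = U D Vᵀ + σ Z` (rows i.i.d.
`N(0, V Λ Vᵀ + σ² I_p)`), as a measure on `Fin n → Fin p → ℝ`. -/
def spikedMeasure (n p r : ℕ) (Λ : Fin r → ℝ) (V : Matrix (Fin p) (Fin r) ℝ)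
    (σ2 : ℝ) : Measure (Fin n → Fin p → ℝ) :=
  Measure.map
    (fun w : (Fin n → Fin r → ℝ) × (Fin n → Fin p → ℝ) =>
      fun i j => (∑ k, w.1 i k * Real.sqrt (Λ k) * V j k) + Real.sqrt σ2 * w.2 i j)
    ((gaussianMatrix n r).prod (gaussianMatrix n p))


/-- The minimax risk for estimating the principal subspace over
`Θ₀(s,p,r,λ)` (noise variance `σ²`), where the infimum runs over all
measurable estimators with values in `O(p,r)`. -/
def minimaxRisk0 (n p r s : ℕ) (lam σ2 κ : ℝ) : ℝ :=
  ⨅ est : {f : (Fin n → Fin p → ℝ) → (Fin p → Fin r → ℝ) //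
      Measurable f ∧ ∀ x, IsOrthonormalCols (Matrix.of (f x))},
    ⨆ (V : Matrix (Fin p) (Fin r) ℝ) (Λ : Fin r → ℝ)
      (_ : InTheta 0 s p r lam κ V Λ),
      ∫ x, loss (Matrix.of (est.1 x)) V ∂ spikedMeasure n p r Λ V σ2

instance instProbStd (ι : Type*) [Fintype ι] : IsProbabilityMeasure (stdGaussian ι) := by
  unfold stdGaussian; infer_instance

instance instProbMat (n m : ℕ) : IsProbabilityMeasure (gaussianMatrix n m) := by
  unfold gaussianMatrix; infer_instance

/-- One-dimensional master formula. -/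
lemma gauss_master1 (u c : ℝ) (hc : c < 1 / 2) :
    ∫⁻ z, ENNReal.ofReal (exp (u * z + c * z ^ 2)) ∂(gaussianReal 0 1)
      = ENNReal.ofReal (√((1 - 2 * c)⁻¹) * exp (u ^ 2 / (2 * (1 - 2 * c)))) := by
  have h1 : 0 < 1 - 2 * c := by linarith
  set d := 1 - 2 * c with hd
  have hv0 : (0 : ℝ) < d⁻¹ := by positivity
  let v : ℝ≥0 := ⟨d⁻¹, hv0.le⟩
  have hv : v ≠ 0 := by
    intro h; have : (v : ℝ) = 0 := by rw [h]; rfl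
    exact hv0.ne' this
  rw [gaussianReal_of_var_ne_zero _ (one_ne_zero), lintegral_withDensity_eq_lintegral_mul _
    (measurable_gaussianPDF 0 1) (by fun_prop)]
  have key : ∀ z : ℝ, gaussianPDF 0 1 z * ENNReal.ofReal (exp (u * z + c * z ^ 2))
      = ENNReal.ofReal (√(d⁻¹) * exp (u ^ 2 / (2 * d))) * gaussianPDF (u * d⁻¹) v z := by
    intro z
    rw [gaussianPDF, gaussianPDF, ← ENNReal.ofReal_mul (gaussianPDFReal_nonneg _ _ _),
      ← ENNReal.ofReal_mul (by positivity)]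
    congr 1
    rw [gaussianPDFReal_def, gaussianPDFReal_def]
    have hvc : (v : ℝ) = d⁻¹ := rfl
    simp only [hvc, NNReal.coe_one, mul_one, sub_zero]
    have e1 : √(2 * π * d⁻¹) = √(2 * π) * √(d⁻¹) := Real.sqrt_mul (by positivity) _
    rw [e1, mul_inv]
    have e2 : √(d⁻¹) ≠ 0 := (Real.sqrt_pos.2 hv0).ne'
    have e3 : √(2 * π) ≠ 0 := (Real.sqrt_pos.2 (by positivity)).ne'
    have e4 : rexp (-z ^ 2 / 2) * rexp (u * z + c * z ^ 2)
        = rexp (u ^ 2 / (2 * d)) * rexp (-(z - u * d⁻¹) ^ 2 / (2 * d⁻¹)) := by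
      rw [← Real.exp_add, ← Real.exp_add]
      congr 1
      have : c = (1 - d) / 2 := by rw [hd]; ring
      rw [this]; field_simp; ring
    calc (√(2 * π))⁻¹ * rexp (-z ^ 2 / 2) * rexp (u * z + c * z ^ 2)
        = (√(2 * π))⁻¹ * (rexp (-z ^ 2 / 2) * rexp (u * z + c * z ^ 2)) := by ring
      _ = _ := by rw [e4]; field_simp
  simp only [Pi.mul_apply, key]
  rw [lintegral_const_mul _ (measurable_gaussianPDF _ _), lintegral_gaussianPDF_eq_one _ hv, mul_one]

lemma lintegral_pi_prod {ι : Type*} [Fintype ι] {X : ι → Type*} [∀ i, MeasurableSpace (X i)]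
    (μ : ∀ i, Measure (X i)) [∀ i, IsProbabilityMeasure (μ i)] (f : ∀ i, X i → ℝ≥0∞)
    (hf : ∀ i, Measurable (f i)) :
    ∫⁻ x, ∏ i, f i (x i) ∂(Measure.pi μ) = ∏ i, ∫⁻ y, f i y ∂(μ i) := by
  have h := iIndepFun_pi (μ := μ) (X := f) (fun i => (hf i).aemeasurable)
  have h2 := lintegral_prod_eq_prod_lintegral_of_indepFun (μ := Measure.pi μ) Finset.univ
    (fun i x => f i (x i)) h (fun i => (hf i).comp (measurable_pi_apply i))
  rw [h2]
  refine Finset.prod_congr rfl fun i _ => ?_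
  exact (measurePreserving_eval μ i).lintegral_comp (hf i)

lemma ofReal_exp_sum {ι : Type*} (s : Finset ι) (f : ι → ℝ) :
    ENNReal.ofReal (exp (∑ i ∈ s, f i)) = ∏ i ∈ s, ENNReal.ofReal (exp (f i)) := by
  rw [Real.exp_sum, ENNReal.ofReal_prod_of_nonneg (fun i _ => (Real.exp_pos _).le)]

lemma gauss_master_vec {ι : Type*} [Fintype ι] (u : ι → ℝ) (c : ℝ) (hc : c < 1 / 2) :
    ∫⁻ z, ENNReal.ofReal (exp (∑ i, (u i * z i + c * z i ^ 2))) ∂(stdGaussian ι)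
      = ENNReal.ofReal (√((1 - 2 * c)⁻¹) ^ (Fintype.card ι)
          * exp ((∑ i, u i ^ 2) / (2 * (1 - 2 * c)))) := by
  simp_rw [ofReal_exp_sum]
  unfold stdGaussian
  rw [lintegral_pi_prod (fun _ : ι => gaussianReal 0 1)
    (fun i y => ENNReal.ofReal (exp (u i * y + c * y ^ 2))) (fun i => by fun_prop)]
  simp_rw [gauss_master1 _ c hc]
  rw [← ENNReal.ofReal_prod_of_nonneg (fun i _ => by positivity), Finset.prod_mul_distrib,
    ← Real.exp_sum, Finset.sum_div]
  simp

lemma gauss_master_mat {n m : ℕ} (u : Fin n → Fin m → ℝ) (c : ℝ) (hc : c < 1 / 2) :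
    ∫⁻ z, ENNReal.ofReal (exp (∑ i, ∑ j, (u i j * z i j + c * z i j ^ 2))) ∂(gaussianMatrix n m)
      = ENNReal.ofReal (√((1 - 2 * c)⁻¹) ^ (n * m)
          * exp ((∑ i, ∑ j, u i j ^ 2) / (2 * (1 - 2 * c)))) := by
  simp_rw [ofReal_exp_sum Finset.univ (fun i => ∑ j, _)]
  unfold gaussianMatrix
  rw [lintegral_pi_prod (fun _ : Fin n => stdGaussian (Fin m))
    (fun i y => ENNReal.ofReal (exp (∑ j, (u i j * y j + c * y j ^ 2)))) (fun i => by fun_prop)]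
  simp_rw [gauss_master_vec _ c hc]
  rw [← ENNReal.ofReal_prod_of_nonneg (fun i _ => by positivity), Finset.prod_mul_distrib,
    ← Real.exp_sum, Finset.sum_div]
  simp [← pow_mul, mul_comm]

/-- scaling and density, one dimension -/
lemma gauss_scale1 (a : ℝ) (ha : 0 < a) :
    (gaussianReal 0 1).map (fun z => √a * z)
      = (gaussianReal 0 1).withDensity
          (fun z => ENNReal.ofReal ((√a)⁻¹ * exp ((1 - a⁻¹) / 2 * z ^ 2))) := by
  rw [gaussianReal_map_const_mul, mul_zero]
  have hva : NNReal.mk (√a ^ 2) (sq_nonneg _) * 1 = a.toNNReal := by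
    rw [mul_one]; apply NNReal.eq; rw [Real.coe_toNNReal _ ha.le]; exact Real.sq_sqrt ha.le
  rw [hva]
  have hv : a.toNNReal ≠ 0 := (Real.toNNReal_pos.2 ha).ne'
  rw [gaussianReal_of_var_ne_zero _ hv, gaussianReal_of_var_ne_zero _ one_ne_zero,
    ← withDensity_mul _ (measurable_gaussianPDF 0 1) (by fun_prop)]
  congr 1
  ext z
  rw [Pi.mul_apply, gaussianPDF, gaussianPDF, ← ENNReal.ofReal_mul (gaussianPDFReal_nonneg _ _ _)]
  congr 1
  rw [gaussianPDFReal_def, gaussianPDFReal_def]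
  simp only [Real.coe_toNNReal _ ha.le, NNReal.coe_one, mul_one, sub_zero]
  rw [Real.sqrt_mul (by positivity), mul_inv]
  have : rexp (-z ^ 2 / (2 * a)) = rexp (-z ^ 2 / 2) * rexp ((1 - a⁻¹) / 2 * z ^ 2) := by
    rw [← Real.exp_add]; congr 1; field_simp; ring
  rw [this]; ring

lemma pi_map_withDensity {ι : Type*} [Fintype ι] {X : ι → Type*} [∀ i, MeasurableSpace (X i)]
    (μ : ∀ i, Measure (X i)) [∀ i, IsProbabilityMeasure (μ i)] (g : ∀ i, X i → X i)
    (hg : ∀ i, Measurable (g i)) (f : ∀ i, X i → ℝ≥0∞) (hf : ∀ i, Measurable (f i))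
    (h : ∀ i, (μ i).map (g i) = (μ i).withDensity (f i)) :
    (Measure.pi μ).map (fun x i => g i (x i))
      = (Measure.pi μ).withDensity (fun x => ∏ i, f i (x i)) := by
  have hp : ∀ i, IsProbabilityMeasure ((μ i).map (g i)) :=
    fun i => Measure.isProbabilityMeasure_map (hg i).aemeasurable
  rw [Measure.pi_map_pi (fun i => (hg i).aemeasurable)]
  refine Measure.pi_eq fun s hs => ?_
  rw [withDensity_apply _ (MeasurableSet.univ_pi hs), ← lintegral_indicator (MeasurableSet.univ_pi hs)]
  have : ∀ x : (∀ i, X i), (Set.univ.pi s).indicator (fun x => ∏ i, f i (x i)) x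
      = ∏ i, (s i).indicator (f i) (x i) := by
    intro x
    by_cases hx : x ∈ Set.univ.pi s
    · rw [Set.indicator_of_mem hx]
      refine Finset.prod_congr rfl fun i _ => ?_
      rw [Set.indicator_of_mem (hx i (Set.mem_univ i))]
    · rw [Set.indicator_of_notMem hx]
      simp only [Set.mem_pi, Set.mem_univ, true_implies, not_forall] at hx
      obtain ⟨i, hi⟩ := hx
      exact (Finset.prod_eq_zero (Finset.mem_univ i) (Set.indicator_of_notMem hi _)).symm
  simp_rw [this]
  rw [lintegral_pi_prod μ _ (fun i => (hf i).indicator (hs i))]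
  refine Finset.prod_congr rfl fun i _ => ?_
  rw [h i, withDensity_apply _ (hs i), lintegral_indicator (hs i)]

lemma gauss_scale_mat (n m : ℕ) (a : ℝ) (ha : 0 < a) :
    (gaussianMatrix n m).map (fun z i j => √a * z i j)
      = (gaussianMatrix n m).withDensity
          (fun z => ∏ i, ∏ j, ENNReal.ofReal ((√a)⁻¹ * exp ((1 - a⁻¹) / 2 * z i j ^ 2))) := by
  unfold gaussianMatrix
  refine pi_map_withDensity (fun _ : Fin n => stdGaussian (Fin m))
    (fun _ x j => √a * x j) (fun _ => by fun_prop)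
    (fun _ x => ∏ j, ENNReal.ofReal ((√a)⁻¹ * exp ((1 - a⁻¹) / 2 * x j ^ 2)))
    (fun _ => by fun_prop) (fun _ => ?_)
  unfold stdGaussian
  exact pi_map_withDensity (fun _ : Fin m => gaussianReal 0 1)
    (fun _ x => √a * x) (fun _ => by fun_prop)
    (fun _ x => ENNReal.ofReal ((√a)⁻¹ * exp ((1 - a⁻¹) / 2 * x ^ 2)))
    (fun _ => by fun_prop) (fun _ => gauss_scale1 a ha)

/-- residual of `x` after projecting on the columns of `V` -/
def rs {p r : ℕ} (V : Matrix (Fin p) (Fin r) ℝ) (x : Fin p → ℝ) : Fin p → ℝ :=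
  x - V *ᵥ (x ᵥ* V)

section
variable {p r : ℕ} {V : Matrix (Fin p) (Fin r) ℝ}

lemma mulVec_vecMul_self (hV : IsOrthonormalCols V) (a : Fin r → ℝ) : (V *ᵥ a) ᵥ* V = a := by
  rw [← Matrix.vecMul_transpose, Matrix.vecMul_vecMul, hV, Matrix.vecMul_one]

lemma rs_vecMul (hV : IsOrthonormalCols V) (x : Fin p → ℝ) : rs V x ᵥ* V = 0 := by
  rw [rs, Matrix.sub_vecMul, mulVec_vecMul_self hV, sub_self]

lemma dot_mulVec_left (a : Fin r → ℝ) (x : Fin p → ℝ) : (V *ᵥ a) ⬝ᵥ x = a ⬝ᵥ (x ᵥ* V) := by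
  rw [dotProduct_comm, Matrix.dotProduct_mulVec, dotProduct_comm]

lemma dot_mulVec_mulVec (hV : IsOrthonormalCols V) (a b : Fin r → ℝ) :
    (V *ᵥ a) ⬝ᵥ (V *ᵥ b) = a ⬝ᵥ b := by
  rw [dot_mulVec_left, mulVec_vecMul_self hV]

lemma dot_rs_mulVec (hV : IsOrthonormalCols V) (x : Fin p → ℝ) (a : Fin r → ℝ) :
    rs V x ⬝ᵥ (V *ᵥ a) = 0 := by
  rw [Matrix.dotProduct_mulVec, rs_vecMul hV, zero_dotProduct]

lemma rs_mulVec (hV : IsOrthonormalCols V) (a : Fin r → ℝ) : rs V (V *ᵥ a) = 0 := by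
  rw [rs, mulVec_vecMul_self hV, sub_self]

lemma rs_add (x y : Fin p → ℝ) : rs V (x + y) = rs V x + rs V y := by
  simp only [rs, Matrix.add_vecMul, Matrix.mulVec_add]; abel

lemma rs_smul (c : ℝ) (x : Fin p → ℝ) : rs V (c • x) = c • rs V x := by
  simp only [rs, Matrix.smul_vecMul, Matrix.mulVec_smul, smul_sub]

lemma dot_rs_comm (x y : Fin p → ℝ) : rs V x ⬝ᵥ y = x ⬝ᵥ rs V y := by
  simp only [rs, sub_dotProduct, dotProduct_sub]
  rw [dot_mulVec_left, Matrix.dotProduct_mulVec]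

lemma rs_rs (hV : IsOrthonormalCols V) (x : Fin p → ℝ) : rs V (rs V x) = rs V x := by
  conv_lhs => rw [rs, rs_vecMul hV, Matrix.mulVec_zero, sub_zero]

lemma dot_decomp (hV : IsOrthonormalCols V) (x y : Fin p → ℝ) :
    x ⬝ᵥ y = (x ᵥ* V) ⬝ᵥ (y ᵥ* V) + rs V x ⬝ᵥ rs V y := by
  rw [← dot_rs_comm, rs_rs hV]
  simp only [rs, sub_dotProduct]
  rw [dot_mulVec_left]; ring

end

lemma charfun_mat {n m : ℕ} (a : Fin n → Fin m → ℝ) :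
    ∫ z, Complex.exp ((∑ i, a i ⬝ᵥ z i : ℝ) * Complex.I) ∂(gaussianMatrix n m)
      = Complex.exp (-(∑ i, a i ⬝ᵥ a i : ℝ) / 2) := by
  have h1 : ∀ t : ℝ, ∫ z, Complex.exp ((t * z : ℝ) * Complex.I) ∂(gaussianReal 0 1)
      = Complex.exp (-(t * t : ℝ) / 2) := by
    intro t
    have := charFun_gaussianReal (μ := 0) (v := 1) t
    rw [charFun_apply_real] at this
    push_cast
    rw [this]; congr 1; push_cast; ring
  have h2 : ∀ b : Fin m → ℝ, ∫ z, Complex.exp ((b ⬝ᵥ z : ℝ) * Complex.I) ∂(stdGaussian (Fin m))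
      = Complex.exp (-(b ⬝ᵥ b : ℝ) / 2) := by
    intro b
    have e : ∀ z : Fin m → ℝ, Complex.exp ((b ⬝ᵥ z : ℝ) * Complex.I)
        = ∏ j, Complex.exp ((b j * z j : ℝ) * Complex.I) := by
      intro z
      rw [← Complex.exp_sum, dotProduct]; push_cast; rw [Finset.sum_mul]
    simp_rw [e]
    unfold stdGaussian
    rw [integral_fintype_prod_eq_prod (f := fun j (z : ℝ) => Complex.exp ((b j * z : ℝ) * Complex.I))]
    simp_rw [h1]
    rw [← Complex.exp_sum, dotProduct]; push_cast; rw [← Finset.sum_div, Finset.sum_neg_distrib]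
  have e : ∀ z : Fin n → Fin m → ℝ, Complex.exp ((∑ i, a i ⬝ᵥ z i : ℝ) * Complex.I)
      = ∏ i, Complex.exp ((a i ⬝ᵥ z i : ℝ) * Complex.I) := by
    intro z
    rw [← Complex.exp_sum, Complex.ofReal_sum, Finset.sum_mul]
  simp_rw [e]
  unfold gaussianMatrix
  rw [integral_fintype_prod_eq_prod (f := fun i (z : Fin m → ℝ) => Complex.exp ((a i ⬝ᵥ z : ℝ) * Complex.I))]
  simp_rw [h2]
  rw [← Complex.exp_sum, ← Finset.sum_div, Finset.sum_neg_distrib, Complex.ofReal_sum]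

lemma law_eq {n r p : ℕ}
    (T₁ T₂ : (Fin n → Fin r → ℝ) × (Fin n → Fin p → ℝ) → (Fin n → Fin p → ℝ))
    (h₁ : Measurable T₁) (h₂ : Measurable T₂)
    (a₁ a₂ : (Fin n → Fin p → ℝ) → (Fin n → Fin r → ℝ))
    (b₁ b₂ : (Fin n → Fin p → ℝ) → (Fin n → Fin p → ℝ))
    (e₁ : ∀ c w, ∑ i, c i ⬝ᵥ T₁ w i = ∑ i, a₁ c i ⬝ᵥ w.1 i + ∑ i, b₁ c i ⬝ᵥ w.2 i)
    (e₂ : ∀ c w, ∑ i, c i ⬝ᵥ T₂ w i = ∑ i, a₂ c i ⬝ᵥ w.1 i + ∑ i, b₂ c i ⬝ᵥ w.2 i)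
    (h : ∀ c, ∑ i, a₁ c i ⬝ᵥ a₁ c i + ∑ i, b₁ c i ⬝ᵥ b₁ c i
      = ∑ i, a₂ c i ⬝ᵥ a₂ c i + ∑ i, b₂ c i ⬝ᵥ b₂ c i) :
    Measure.map T₁ ((gaussianMatrix n r).prod (gaussianMatrix n p))
      = Measure.map T₂ ((gaussianMatrix n r).prod (gaussianMatrix n p)) := by
  have _ := Measure.isProbabilityMeasure_map (μ := (gaussianMatrix n r).prod (gaussianMatrix n p)) h₁.aemeasurable
  have _ := Measure.isProbabilityMeasure_map (μ := (gaussianMatrix n r).prod (gaussianMatrix n p)) h₂.aemeasurable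
  have key : ∀ (T : (Fin n → Fin r → ℝ) × (Fin n → Fin p → ℝ) → (Fin n → Fin p → ℝ))
      (_ : Measurable T) (a : (Fin n → Fin r → ℝ)) (b c : (Fin n → Fin p → ℝ))
      (_ : ∀ w, ∑ i, c i ⬝ᵥ T w i = ∑ i, a i ⬝ᵥ w.1 i + ∑ i, b i ⬝ᵥ w.2 i),
      ∫ x, Complex.exp ((∑ i, c i ⬝ᵥ x i : ℝ) * Complex.I)
        ∂(Measure.map T ((gaussianMatrix n r).prod (gaussianMatrix n p)))
      = Complex.exp (-(∑ i, a i ⬝ᵥ a i + ∑ i, b i ⬝ᵥ b i : ℝ) / 2) := by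
    intro T hT a b c e
    rw [integral_map hT.aemeasurable (by
      apply Continuous.aestronglyMeasurable
      simp only [dotProduct]
      fun_prop)]
    simp_rw [e]
    have : ∀ w : (Fin n → Fin r → ℝ) × (Fin n → Fin p → ℝ),
        Complex.exp ((∑ i, a i ⬝ᵥ w.1 i + ∑ i, b i ⬝ᵥ w.2 i : ℝ) * Complex.I)
        = Complex.exp ((∑ i, a i ⬝ᵥ w.1 i : ℝ) * Complex.I) *
          Complex.exp ((∑ i, b i ⬝ᵥ w.2 i : ℝ) * Complex.I) := by
      intro w; rw [← Complex.exp_add, Complex.ofReal_add, add_mul]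
    simp_rw [this]
    rw [integral_prod_mul (fun z : Fin n → Fin r → ℝ => Complex.exp ((∑ i, a i ⬝ᵥ z i : ℝ) * Complex.I))
      (fun z : Fin n → Fin p → ℝ => Complex.exp ((∑ i, b i ⬝ᵥ z i : ℝ) * Complex.I)),
      charfun_mat, charfun_mat, ← Complex.exp_add]
    congr 1; push_cast; ring
  refine Measure.ext_of_charFunDual ?_
  ext Lf
  rw [charFunDual_apply, charFunDual_apply]
  set c : Fin n → Fin p → ℝ := fun i j => Lf (Pi.single i (Pi.single j 1)) with hc
  have hL : ∀ x, Lf x = ∑ i, c i ⬝ᵥ x i := by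
    intro x
    have hx : x = ∑ i, ∑ j, x i j • (Pi.single i (Pi.single j (1 : ℝ)) : Fin n → Fin p → ℝ) := by
      ext i j
      simp only [Finset.sum_apply, Pi.smul_apply, smul_eq_mul]
      rw [Finset.sum_eq_single i, Finset.sum_eq_single j]
      · simp
      · intro j' _ hj'; simp [hj'.symm]
      · simp
      · intro i' _ hi'; simp [hi'.symm]
      · simp
    conv_lhs => rw [hx]
    simp only [map_sum, map_smul, dotProduct, hc, smul_eq_mul]
    refine Finset.sum_congr rfl fun i _ => Finset.sum_congr rfl fun j _ => mul_comm _ _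
  simp_rw [hL]
  rw [key T₁ h₁ _ _ c (e₁ c), key T₂ h₂ _ _ c (e₂ c), h]

/-- representation map -/
def Trep {n p r : ℕ} (d : Fin r → ℝ) (V : Matrix (Fin p) (Fin r) ℝ)
    (w : (Fin n → Fin r → ℝ) × (Fin n → Fin p → ℝ)) : Fin n → Fin p → ℝ :=
  fun i => V *ᵥ (d * w.1 i) + rs V (w.2 i)

lemma measurable_Trep {n p r : ℕ} (d : Fin r → ℝ) (V : Matrix (Fin p) (Fin r) ℝ) :
    Measurable (Trep (n := n) d V) := by
  apply Continuous.measurable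
  unfold Trep rs
  refine continuous_pi fun i => continuous_pi fun j => ?_
  simp only [Pi.add_apply, Pi.sub_apply, Matrix.mulVec, Matrix.vecMul, dotProduct, Pi.mul_apply]
  fun_prop

lemma spiked_rep {n p r : ℕ} {Λ : Fin r → ℝ} (hΛ : ∀ k, 0 ≤ Λ k)
    {V : Matrix (Fin p) (Fin r) ℝ} (hV : IsOrthonormalCols V) :
    spikedMeasure n p r Λ V 1
      = Measure.map (Trep (fun k => √(1 + Λ k)) V)
          ((gaussianMatrix n r).prod (gaussianMatrix n p)) := by
  unfold spikedMeasure
  have mulsw : ∀ (x y z : Fin r → ℝ), x ⬝ᵥ (y * z) = (y * x) ⬝ᵥ z := by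
    intro x y z; simp only [dotProduct, Pi.mul_apply]
    exact Finset.sum_congr rfl fun _ _ => by ring
  refine law_eq _ _ (by fun_prop) (measurable_Trep _ _)
    (fun c i => (fun k => √(Λ k)) * (c i ᵥ* V)) (fun c i => (fun k => √(1 + Λ k)) * (c i ᵥ* V))
    (fun c => c) (fun c i => rs V (c i)) ?_ ?_ ?_
  · intro c w
    rw [← Finset.sum_add_distrib]
    refine Finset.sum_congr rfl fun i _ => ?_
    have : (fun j => (∑ k, w.1 i k * √(Λ k) * V j k) + √1 * w.2 i j)
        = V *ᵥ ((fun k => √(Λ k)) * w.1 i) + w.2 i := by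
      ext j
      simp only [Pi.add_apply, Matrix.mulVec, dotProduct, Pi.mul_apply, Real.sqrt_one, one_mul]
      congr 1
      exact Finset.sum_congr rfl fun _ _ => by ring
    rw [this, dotProduct_add, Matrix.dotProduct_mulVec, mulsw]
  · intro c w
    rw [← Finset.sum_add_distrib]
    refine Finset.sum_congr rfl fun i _ => ?_
    rw [Trep, dotProduct_add, Matrix.dotProduct_mulVec, mulsw, dot_rs_comm]
  · intro c
    rw [← Finset.sum_add_distrib, ← Finset.sum_add_distrib]
    refine Finset.sum_congr rfl fun i _ => ?_
    rw [dot_decomp hV (c i) (c i), ← add_assoc]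
    congr 1
    simp only [dotProduct, Pi.mul_apply]
    rw [← Finset.sum_add_distrib]
    refine Finset.sum_congr rfl fun k _ => ?_
    have h1 := Real.mul_self_sqrt (hΛ k)
    have h2 := Real.mul_self_sqrt (show 0 ≤ 1 + Λ k by linarith [hΛ k])
    linear_combination (c i ᵥ* V) k ^ 2 * h1 - (c i ᵥ* V) k ^ 2 * h2

lemma gauss_rep {n p r : ℕ} {V : Matrix (Fin p) (Fin r) ℝ} (hV : IsOrthonormalCols V) :
    gaussianMatrix n p
      = Measure.map (Trep 1 V) ((gaussianMatrix n r).prod (gaussianMatrix n p)) := by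
  have h := spiked_rep (n := n) (Λ := 0) (fun _ => le_rfl) hV
  have e : (fun k : Fin r => √(1 + (0 : Fin r → ℝ) k)) = 1 := by ext k; simp
  rw [e] at h
  rw [← h]
  unfold spikedMeasure
  simp

lemma spiked_scale {n p r : ℕ} {Λ : Fin r → ℝ}
    {V : Matrix (Fin p) (Fin r) ℝ} (σ2 : ℝ) (hσ : 0 < σ2) :
    spikedMeasure n p r Λ V σ2
      = Measure.map (fun x i j => √σ2 * x i j) (spikedMeasure n p r (fun k => Λ k / σ2) V 1) := by
  unfold spikedMeasure
  rw [Measure.map_map (by fun_prop) (by fun_prop)]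
  congr 1
  ext w i j
  simp only [Function.comp, Real.sqrt_one, one_mul, mul_add, Finset.mul_sum]
  congr 1
  refine Finset.sum_congr rfl fun k _ => ?_
  rw [Real.sqrt_div' _ hσ.le]
  have := (Real.sqrt_pos.2 hσ).ne'
  field_simp

instance instProbSpiked (n p r : ℕ) (Λ : Fin r → ℝ) (V : Matrix (Fin p) (Fin r) ℝ) (σ2 : ℝ) :
    IsProbabilityMeasure (spikedMeasure n p r Λ V σ2) := by
  unfold spikedMeasure
  exact Measure.isProbabilityMeasure_map (by fun_prop)

/-- law of `U y` for a unit vector `y` -/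
lemma map_unit_vec {n m : ℕ} (y : Fin m → ℝ) (hy : y ⬝ᵥ y = 1) :
    (gaussianMatrix n m).map (fun z i => z i ⬝ᵥ y) = stdGaussian (Fin n) := by
  have h1 : (stdGaussian (Fin m)).map (fun z => z ⬝ᵥ y) = gaussianReal 0 1 := by
    have hm : Measurable (fun z : Fin m → ℝ => z ⬝ᵥ y) := by simp only [dotProduct]; fun_prop
    have _ := Measure.isProbabilityMeasure_map (μ := stdGaussian (Fin m)) hm.aemeasurable
    refine Measure.ext_of_charFun ?_
    ext t
    rw [charFun_gaussianReal, charFun_apply_real, integral_map hm.aemeasurable (by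
      apply Continuous.aestronglyMeasurable; fun_prop)]
    have h := charfun_mat (n := 1) (fun _ => t • y)
    have hmp := measurePreserving_eval (fun _ : Fin 1 => stdGaussian (Fin m)) 0
    simp only [Fin.sum_univ_one] at h
    have h3 : ∫ z, Complex.exp (((t • y) ⬝ᵥ z : ℝ) * Complex.I) ∂(stdGaussian (Fin m))
        = Complex.exp (-(((t • y) ⬝ᵥ (t • y) : ℝ)) / 2) := by
      rw [← h, ← hmp.map_eq, integral_map hmp.measurable.aemeasurable (by
        apply Continuous.aestronglyMeasurable; simp only [dotProduct]; fun_prop)]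
      rfl
    simp only [smul_dotProduct, dotProduct_smul, hy, smul_eq_mul, mul_one] at h3
    have e : ∀ z : Fin m → ℝ, (t : ℂ) * ((z ⬝ᵥ y : ℝ) : ℂ) * Complex.I
        = ((t * y ⬝ᵥ z : ℝ) : ℂ) * Complex.I := by
      intro z; rw [dotProduct_comm z y]; push_cast; ring
    simp_rw [e, h3]
    congr 1; push_cast; ring
  unfold gaussianMatrix
  have hs : ∀ _ : Fin n, SigmaFinite ((stdGaussian (Fin m)).map (fun z => z ⬝ᵥ y)) := by
    intro _; rw [h1]; infer_instance
  rw [Measure.pi_map_pi (μ := fun _ : Fin n => stdGaussian (Fin m)) (f := fun _ z => z ⬝ᵥ y)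
    (fun _ => by
      apply Measurable.aemeasurable; simp only [dotProduct]; fun_prop)]
  rw [h1]; rfl

lemma frobSq_eq_trace {m k : Type*} [Fintype m] [Fintype k] (A : Matrix m k ℝ) :
    frobSq A = trace (Aᵀ * A) := by
  unfold frobSq
  rw [Finset.sum_comm]
  simp only [trace, Matrix.mul_apply, diag_apply, transpose_apply]
  exact Finset.sum_congr rfl fun i _ => Finset.sum_congr rfl fun j _ => by ring

lemma frobSq_nonneg {m k : Type*} [Fintype m] [Fintype k] (A : Matrix m k ℝ) : 0 ≤ frobSq A :=
  Finset.sum_nonneg fun _ _ => Finset.sum_nonneg fun _ _ => sq_nonneg _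

lemma frobSq_transpose {m k : Type*} [Fintype m] [Fintype k] (A : Matrix m k ℝ) :
    frobSq Aᵀ = frobSq A := by
  unfold frobSq; rw [Finset.sum_comm]; rfl

lemma loss_nonneg {p r : ℕ} (V W : Matrix (Fin p) (Fin r) ℝ) : 0 ≤ loss V W := frobSq_nonneg _

lemma loss_eq {p r : ℕ} {V W : Matrix (Fin p) (Fin r) ℝ} (hV : IsOrthonormalCols V)
    (hW : IsOrthonormalCols W) : loss V W = 2 * r - 2 * frobSq (Vᵀ * W) := by
  unfold IsOrthonormalCols at *
  unfold loss
  rw [frobSq_eq_trace, frobSq_eq_trace]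
  have h1 : trace ((V * Vᵀ) * (V * Vᵀ)) = r := by
    rw [show (V * Vᵀ) * (V * Vᵀ) = V * (Vᵀ * V) * Vᵀ by simp only [Matrix.mul_assoc], hV,
      Matrix.mul_one, trace_mul_comm, hV]; simp
  have h2 : trace ((W * Wᵀ) * (W * Wᵀ)) = r := by
    rw [show (W * Wᵀ) * (W * Wᵀ) = W * (Wᵀ * W) * Wᵀ by simp only [Matrix.mul_assoc], hW,
      Matrix.mul_one, trace_mul_comm, hW]; simp
  have h3 : trace ((V * Vᵀ) * (W * Wᵀ)) = trace ((Vᵀ * W)ᵀ * (Vᵀ * W)) := by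
    rw [show (V * Vᵀ) * (W * Wᵀ) = (V * Vᵀ * W) * Wᵀ by simp only [Matrix.mul_assoc],
      trace_mul_comm]
    simp only [transpose_mul, transpose_transpose, Matrix.mul_assoc]
  have h4 : trace ((W * Wᵀ) * (V * Vᵀ)) = trace ((Vᵀ * W)ᵀ * (Vᵀ * W)) := by
    rw [trace_mul_comm, h3]
  simp only [transpose_sub, transpose_mul, transpose_transpose, sub_mul, mul_sub, trace_sub] at *
  rw [h1, h2, h3, h4]; ring

lemma loss_comm {p r : ℕ} (V W : Matrix (Fin p) (Fin r) ℝ) : loss V W = loss W V := by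
  unfold loss frobSq
  refine Finset.sum_congr rfl fun i _ => Finset.sum_congr rfl fun j _ => ?_
  simp only [Matrix.sub_apply]; ring

lemma loss_le {p r : ℕ} {V W : Matrix (Fin p) (Fin r) ℝ} (hV : IsOrthonormalCols V)
    (hW : IsOrthonormalCols W) : loss V W ≤ 2 * r := by
  rw [loss_eq hV hW]; linarith [frobSq_nonneg (Vᵀ * W)]

/-- loss via the residual -/
lemma loss_eq_resid {p r : ℕ} {V W : Matrix (Fin p) (Fin r) ℝ} (hV : IsOrthonormalCols V)
    (hW : IsOrthonormalCols W) : loss V W = 2 * frobSq (W - V * (Vᵀ * W)) := by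
  rw [loss_eq hV hW]
  unfold IsOrthonormalCols at *
  rw [frobSq_eq_trace, frobSq_eq_trace]
  have h : (W - V * (Vᵀ * W))ᵀ * (W - V * (Vᵀ * W)) = 1 - (Vᵀ * W)ᵀ * (Vᵀ * W) := by
    have a1 : (V * (Vᵀ * W))ᵀ * W = (Vᵀ * W)ᵀ * (Vᵀ * W) := by
      simp only [transpose_mul, transpose_transpose, Matrix.mul_assoc]
    have a2 : Wᵀ * (V * (Vᵀ * W)) = (Vᵀ * W)ᵀ * (Vᵀ * W) := by
      simp only [transpose_mul, transpose_transpose, Matrix.mul_assoc]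
    have a3 : (V * (Vᵀ * W))ᵀ * (V * (Vᵀ * W)) = (Vᵀ * W)ᵀ * (Vᵀ * W) := by
      rw [transpose_mul, Matrix.mul_assoc, ← Matrix.mul_assoc Vᵀ V, hV, Matrix.one_mul]
    rw [transpose_sub, Matrix.sub_mul, Matrix.mul_sub, Matrix.mul_sub, a1, a2, a3, hW]; abel
  rw [h, trace_sub]; simp; ring

lemma frobSq_cross {p r : ℕ} {V W : Matrix (Fin p) (Fin r) ℝ} (hV : IsOrthonormalCols V)
    (hW : IsOrthonormalCols W) : frobSq (Vᵀ * W) ≤ r := by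
  have := loss_nonneg V W
  rw [loss_eq hV hW] at this; linarith

lemma weakLq_forward {p r s : ℕ} (hsp : s ≤ p) {V : Matrix (Fin p) (Fin r) ℝ}
    (h : weakLq 0 V ≤ s) : ∃ B : Finset (Fin p), B.card = s ∧ ∀ j ∉ B, ∀ k, V j k = 0 := by
  classical
  refine ⟨(Finset.univ.filter fun j : Fin p => (j : ℕ) < s).image
    (Tuple.sort (fun i => - rowNorm V i)), ?_, ?_⟩
  · rw [Finset.card_image_of_injective _ (Equiv.injective _)]
    rw [Fin.card_filter_val_lt]; omega
  · intro j hj k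
    obtain ⟨i, rfl⟩ := (Tuple.sort (fun i => - rowNorm V i)).surjective j
    have hi : ¬ (i : ℕ) < s := by
      intro hi; exact hj (Finset.mem_image_of_mem _ (by simp [hi]))
    have h0 : sortedRowNorm V i = 0 := by
      by_contra hne
      have h2 := le_ciSup (f := fun j : Fin p => ((j : ℕ) + 1 : ℝ) *
        (if sortedRowNorm V j = 0 then 0 else (sortedRowNorm V j) ^ (0:ℝ)))
        (Set.finite_range _).bddAbove i
      have h3 : ((i : ℕ) + 1 : ℝ) ≤ s := by
        have h4 := h2.trans h
        simpa only [hne, if_false, Real.rpow_zero, mul_one] using h4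
      have : (i : ℕ) + 1 ≤ s := by exact_mod_cast h3
      omega
    unfold sortedRowNorm rowNorm at h0
    rw [Real.sqrt_eq_zero (Finset.sum_nonneg fun _ _ => sq_nonneg _),
      Finset.sum_eq_zero_iff_of_nonneg (fun _ _ => sq_nonneg _)] at h0
    exact pow_eq_zero_iff (two_ne_zero) |>.1 (h0 k (Finset.mem_univ _))

lemma weakLq_backward {p r s : ℕ} {V : Matrix (Fin p) (Fin r) ℝ}
    (B : Finset (Fin p)) (hB : B.card ≤ s) (h : ∀ j ∉ B, ∀ k, V j k = 0) : weakLq 0 V ≤ s := by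
  classical
  unfold weakLq
  refine Real.iSup_le (fun j => ?_) (Nat.cast_nonneg _)
  split_ifs with h0
  · simp
  · rw [Real.rpow_zero, mul_one]
    have hpos : 0 < sortedRowNorm V j := lt_of_le_of_ne (Real.sqrt_nonneg _) (Ne.symm h0)
    have hsub : (Finset.Iic j).image (Tuple.sort (fun i => - rowNorm V i)) ⊆ B := by
      intro i hi
      obtain ⟨k, hk, rfl⟩ := Finset.mem_image.1 hi
      by_contra hn
      have hm := Tuple.monotone_sort (fun i => - rowNorm V i) (Finset.mem_Iic.1 hk)
      simp only [Function.comp] at hm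
      have h1 : rowNorm V ((Tuple.sort fun i => -rowNorm V i) k) = 0 := by
        rw [rowNorm, Finset.sum_eq_zero (fun k _ => by rw [h _ hn k]; ring), Real.sqrt_zero]
      unfold sortedRowNorm at hpos
      linarith
    have hc := Finset.card_le_card hsub
    rw [Finset.card_image_of_injective _ (Equiv.injective _), Fin.card_Iic] at hc
    exact_mod_cast hc.trans hB

lemma map_withDensity_comp {α β : Type*} [MeasurableSpace α] [MeasurableSpace β] (ν : Measure α)
    (T : α → β) (hT : Measurable T) (f : β → ℝ≥0∞) (hf : Measurable f) :
    (ν.withDensity (fun a => f (T a))).map T = (ν.map T).withDensity f := by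
  ext s hs
  rw [Measure.map_apply hT hs, withDensity_apply _ (hT hs), withDensity_apply _ hs,
    setLIntegral_map hs hf hT]

lemma Trep_vecMul {n p r : ℕ} {V : Matrix (Fin p) (Fin r) ℝ} (hV : IsOrthonormalCols V)
    (d : Fin r → ℝ) (w : (Fin n → Fin r → ℝ) × (Fin n → Fin p → ℝ)) (i : Fin n) :
    Trep d V w i ᵥ* V = d * w.1 i := by
  unfold Trep
  rw [Matrix.add_vecMul, mulVec_vecMul_self hV, rs_vecMul hV, add_zero]

/-- density of the spiked measure with equal spikes -/
lemma spiked_density {n p r : ℕ} {V : Matrix (Fin p) (Fin r) ℝ} (hV : IsOrthonormalCols V)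
    (lam : ℝ) (hl : 0 < lam) :
    spikedMeasure n p r (fun _ => lam) V 1
      = (gaussianMatrix n p).withDensity (fun x => ENNReal.ofReal
          (((√(1 + lam))⁻¹) ^ (n * r)
            * exp ((1 - (1 + lam)⁻¹) / 2 * ∑ i, ∑ k, ((x i ᵥ* V) k) ^ 2))) := by
  rw [spiked_rep (fun _ => hl.le) hV]
  have h1 : (Trep (fun _ : Fin r => √(1 + lam)) V)
      = (Trep (n := n) 1 V) ∘ (Prod.map (fun z i j => √(1 + lam) * z i j) id) := by
    ext w i j
    simp only [Function.comp, Trep, Prod.map]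
    simp
    rfl
  have hm : Measurable (fun x : Fin n → Fin p → ℝ => ENNReal.ofReal
          (((√(1 + lam))⁻¹) ^ (n * r)
            * exp ((1 - (1 + lam)⁻¹) / 2 * ∑ i, ∑ k, ((x i ᵥ* V) k) ^ 2))) := by
    simp only [Matrix.vecMul, dotProduct]; fun_prop
  have hp : IsProbabilityMeasure
      ((gaussianMatrix n r).map (fun z i j => √(1 + lam) * z i j)) :=
    Measure.isProbabilityMeasure_map (Measurable.aemeasurable (by fun_prop))
  rw [h1, ← Measure.map_map (measurable_Trep _ _) (by fun_prop),
    ← Measure.map_prod_map _ _ (by fun_prop) measurable_id, Measure.map_id]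
  rw [gauss_scale_mat n r (1 + lam) (by linarith), prod_withDensity_left (by fun_prop)]
  conv_rhs => rw [gauss_rep (n := n) hV]
  rw [← map_withDensity_comp _ _ (measurable_Trep _ _) _ hm]
  congr 2
  ext w
  simp only [Trep_vecMul hV, one_mul]
  rw [Finset.prod_congr rfl (fun i _ => (ENNReal.ofReal_prod_of_nonneg (fun (j : Fin r) _ =>
    (mul_nonneg (inv_nonneg.2 (Real.sqrt_nonneg (1 + lam))) (Real.exp_pos _).le))).symm)]
  rw [← ENNReal.ofReal_prod_of_nonneg (fun i _ => by positivity)]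
  simp_rw [Finset.prod_mul_distrib, ← Real.exp_sum, ← Finset.mul_sum]
  simp [← pow_mul, mul_comm]

lemma lin_mat {n m : ℕ} (y : Fin n → Fin m → ℝ) (b : ℝ) (hb : 0 ≤ b) :
    ENNReal.ofReal (exp (b * ∑ i, ∑ j, y i j ^ 2))
      = ∫⁻ z, ENNReal.ofReal (exp (√(2 * b) * ∑ i, ∑ j, y i j * z i j)) ∂(gaussianMatrix n m) := by
  have h := gauss_master_mat (fun i j => √(2 * b) * y i j) 0 (by norm_num)
  have e : ∀ z : Fin n → Fin m → ℝ, ∑ i, ∑ j, (√(2 * b) * y i j * z i j + 0 * z i j ^ 2)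
      = √(2 * b) * ∑ i, ∑ j, y i j * z i j := by
    intro z; simp only [Finset.mul_sum, zero_mul, add_zero, mul_assoc]
  simp_rw [e] at h
  rw [h]
  congr 1
  simp only [mul_pow, Real.sq_sqrt (by linarith : 0 ≤ 2 * b), ← Finset.mul_sum]
  simp
  ring

lemma inner_gauss {n p r : ℕ} {V : Matrix (Fin p) (Fin r) ℝ} (hV : IsOrthonormalCols V)
    (v : Fin n → Fin p → ℝ) (c : ℝ) (hc : c < 1 / 2) :
    ∫⁻ x, ENNReal.ofReal (exp (∑ i, x i ⬝ᵥ v i + c * ∑ i, ∑ k, ((x i ᵥ* V) k) ^ 2))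
        ∂(gaussianMatrix n p)
      = ENNReal.ofReal (√((1 - 2 * c)⁻¹) ^ (n * r)
          * exp ((∑ i, ∑ k, ((v i ᵥ* V) k) ^ 2) / (2 * (1 - 2 * c))
            + (∑ i, rs V (v i) ⬝ᵥ rs V (v i)) / 2)) := by
  have hm : Measurable (fun x : Fin n → Fin p → ℝ => ENNReal.ofReal
      (exp (∑ i, x i ⬝ᵥ v i + c * ∑ i, ∑ k, ((x i ᵥ* V) k) ^ 2))) := by
    simp only [Matrix.vecMul, dotProduct]; fun_prop
  rw [gauss_rep (n := n) hV, lintegral_map hm (measurable_Trep _ _)]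
  have e : ∀ w : (Fin n → Fin r → ℝ) × (Fin n → Fin p → ℝ),
      ENNReal.ofReal (exp (∑ i, Trep 1 V w i ⬝ᵥ v i
        + c * ∑ i, ∑ k, ((Trep 1 V w i ᵥ* V) k) ^ 2))
      = ENNReal.ofReal (exp (∑ i, ∑ j, ((v i ᵥ* V) j * w.1 i j + c * w.1 i j ^ 2)))
        * ENNReal.ofReal (exp (∑ i, ∑ j, (rs V (v i) j * w.2 i j + 0 * w.2 i j ^ 2))) := by
    intro w
    rw [← ENNReal.ofReal_mul (Real.exp_pos _).le, ← Real.exp_add]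
    congr 2
    simp only [Trep_vecMul hV, one_mul, Finset.mul_sum, ← Finset.sum_add_distrib]
    refine Finset.sum_congr rfl fun i _ => ?_
    simp only [Trep, one_mul, add_dotProduct, dot_mulVec_left, dot_rs_comm (w.2 i)]
    rw [dotProduct_comm (w.1 i), dotProduct_comm (w.2 i)]
    simp only [dotProduct, Finset.sum_add_distrib, zero_mul, Finset.sum_const_zero]
    ring
  simp_rw [e]
  rw [lintegral_prod_mul
    (f := fun z : Fin n → Fin r → ℝ => ENNReal.ofReal (exp (∑ i, ∑ j, ((v i ᵥ* V) j * z i j + c * z i j ^ 2))))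
    (g := fun z : Fin n → Fin p → ℝ => ENNReal.ofReal (exp (∑ i, ∑ j, (rs V (v i) j * z i j + 0 * z i j ^ 2))))
    (Measurable.aemeasurable (by fun_prop)) (Measurable.aemeasurable (by fun_prop)),
    gauss_master_mat _ c hc,
    gauss_master_mat _ 0 (by norm_num), ← ENNReal.ofReal_mul (by positivity)]
  congr 1
  simp only [dotProduct, mul_zero, sub_zero, inv_one, Real.sqrt_one, one_pow, one_mul, mul_one]
  rw [mul_assoc, ← Real.exp_add]
  congr 3
  simp only [sq]

lemma row_unit {r : ℕ} (u : Fin r → ℝ) (hu : ∑ k, u k ^ 2 = 1) (α τ : ℝ) (hα : α < 1 / 2)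
    (hτ0 : 0 ≤ τ) (hτ : 2 * τ < 1 - 2 * α) :
    ∫⁻ h, ENNReal.ofReal (exp (α * ∑ k, h k ^ 2 + τ * (∑ k, u k * h k) ^ 2)) ∂(stdGaussian (Fin r))
      = ENNReal.ofReal (√((1 - 2 * α)⁻¹) ^ r * √((1 - 2 * (τ / (1 - 2 * α)))⁻¹)) := by
  have e : ∀ h : Fin r → ℝ, ENNReal.ofReal (exp (α * ∑ k, h k ^ 2 + τ * (∑ k, u k * h k) ^ 2))
      = ∫⁻ y, ENNReal.ofReal (exp (∑ k, (√(2 * τ) * y * u k * h k + α * h k ^ 2)))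
          ∂(gaussianReal 0 1) := by
    intro h
    have g := gauss_master1 (√(2 * τ) * ∑ k, u k * h k) 0 (by norm_num)
    have e2 : ∀ y : ℝ, ENNReal.ofReal (exp (∑ k, (√(2 * τ) * y * u k * h k + α * h k ^ 2)))
        = ENNReal.ofReal (exp (α * ∑ k, h k ^ 2)) *
          ENNReal.ofReal (exp ((√(2 * τ) * ∑ k, u k * h k) * y + 0 * y ^ 2)) := by
      intro y
      rw [← ENNReal.ofReal_mul (Real.exp_pos _).le, ← Real.exp_add]
      congr 2
      simp only [Finset.sum_add_distrib, Finset.mul_sum, Finset.sum_mul, zero_mul, add_zero]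
      rw [add_comm]
      congr 1
      exact Finset.sum_congr rfl fun _ _ => by ring
    simp_rw [e2]
    rw [lintegral_const_mul _ (by fun_prop), g, ← ENNReal.ofReal_mul (Real.exp_pos _).le]
    congr 1
    rw [Real.exp_add]
    congr 1
    rw [mul_pow, Real.sq_sqrt (by linarith)]
    simp
    ring
  simp_rw [e]
  rw [lintegral_lintegral_swap (by fun_prop)]
  simp_rw [gauss_master_vec _ α hα]
  have h1 : 0 < 1 - 2 * α := by linarith
  have hc : τ / (1 - 2 * α) < 1 / 2 := by rw [div_lt_iff₀ h1]; linarith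
  have g := gauss_master1 0 (τ / (1 - 2 * α)) hc
  have e3 : ∀ y : ℝ, ENNReal.ofReal (√((1 - 2 * α)⁻¹) ^ Fintype.card (Fin r) *
      exp ((∑ i, (√(2 * τ) * y * u i) ^ 2) / (2 * (1 - 2 * α))))
      = ENNReal.ofReal (√((1 - 2 * α)⁻¹) ^ r)
        * ENNReal.ofReal (exp (0 * y + τ / (1 - 2 * α) * y ^ 2)) := by
    intro y
    rw [← ENNReal.ofReal_mul (by positivity)]
    simp only [Fintype.card_fin]
    congr 3
    simp only [mul_pow, ← Finset.mul_sum, hu, Real.sq_sqrt (by linarith : 0 ≤ 2 * τ)]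
    field_simp
    ring
  simp_rw [e3]
  rw [lintegral_const_mul _ (by fun_prop), g, ← ENNReal.ofReal_mul (by positivity)]
  simp

lemma row_gen {p r : ℕ} (G : Matrix (Fin p) (Fin r) ℝ) (α δ : ℝ) (hα : α < 1 / 2) (hδ : 0 ≤ δ)
    (hτ : 2 * (δ * frobSq G) < 1 - 2 * α) :
    ∫⁻ h, ENNReal.ofReal (exp (α * ∑ k, h k ^ 2 + δ * ∑ j, (∑ k, G j k * h k) ^ 2))
        ∂(stdGaussian (Fin r))
      ≤ ENNReal.ofReal (√((1 - 2 * α)⁻¹) ^ r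
          * √((1 - 2 * (δ * frobSq G / (1 - 2 * α)))⁻¹)) := by
  set t := frobSq G with ht
  have ht0 : 0 ≤ t := frobSq_nonneg G
  rcases ht0.eq_or_lt with h0 | hpos
  · have hG : ∀ j k, G j k = 0 := by
      intro j k
      have h1 : frobSq G = 0 := by rw [← ht, ← h0]
      have h2 := (Finset.sum_eq_zero_iff_of_nonneg
        (fun _ _ => Finset.sum_nonneg fun _ _ => sq_nonneg _)).1 h1 j (Finset.mem_univ _)
      have h3 := (Finset.sum_eq_zero_iff_of_nonneg (fun _ _ => sq_nonneg _)).1 h2 k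
        (Finset.mem_univ _)
      exact pow_eq_zero_iff two_ne_zero |>.1 h3
    have g := gauss_master_vec (ι := Fin r) 0 α hα
    simp only [← h0, hG]
    simp only [Pi.zero_apply, zero_mul, zero_add, ← Finset.mul_sum] at g
    simp only [zero_mul, Finset.sum_const_zero, ne_eq, OfNat.ofNat_ne_zero, not_false_eq_true,
      zero_pow, mul_zero, add_zero]
    rw [g]; simp
  · set w : Fin p → ℝ := fun j => (∑ k, G j k ^ 2) with hw
    have hw0 : ∀ j, 0 ≤ w j := fun j => Finset.sum_nonneg fun _ _ => sq_nonneg _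
    have hwt : ∑ j, w j / t = 1 := by
      rw [← Finset.sum_div]; exact div_self hpos.ne'
    set u : Fin p → Fin r → ℝ := fun j k => (√(w j))⁻¹ * G j k with hu
    have hGu : ∀ j k, G j k = √(w j) * u j k := by
      intro j k
      rcases (hw0 j).eq_or_lt with h | h
      · have h2 : ∑ k, G j k ^ 2 = 0 := h.symm
        rw [Finset.sum_eq_zero_iff_of_nonneg (fun _ _ => sq_nonneg _)] at h2
        rw [pow_eq_zero_iff two_ne_zero |>.1 (h2 k (Finset.mem_univ _)), ← h]; simp
      · rw [hu]; have := (Real.sqrt_pos.2 h).ne'; field_simp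
    have hpt : ∀ h : Fin r → ℝ,
        ENNReal.ofReal (exp (α * ∑ k, h k ^ 2 + δ * ∑ j, (∑ k, G j k * h k) ^ 2))
        ≤ ∑ j, ENNReal.ofReal (w j / t) *
          ENNReal.ofReal (exp (α * ∑ k, h k ^ 2 + δ * t * (∑ k, u j k * h k) ^ 2)) := by
      intro h
      simp_rw [← ENNReal.ofReal_mul (div_nonneg (hw0 _) hpos.le)]
      rw [← ENNReal.ofReal_sum_of_nonneg
        (fun j _ => mul_nonneg (div_nonneg (hw0 j) hpos.le) (Real.exp_pos _).le)]
      apply ENNReal.ofReal_le_ofReal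
      have hJ := convexOn_exp.map_sum_le (t := Finset.univ) (w := fun j => w j / t)
        (p := fun j => α * ∑ k, h k ^ 2 + δ * t * (∑ k, u j k * h k) ^ 2)
        (fun j _ => div_nonneg (hw0 j) hpos.le) hwt (fun _ _ => Set.mem_univ _)
      simp only [smul_eq_mul] at hJ
      refine le_trans (le_of_eq ?_) hJ
      congr 1
      simp only [mul_add, Finset.sum_add_distrib]
      rw [← Finset.sum_mul, hwt, one_mul]
      congr 1
      rw [Finset.mul_sum]
      refine Finset.sum_congr rfl fun j _ => ?_
      have : ∑ k, G j k * h k = √(w j) * ∑ k, u j k * h k := by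
        rw [Finset.mul_sum]; exact Finset.sum_congr rfl fun k _ => by rw [hGu]; ring
      rw [this, mul_pow, Real.sq_sqrt (hw0 j)]
      field_simp
    refine (lintegral_mono hpt).trans ?_
    rw [lintegral_finsetSum _ (fun j _ => by fun_prop)]
    have hone : ∀ j, ENNReal.ofReal (w j / t) * ∫⁻ h, ENNReal.ofReal
        (exp (α * ∑ k, h k ^ 2 + δ * t * (∑ k, u j k * h k) ^ 2)) ∂(stdGaussian (Fin r))
        = ENNReal.ofReal (w j / t) * ENNReal.ofReal (√((1 - 2 * α)⁻¹) ^ r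
          * √((1 - 2 * (δ * t / (1 - 2 * α)))⁻¹)) := by
      intro j
      rcases (hw0 j).eq_or_lt with h | h
      · rw [← h]; simp
      · rw [row_unit (u j) _ α (δ * t) hα (by positivity) hτ]
        simp only [hu, mul_pow, ← Finset.mul_sum]
        rw [inv_pow, Real.sq_sqrt h.le]
        exact inv_mul_cancel₀ h.ne'
    have hmeas : ∀ j, Measurable (fun h : Fin r → ℝ => ENNReal.ofReal
        (exp (α * ∑ k, h k ^ 2 + δ * t * (∑ k, u j k * h k) ^ 2))) := fun j => by fun_prop
    rw [Finset.sum_congr rfl (fun j _ => (lintegral_const_mul _ (hmeas j)).trans (hone j))]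
    rw [← Finset.sum_mul, ← ENNReal.ofReal_sum_of_nonneg (fun j _ => div_nonneg (hw0 j) hpos.le),
      hwt]
    simp

lemma frobSq_resid_eq {p r : ℕ} (V₀ V₁ : Matrix (Fin p) (Fin r) ℝ) (h : Fin r → ℝ) :
    rs V₀ (V₁ *ᵥ h) = (V₁ - V₀ * (V₀ᵀ * V₁)) *ᵥ h := by
  unfold rs
  rw [Matrix.sub_mulVec, ← Matrix.mulVec_mulVec, ← Matrix.mulVec_mulVec, ← Matrix.mulVec_transpose]

lemma chi_int {n p r : ℕ} {V₀ V₁ : Matrix (Fin p) (Fin r) ℝ} (hV₀ : IsOrthonormalCols V₀)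
    (hV₁ : IsOrthonormalCols V₁) (lam : ℝ) (hl : 0 < lam) (hs : hfun lam * loss V₀ V₁ ≤ 1 / 2) :
    ∫⁻ x, ENNReal.ofReal (((√(1 + lam))⁻¹) ^ (n * r)
        * exp ((1 - (1 + lam)⁻¹) * (∑ i, ∑ k, ((x i ᵥ* V₁) k) ^ 2)
          - (1 - (1 + lam)⁻¹) / 2 * ∑ i, ∑ k, ((x i ᵥ* V₀) k) ^ 2)) ∂(gaussianMatrix n p)
      ≤ ENNReal.ofReal (exp (n * (hfun lam * loss V₀ V₁))) := by
  set β := 1 - (1 + lam)⁻¹ with hβ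
  have hl1 : 0 < 1 + lam := by linarith
  have hβ' : β = lam / (1 + lam) := by rw [hβ]; field_simp; ring
  have hβ0 : 0 < β := by rw [hβ']; positivity
  set α := β / (1 + β) with hα
  have hα' : α = lam / (1 + 2 * lam) := by
    rw [hα, hβ']; field_simp; ring
  have hα2 : 1 - 2 * α = (1 + 2 * lam)⁻¹ := by rw [hα']; field_simp; ring
  have hα3 : α < 1 / 2 := by
    have : 0 < (1 + 2 * lam)⁻¹ := by positivity
    linarith
  set G := V₁ - V₀ * (V₀ᵀ * V₁) with hG
  have hGt : loss V₀ V₁ = 2 * frobSq G := loss_eq_resid hV₀ hV₁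
  have hδ : β - α = lam ^ 2 / ((1 + lam) * (1 + 2 * lam)) := by
    rw [hβ', hα']; field_simp; ring
  have hδ0 : 0 ≤ β - α := by rw [hδ]; positivity
  have hht : (β - α) * frobSq G / (1 - 2 * α) = hfun lam * frobSq G := by
    rw [hα2, hδ, hfun]; field_simp; ring
  have hK : ∀ x : Fin n → Fin p → ℝ, ENNReal.ofReal (((√(1 + lam))⁻¹) ^ (n * r)
        * exp (β * (∑ i, ∑ k, ((x i ᵥ* V₁) k) ^ 2) - β / 2 * ∑ i, ∑ k, ((x i ᵥ* V₀) k) ^ 2))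
      = ENNReal.ofReal (((√(1 + lam))⁻¹) ^ (n * r)) *
        ∫⁻ H, ENNReal.ofReal (exp (∑ i, x i ⬝ᵥ (√(2 * β) • (V₁ *ᵥ H i))
            + (-β / 2) * ∑ i, ∑ k, ((x i ᵥ* V₀) k) ^ 2)) ∂(gaussianMatrix n r) := by
    intro x
    rw [ENNReal.ofReal_mul (by positivity), sub_eq_add_neg, Real.exp_add,
      ENNReal.ofReal_mul (Real.exp_pos _).le, lin_mat _ β hβ0.le]
    congr 1
    rw [← lintegral_mul_const _ (by fun_prop)]
    refine lintegral_congr fun H => ?_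
    rw [← ENNReal.ofReal_mul (Real.exp_pos _).le, ← Real.exp_add]
    congr 2
    congr 1
    · rw [Finset.mul_sum]
      refine Finset.sum_congr rfl fun i _ => ?_
      rw [dotProduct_smul, smul_eq_mul, dotProduct_comm, dot_mulVec_left, dotProduct_comm]
      rfl
    · ring
  simp_rw [hK]
  have hm1 : Measurable (fun q : (Fin n → Fin p → ℝ) × (Fin n → Fin r → ℝ) =>
      ENNReal.ofReal (exp (∑ i, q.1 i ⬝ᵥ (√(2 * β) • (V₁ *ᵥ q.2 i))
            + (-β / 2) * ∑ i, ∑ k, ((q.1 i ᵥ* V₀) k) ^ 2))) := by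
    simp only [Matrix.vecMul, Matrix.mulVec, dotProduct, Pi.smul_apply, smul_eq_mul]; fun_prop
  rw [lintegral_const_mul _ hm1.lintegral_prod_right', lintegral_lintegral_swap hm1.aemeasurable]
  simp_rw [inner_gauss hV₀ _ (-β / 2) (by linarith)]
  have hrow : ∀ H : Fin n → Fin r → ℝ,
      ENNReal.ofReal (√((1 - 2 * (-β / 2))⁻¹) ^ (n * r)
          * exp ((∑ i, ∑ k, (((√(2 * β) • (V₁ *ᵥ H i)) ᵥ* V₀) k) ^ 2) / (2 * (1 - 2 * (-β / 2)))
            + (∑ i, rs V₀ (√(2 * β) • (V₁ *ᵥ H i)) ⬝ᵥ rs V₀ (√(2 * β) • (V₁ *ᵥ H i))) / 2))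
      = ENNReal.ofReal (√((1 + β)⁻¹) ^ (n * r)) *
        ∏ i, ENNReal.ofReal (exp (α * ∑ k, H i k ^ 2
          + (β - α) * ∑ j, (∑ k, G j k * H i k) ^ 2)) := by
    intro H
    rw [show 1 - 2 * (-β / 2) = 1 + β by ring, ENNReal.ofReal_mul (by positivity),
      ← ofReal_exp_sum]
    congr 3
    rw [Finset.sum_div, Finset.sum_div, ← Finset.sum_add_distrib]
    refine Finset.sum_congr rfl fun i _ => ?_
    have hk : ∑ j, (∑ k, G j k * H i k) ^ 2
        = rs V₀ (V₁ *ᵥ H i) ⬝ᵥ rs V₀ (V₁ *ᵥ H i) := by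
      rw [frobSq_resid_eq, ← hG]
      simp only [Matrix.mulVec, dotProduct, sq]
    have hd := dot_decomp hV₀ (V₁ *ᵥ H i) (V₁ *ᵥ H i)
    rw [dot_mulVec_mulVec hV₁] at hd
    have h1 : ∑ k, H i k ^ 2 = H i ⬝ᵥ H i := by simp only [dotProduct, sq]
    have h2 : ∑ k, (((√(2 * β) • (V₁ *ᵥ H i)) ᵥ* V₀) k) ^ 2
        = 2 * β * (((V₁ *ᵥ H i) ᵥ* V₀) ⬝ᵥ ((V₁ *ᵥ H i) ᵥ* V₀)) := by
      rw [Matrix.smul_vecMul]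
      simp only [Pi.smul_apply, smul_eq_mul, mul_pow, dotProduct,
        Real.sq_sqrt (by linarith : 0 ≤ 2 * β), ← Finset.mul_sum]
      simp only [sq]
    rw [h1, h2, hk, rs_smul, smul_dotProduct, dotProduct_smul, smul_eq_mul, smul_eq_mul,
      ← mul_assoc, Real.mul_self_sqrt (by linarith), hd, hα]
    have : 1 + β ≠ 0 := by linarith
    field_simp
    ring
  simp_rw [hrow]
  have hm2 : Measurable (fun h : Fin r → ℝ => ENNReal.ofReal (exp (α * ∑ k, h k ^ 2
          + (β - α) * ∑ j, (∑ k, G j k * h k) ^ 2))) := by fun_prop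
  rw [lintegral_const_mul _ (by
    exact Finset.measurable_prod _ fun i _ => hm2.comp (measurable_pi_apply i))]
  unfold gaussianMatrix
  rw [lintegral_pi_prod (fun _ : Fin n => stdGaussian (Fin r)) _ (fun _ => hm2)]
  have hτ : 2 * ((β - α) * frobSq G) < 1 - 2 * α := by
    have h3 : hfun lam * frobSq G ≤ 1 / 4 := by rw [hGt] at hs; linarith
    have h4 : 0 < 1 - 2 * α := by linarith
    rw [← hht, div_le_iff₀ h4] at h3
    linarith
  have hR := row_gen G α (β - α) hα3 hδ0 hτ
  refine (mul_le_mul_right (mul_le_mul_right (Finset.prod_le_prod' fun i _ => hR) _) _).trans ?_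
  rw [Finset.prod_const, ← ENNReal.ofReal_pow (by positivity), ← ENNReal.ofReal_mul (by positivity),
    ← ENNReal.ofReal_mul (by positivity)]
  apply ENNReal.ofReal_le_ofReal
  rw [Finset.card_univ, Fintype.card_fin, mul_pow, ← pow_mul, mul_comm r n, ← mul_assoc, ← mul_assoc,
    ← mul_pow, ← mul_pow]
  have hone : (√(1 + lam))⁻¹ * √((1 + β)⁻¹) * √((1 - 2 * α)⁻¹) = 1 := by
    rw [← Real.sqrt_inv, ← Real.sqrt_mul (by positivity), ← Real.sqrt_mul (by positivity), hα2, hβ']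
    rw [show (1 + lam)⁻¹ * (1 + lam / (1 + lam))⁻¹ * (1 + 2 * lam)⁻¹⁻¹ = 1 by field_simp; ring]
    simp
  rw [hone, one_pow, one_mul, hht, Real.exp_nat_mul, hGt]
  refine pow_le_pow_left₀ (Real.sqrt_nonneg _) ?_ n
  set x := hfun lam * frobSq G with hx
  have hx1 : x ≤ 1 / 4 := by rw [hGt] at hs; rw [hx]; linarith
  have hx0 : 0 ≤ x := mul_nonneg (by unfold hfun; positivity) (frobSq_nonneg _)
  rw [show hfun lam * (2 * frobSq G) = 2 * x by rw [hx]; ring]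
  rw [Real.sqrt_le_left (Real.exp_pos _).le, ← Real.exp_nat_mul, inv_le_comm₀ (by linarith) (Real.exp_pos _), ← Real.exp_neg]
  have h5 := Real.exp_bound_div_one_sub_of_interval (x := 2 * x) (by linarith) (by linarith)
  have h6 : rexp (-((2:ℕ) * (2 * x))) ≤ 1 / (1 + 2 * (2 * x)) := by
    rw [Real.exp_neg, ← one_div]
    refine one_div_le_one_div_of_le (by linarith) ?_
    have := Real.add_one_le_exp ((2:ℕ) * (2 * x))
    push_cast at this ⊢
    linarith
  refine h6.trans ?_
  rw [div_le_iff₀ (by linarith)]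
  nlinarith

/-- two point comparison -/
lemma chi_cmp {n p r : ℕ} {V₀ V₁ : Matrix (Fin p) (Fin r) ℝ} (hV₀ : IsOrthonormalCols V₀)
    (hV₁ : IsOrthonormalCols V₁) (lam : ℝ) (hl : 0 < lam) (hs : hfun lam * loss V₀ V₁ ≤ 1 / 2)
    (c : ℝ) (hc : 0 < c) (A : Set (Fin n → Fin p → ℝ)) (hA : MeasurableSet A) :
    (spikedMeasure n p r (fun _ => lam) V₁ 1).real A
      ≤ c / 2 * (spikedMeasure n p r (fun _ => lam) V₀ 1).real A
        + exp (n * (hfun lam * loss V₀ V₁)) / (2 * c) := by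
  have hInteg := chi_int (n := n) hV₀ hV₁ lam hl hs
  have key : (spikedMeasure n p r (fun _ => lam) V₁ 1) A
      ≤ ENNReal.ofReal (c / 2) * (spikedMeasure n p r (fun _ => lam) V₀ 1) A
        + ENNReal.ofReal (1 / (2 * c)) * ENNReal.ofReal (exp (n * (hfun lam * loss V₀ V₁))) := by
    rw [spiked_density hV₁ lam hl, spiked_density hV₀ lam hl, withDensity_apply _ hA,
      withDensity_apply _ hA]
    refine le_trans ?_ (add_le_add_right (mul_le_mul_right
      ((setLIntegral_le_lintegral A _).trans hInteg) _) _)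
    have hm0 : ∀ V : Matrix (Fin p) (Fin r) ℝ, Measurable (fun x : Fin n → Fin p → ℝ =>
        ∑ i, ∑ k, ((x i ᵥ* V) k) ^ 2) := by
      intro V; simp only [Matrix.vecMul, dotProduct]; fun_prop
    have m0 := hm0 V₀
    have m1 := hm0 V₁
    rw [← lintegral_const_mul _ (by fun_prop), ← lintegral_const_mul _ (by fun_prop),
      ← lintegral_add_left (by fun_prop)]
    refine lintegral_mono fun x => ?_
    simp only
    generalize (∑ i, ∑ k, ((x i ᵥ* V₀) k) ^ 2) = a
    generalize (∑ i, ∑ k, ((x i ᵥ* V₁) k) ^ 2) = b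
    have hKp : 0 < ((√(1 + lam))⁻¹) ^ (n * r) := by
      have : 0 < √(1 + lam) := Real.sqrt_pos.2 (by linarith)
      positivity
    generalize ((√(1 + lam))⁻¹) ^ (n * r) = K at hKp ⊢
    generalize 1 - (1 + lam)⁻¹ = β
    rw [← ENNReal.ofReal_mul (by positivity), ← ENNReal.ofReal_mul (by positivity),
      ← ENNReal.ofReal_add (by positivity) (by positivity)]
    apply ENNReal.ofReal_le_ofReal
    have e1 : rexp (β * b - β / 2 * a) * rexp (β / 2 * a) = rexp (β / 2 * b) ^ 2 := by
      rw [← Real.exp_add, ← Real.exp_nat_mul]; congr 1; push_cast; ring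
    have p1 := Real.exp_pos (β * b - β / 2 * a)
    have p2 := Real.exp_pos (β / 2 * a)
    have p3 := Real.exp_pos (β / 2 * b)
    generalize rexp (β * b - β / 2 * a) = u at *
    generalize rexp (β / 2 * a) = v at *
    generalize rexp (β / 2 * b) = z at *
    have : z ≤ c / 2 * v + 1 / (2 * c) * u := by
      have hsq : (2 * z) ^ 2 ≤ (c * v + u / c) ^ 2 := by
        have : (c * v + u / c) ^ 2 = (c * v - u / c) ^ 2 + 4 * (u * v) := by field_simp; ring
        rw [this, e1]; nlinarith [sq_nonneg (c * v - u / c)]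
      have := abs_le_of_sq_le_sq' hsq (by positivity)
      have e2 : c / 2 * v + 1 / (2 * c) * u = (c * v + u / c) / 2 := by field_simp
      rw [e2]; linarith [this.2]
    calc K * z ≤ K * (c / 2 * v + 1 / (2 * c) * u) := by gcongr
      _ = _ := by ring
  have h2 := ENNReal.toReal_mono (by
    refine ENNReal.add_ne_top.2 ⟨ENNReal.mul_ne_top ENNReal.ofReal_ne_top (measure_ne_top _ _),
      ENNReal.mul_ne_top ENNReal.ofReal_ne_top ENNReal.ofReal_ne_top⟩) key
  rw [ENNReal.toReal_add (ENNReal.mul_ne_top ENNReal.ofReal_ne_top (measure_ne_top _ _))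
    (ENNReal.mul_ne_top ENNReal.ofReal_ne_top ENNReal.ofReal_ne_top), ENNReal.toReal_mul,
    ENNReal.toReal_mul, ENNReal.toReal_ofReal (by positivity), ENNReal.toReal_ofReal (by positivity),
    ENNReal.toReal_ofReal (by positivity)] at h2
  unfold Measure.real
  refine h2.trans (le_of_eq ?_)
  ring

lemma measurable_loss {p r : ℕ} {α : Type*} [MeasurableSpace α] {f : α → (Fin p → Fin r → ℝ)}
    (hf : Measurable f) (V : Matrix (Fin p) (Fin r) ℝ) :
    Measurable (fun x => loss (Matrix.of (f x)) V) := by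
  have hf' : ∀ i j, Measurable (fun x => f x i j) := fun i j => by fun_prop
  unfold loss frobSq
  simp only [Matrix.sub_apply, Matrix.mul_apply, Matrix.transpose_apply, Matrix.of_apply]
  fun_prop

lemma integrable_loss {p r : ℕ} {α : Type*} [MeasurableSpace α] {f : α → (Fin p → Fin r → ℝ)}
    (hf : Measurable f) (ho : ∀ x, IsOrthonormalCols (Matrix.of (f x)))
    {V : Matrix (Fin p) (Fin r) ℝ} (hV : IsOrthonormalCols V) (μ : Measure α)
    [IsProbabilityMeasure μ] :
    Integrable (fun x => loss (Matrix.of (f x)) V) μ := by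
  refine Integrable.of_bound (measurable_loss hf V).aestronglyMeasurable (2 * r)
    (Filter.Eventually.of_forall fun x => ?_)
  rw [Real.norm_eq_abs, abs_of_nonneg (loss_nonneg _ _)]
  exact loss_le (ho x) hV

lemma frobSq_add_le {m k : Type*} [Fintype m] [Fintype k] (A B : Matrix m k ℝ) :
    frobSq (A + B) ≤ 2 * frobSq A + 2 * frobSq B := by
  unfold frobSq
  simp only [Finset.mul_sum, ← Finset.sum_add_distrib]
  refine Finset.sum_le_sum fun i _ => Finset.sum_le_sum fun j _ => ?_
  rw [Matrix.add_apply]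
  nlinarith [sq_nonneg (A i j - B i j)]

lemma loss_triangle {p r : ℕ} (U V W : Matrix (Fin p) (Fin r) ℝ) :
    loss U W ≤ 2 * loss U V + 2 * loss V W := by
  unfold loss
  have := frobSq_add_le (U * Uᵀ - V * Vᵀ) (V * Vᵀ - W * Wᵀ)
  simpa using this

lemma markov_loss {p r : ℕ} {α : Type*} [MeasurableSpace α] {f : α → (Fin p → Fin r → ℝ)}
    (hf : Measurable f) (ho : ∀ x, IsOrthonormalCols (Matrix.of (f x)))
    {V : Matrix (Fin p) (Fin r) ℝ} (hV : IsOrthonormalCols V) (μ : Measure α)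
    [IsProbabilityMeasure μ] (δ : ℝ) (hδ : 0 ≤ δ)
    (h : μ.real {x | loss (Matrix.of (f x)) V < δ} ≤ 1 / 2) :
    δ / 2 ≤ ∫ x, loss (Matrix.of (f x)) V ∂μ := by
  have h1 := mul_meas_ge_le_integral_of_nonneg (μ := μ)
    (Filter.Eventually.of_forall fun x => loss_nonneg (Matrix.of (f x)) V)
    (integrable_loss hf ho hV μ) δ
  have h2 : {x | δ ≤ loss (Matrix.of (f x)) V} = {x | loss (Matrix.of (f x)) V < δ}ᶜ := by
    ext x; simp
  rw [h2, probReal_compl_eq_one_sub (measurableSet_lt (measurable_loss hf V) measurable_const)]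
    at h1
  nlinarith

/-- `[e_1,…,e_{r'}, x]` -/
def colMat {p r' : ℕ} (hp : r' ≤ p) (x : Fin p → ℝ) : Matrix (Fin p) (Fin (r' + 1)) ℝ :=
  (Matrix.of (Fin.snoc (α := fun _ => Fin p → ℝ)
    (fun k : Fin r' => Pi.single (Fin.castLE hp k) (1 : ℝ)) x))ᵀ

lemma colMat_gram {p r' : ℕ} (hp : r' ≤ p) (x y : Fin p → ℝ)
    (k l : Fin (r' + 1)) : ((colMat hp x)ᵀ * colMat hp y) k l
      = (Fin.snoc (α := fun _ => Fin p → ℝ)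
    (fun k : Fin r' => Pi.single (Fin.castLE hp k) (1 : ℝ)) x k : Fin p → ℝ) ⬝ᵥ
      (Fin.snoc (α := fun _ => Fin p → ℝ)
    (fun k : Fin r' => Pi.single (Fin.castLE hp k) (1 : ℝ)) y l) := by
  rfl

lemma colMat_orth {p r' : ℕ} (hp : r' ≤ p) (x : Fin p → ℝ)
    (hx : ∀ k : Fin r', x (Fin.castLE hp k) = 0) (hxx : x ⬝ᵥ x = 1) :
    IsOrthonormalCols (colMat hp x) := by
  unfold IsOrthonormalCols
  ext k l
  rw [colMat_gram]
  refine Fin.lastCases ?_ (fun k => ?_) k <;> refine Fin.lastCases ?_ (fun l => ?_) l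
  · simp [hxx]
  · simp [hx, Fin.castSucc_ne_last, Matrix.one_apply]
    intro h; exact absurd h.symm (Fin.castSucc_ne_last _)
  · simp [hx, Fin.castSucc_ne_last, Matrix.one_apply]
  · simp [Matrix.one_apply, Pi.single_apply, eq_comm]

lemma colMat_cross {p r' : ℕ} (hp : r' ≤ p) (x y : Fin p → ℝ)
    (hx : ∀ k : Fin r', x (Fin.castLE hp k) = 0) (hy : ∀ k : Fin r', y (Fin.castLE hp k) = 0) :
    frobSq ((colMat hp x)ᵀ * colMat hp y) = r' + (x ⬝ᵥ y) ^ 2 := by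
  unfold frobSq
  simp only [colMat_gram]
  rw [Fin.sum_univ_castSucc]
  simp only [Fin.sum_univ_castSucc]
  simp [hx, hy, Pi.single_apply]

lemma colMat_loss {p r' : ℕ} (hp : r' ≤ p) (x y : Fin p → ℝ)
    (hx : ∀ k : Fin r', x (Fin.castLE hp k) = 0) (hy : ∀ k : Fin r', y (Fin.castLE hp k) = 0)
    (hxx : x ⬝ᵥ x = 1) (hyy : y ⬝ᵥ y = 1) :
    loss (colMat hp x) (colMat hp y) = 2 - 2 * (x ⬝ᵥ y) ^ 2 := by
  rw [loss_eq (colMat_orth hp x hx hxx) (colMat_orth hp y hy hyy), colMat_cross hp x y hx hy]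
  push_cast; ring

/-- number of words close to a given word -/
lemma card_close {m q : ℕ} (hq : 1 ≤ q) (w₀ : Fin m → Fin q) :
    (Finset.univ.filter fun w : Fin m → Fin q =>
      2 * (Finset.univ.filter fun i => w i ≠ w₀ i).card < m).card ≤ 2 ^ m * q ^ (m / 2) := by
  classical
  have hsub : (Finset.univ.filter fun w : Fin m → Fin q =>
      2 * (Finset.univ.filter fun i => w i ≠ w₀ i).card < m) ⊆
      (Finset.univ.filter fun S : Finset (Fin m) => S.card ≤ m / 2).biUnion
        (fun S => Fintype.piFinset fun i => if i ∈ S then Finset.univ else {w₀ i}) := by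
    intro w hw
    simp only [Finset.mem_filter, Finset.mem_univ, true_and] at hw
    simp only [Finset.mem_biUnion, Finset.mem_filter, Finset.mem_univ, true_and,
      Fintype.mem_piFinset]
    refine ⟨Finset.univ.filter fun i => w i ≠ w₀ i, by omega, fun i => ?_⟩
    split_ifs with h
    · simp
    · simpa using h
  refine (Finset.card_le_card hsub).trans (Finset.card_biUnion_le.trans ?_)
  have : ∀ S ∈ (Finset.univ.filter fun S : Finset (Fin m) => S.card ≤ m / 2),
      (Fintype.piFinset fun i => if i ∈ S then Finset.univ else {w₀ i}).card ≤ q ^ (m / 2) := by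
    intro S hS
    simp only [Finset.mem_filter, Finset.mem_univ, true_and] at hS
    rw [Fintype.card_piFinset]
    calc ∏ i, (if i ∈ S then Finset.univ else {w₀ i} : Finset (Fin q)).card
        = ∏ i, (if i ∈ S then q else 1) := by
          refine Finset.prod_congr rfl fun i _ => ?_
          split_ifs <;> simp
      _ = q ^ S.card := by
          rw [Finset.prod_ite_mem]; simp
      _ ≤ q ^ (m / 2) := Nat.pow_le_pow_right hq hS
  refine (Finset.sum_le_card_nsmul _ _ _ this).trans ?_
  rw [smul_eq_mul]
  refine Nat.mul_le_mul_right _ ((Finset.card_le_univ _).trans ?_)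
  simp

lemma hfun_pos {lam : ℝ} (hl : 0 < lam) : 0 < hfun lam := by unfold hfun; positivity

/-- overlap version of Fano -/
lemma fano {n p r : ℕ} {W : Type*} [Fintype W] [Nonempty W] (V₀ : Matrix (Fin p) (Fin r) ℝ)
    (V : W → Matrix (Fin p) (Fin r) ℝ) (hV₀ : IsOrthonormalCols V₀)
    (hV : ∀ w, IsOrthonormalCols (V w)) (lam : ℝ) (hl : 0 < lam) (ℓ δ : ℝ) (hδ : 0 < δ)
    (hℓ : ∀ w, loss V₀ (V w) ≤ ℓ) (hs : hfun lam * ℓ ≤ 1 / 2) (K : ℕ)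
    (hK : ∀ w₀, (Finset.univ.filter fun w => loss (V w₀) (V w) < 4 * δ).card ≤ K)
    (hE : exp (n * (hfun lam * ℓ)) * K ≤ Fintype.card W / 4)
    (f : (Fin n → Fin p → ℝ) → (Fin p → Fin r → ℝ)) (hf : Measurable f)
    (ho : ∀ x, IsOrthonormalCols (Matrix.of (f x))) :
    ∃ w, δ / 2 ≤ ∫ x, loss (Matrix.of (f x)) (V w) ∂(spikedMeasure n p r (fun _ => lam) (V w) 1) := by
  classical
  set E := exp (n * (hfun lam * ℓ)) with hEdef
  have hE0 : 0 < E := Real.exp_pos _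
  set A : W → Set (Fin n → Fin p → ℝ) := fun w => {x | loss (Matrix.of (f x)) (V w) < δ} with hA
  have hAm : ∀ w, MeasurableSet (A w) := fun w =>
    measurableSet_lt (measurable_loss hf _) measurable_const
  set P₀ := spikedMeasure n p r (fun _ => lam) V₀ 1 with hP₀
  have h1 : ∀ w, (spikedMeasure n p r (fun _ => lam) (V w) 1).real (A w) ≤ E * P₀.real (A w) + 1 / 4 := by
    intro w
    have := chi_cmp (n := n) hV₀ (hV w) lam hl
      ((mul_le_mul_of_nonneg_left (hℓ w) (hfun_pos hl).le).trans hs) (2 * E) (by positivity) (A w) (hAm w)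
    have h2 : exp (n * (hfun lam * loss V₀ (V w))) ≤ E := by
      rw [hEdef]
      refine Real.exp_le_exp.2 (mul_le_mul_of_nonneg_left
        (mul_le_mul_of_nonneg_left (hℓ w) (hfun_pos hl).le) (Nat.cast_nonneg _))
    have h3 : exp (n * (hfun lam * loss V₀ (V w))) / (2 * (2 * E)) ≤ 1 / 4 := by
      rw [div_le_iff₀ (by positivity)]; linarith
    refine this.trans ?_
    have : 2 * E / 2 = E := by ring
    rw [this]; linarith
  have hov : ∑ w, P₀.real (A w) ≤ K := by
    have e : ∑ w, P₀.real (A w) = ∫ x, ∑ w, (A w).indicator (fun _ => (1:ℝ)) x ∂P₀ := by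
      rw [integral_finsetSum _ (fun w _ => (integrable_const (1:ℝ)).indicator (hAm w))]
      refine Finset.sum_congr rfl fun w _ => ?_
      exact (integral_indicator_one (hAm w)).symm
    rw [e]
    have : ∀ x, ∑ w, (A w).indicator (fun _ => (1:ℝ)) x ≤ K := by
      intro x
      have e2 : ∑ w, (A w).indicator (fun _ => (1:ℝ)) x
          = ((Finset.univ.filter fun w => x ∈ A w).card : ℝ) := by
        rw [Finset.card_filter]; push_cast
        refine Finset.sum_congr rfl fun w _ => ?_
        by_cases h : x ∈ A w <;> simp [h]
      rw [e2]
      by_cases hne : ∃ w₀, x ∈ A w₀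
      · obtain ⟨w₀, hw₀⟩ := hne
        refine Nat.cast_le.2 ((Finset.card_le_card ?_).trans (hK w₀))
        intro w hw
        simp only [Finset.mem_filter, Finset.mem_univ, true_and] at hw ⊢
        have := loss_triangle (V w₀) (Matrix.of (f x)) (V w)
        rw [loss_comm (V w₀) (Matrix.of (f x))] at this
        simp only [hA, Set.mem_ofPred_eq] at hw hw₀
        linarith
      · push Not at hne
        rw [Finset.filter_eq_empty_iff.2 (fun w _ => hne w)]
        simp
    refine (integral_mono (integrable_finsetSum _
      (fun w _ => (integrable_const (1:ℝ)).indicator (hAm w))) (integrable_const (K:ℝ)) this).trans ?_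
    simp
  have hM : (0:ℝ) < Fintype.card W := Nat.cast_pos.2 Fintype.card_pos
  have hsum : ∑ w, (spikedMeasure n p r (fun _ => lam) (V w) 1).real (A w) ≤ ∑ _w : W, (1 / 2 : ℝ) := by
    refine (Finset.sum_le_sum fun w _ => h1 w).trans ?_
    rw [Finset.sum_add_distrib, ← Finset.mul_sum]
    simp only [Finset.sum_const, Finset.card_univ, nsmul_eq_mul]
    have : E * ∑ w, P₀.real (A w) ≤ E * K := by gcongr
    linarith
  obtain ⟨w, _, hw⟩ := Finset.exists_le_of_sum_le Finset.univ_nonempty hsum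
  exact ⟨w, markov_loss hf ho (hV w) _ δ hδ.le hw⟩

/-- coordinates used for the sparse part -/
def phi {p r m q : ℕ} (h : r + m * q ≤ p) (a : Fin m × Fin q) : Fin p :=
  ⟨r + (finProdFinEquiv a : ℕ), by have := (finProdFinEquiv a).2; omega⟩

lemma phi_inj {p r m q : ℕ} (h : r + m * q ≤ p) : Function.Injective (phi h) := by
  intro a b hab
  simp only [phi, Fin.mk.injEq, Nat.add_left_cancel_iff] at hab
  exact finProdFinEquiv.injective (Fin.ext hab)

/-- sparse direction -/
def xw {p r' m q : ℕ} (h : r' + 1 + m * q ≤ p) (ct st : ℝ) (w : Fin m → Fin q) : Fin p → ℝ :=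
  Pi.single ⟨r', by omega⟩ ct + ∑ i, Pi.single (phi h (i, w i)) (st / √m)

lemma phi_ne {p r' m q : ℕ} (h : r' + 1 + m * q ≤ p) (a : Fin m × Fin q) :
    phi h a ≠ ⟨r', by omega⟩ := by
  intro e
  have := congrArg Fin.val e
  simp only [phi] at this
  omega

lemma xw_zero {p r' m q : ℕ} (h : r' + 1 + m * q ≤ p) (ct st : ℝ) (w : Fin m → Fin q)
    (hp : r' ≤ p) (k : Fin r') : xw h ct st w (Fin.castLE hp k) = 0 := by
  unfold xw
  simp only [Pi.add_apply, Finset.sum_apply]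
  rw [Pi.single_eq_of_ne, Finset.sum_eq_zero, add_zero]
  · intro i _
    rw [Pi.single_eq_of_ne]
    intro e
    have := congrArg Fin.val e
    simp only [phi, Fin.val_castLE] at this
    omega
  · intro e
    have := congrArg Fin.val e
    simp only [Fin.val_castLE] at this
    omega

lemma xw_dot {p r' m q : ℕ} (h : r' + 1 + m * q ≤ p) (ct st : ℝ) (w w' : Fin m → Fin q)
    (hm : 1 ≤ m) :
    xw h ct st w ⬝ᵥ xw h ct st w'
      = ct ^ 2 + st ^ 2 * (1 - ((Finset.univ.filter fun i => w' i ≠ w i).card : ℝ) / m) := by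
  have h1 : ∀ i, xw h ct st w' (phi h (i, w i)) = if w' i = w i then st / √m else 0 := by
    intro i
    unfold xw
    simp only [Pi.add_apply, Finset.sum_apply]
    rw [Pi.single_eq_of_ne (phi_ne h _), zero_add]
    simp only [Pi.single_apply, (phi_inj h).eq_iff, Prod.mk.injEq]
    rw [Finset.sum_eq_single i]
    · simp [eq_comm]
    · intro j _ hj; simp [hj.symm]
    · simp
  have h2 : xw h ct st w' ⟨r', by omega⟩ = ct := by
    unfold xw
    simp only [Pi.add_apply, Finset.sum_apply, Pi.single_eq_same]
    rw [Finset.sum_eq_zero, add_zero]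
    intro i _
    rw [Pi.single_eq_of_ne (phi_ne h _).symm]
  have hm' : (0:ℝ) < m := by exact_mod_cast hm
  conv_lhs => unfold xw
  rw [add_dotProduct, sum_dotProduct]
  simp only [single_dotProduct]
  change ct * xw h ct st w' ⟨r', _⟩ + ∑ i, st / √m * xw h ct st w' (phi h (i, w i)) = _
  simp only [h1, h2, mul_ite, mul_zero]
  rw [← Finset.sum_filter, Finset.sum_const, nsmul_eq_mul]
  have hc := Finset.card_filter_add_card_filter_not (s := (Finset.univ : Finset (Fin m)))
    (fun i => w' i = w i)
  have hc' : ((Finset.univ.filter fun i => w' i = w i).card : ℝ)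
      = m - (Finset.univ.filter fun i => w' i ≠ w i).card := by
    have : (((Finset.univ.filter fun i => w' i = w i).card
      + (Finset.univ.filter fun i => w' i ≠ w i).card : ℕ) : ℝ) = m := by
        simpa using congrArg (Nat.cast : ℕ → ℝ) hc
    push_cast at this; linarith
  rw [hc', div_mul_div_comm, Real.mul_self_sqrt hm'.le]
  field_simp

lemma lower_B_core {n p r' m q : ℕ} (κ lam : ℝ) (hκ : 1 < κ) (hl : 0 < lam) (hm : 1 ≤ m)
    (hq : 1 ≤ q) (h : r' + 1 + m * q ≤ p) (σ : ℝ) (hσ0 : 0 < σ) (hσ1 : σ ≤ 1)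
    (hs : hfun lam * (2 * σ) ≤ 1 / 2)
    (hE : exp (n * (hfun lam * (2 * σ))) * (2 ^ m * q ^ (m / 2)) ≤ q ^ m / 4)
    (f : (Fin n → Fin p → ℝ) → (Fin p → Fin (r' + 1) → ℝ)) (hf : Measurable f)
    (ho : ∀ x, IsOrthonormalCols (Matrix.of (f x))) :
    ∃ V, InTheta 0 ((r' + 1 + m : ℕ) : ℝ) p (r' + 1) lam κ V (fun _ => lam) ∧
      σ / 8 ≤ ∫ x, loss (Matrix.of (f x)) V
        ∂(spikedMeasure n p (r' + 1) (fun _ => lam) V 1) := by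
  classical
  have hp : r' ≤ p := by omega
  set st := √σ with hst
  set ct := √(1 - σ) with hct
  have hst2 : st ^ 2 = σ := Real.sq_sqrt hσ0.le
  have hct2 : ct ^ 2 = 1 - σ := Real.sq_sqrt (by linarith)
  have hm' : (0:ℝ) < m := by exact_mod_cast hm
  have : Nonempty (Fin q) := ⟨⟨0, hq⟩⟩
  set V : (Fin m → Fin q) → Matrix (Fin p) (Fin (r' + 1)) ℝ := fun w => colMat hp (xw h ct st w)
  set x₀ : Fin p → ℝ := Pi.single ⟨r', by omega⟩ 1 with hx₀
  have hx₀z : ∀ k : Fin r', x₀ (Fin.castLE hp k) = 0 := by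
    intro k
    rw [hx₀, Pi.single_eq_of_ne]
    intro e
    have := congrArg Fin.val e
    simp only [Fin.val_castLE] at this
    omega
  have hx₀1 : x₀ ⬝ᵥ x₀ = 1 := by simp [hx₀]
  have hxw1 : ∀ w, xw h ct st w ⬝ᵥ xw h ct st w = 1 := by
    intro w; rw [xw_dot h ct st w w hm, hst2, hct2]; simp
  have hx0w : ∀ w, x₀ ⬝ᵥ xw h ct st w = ct := by
    intro w
    rw [hx₀, single_dotProduct, one_mul]
    unfold xw
    simp only [Pi.add_apply, Finset.sum_apply, Pi.single_eq_same]
    rw [Finset.sum_eq_zero, add_zero]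
    intro i _
    rw [Pi.single_eq_of_ne (phi_ne h _).symm]
  have hV : ∀ w, IsOrthonormalCols (V w) := fun w =>
    colMat_orth hp _ (fun k => xw_zero h ct st w hp k) (hxw1 w)
  obtain ⟨w, hw⟩ := fano (colMat hp x₀) V (colMat_orth hp x₀ hx₀z hx₀1) hV lam hl (2 * σ) (σ / 4)
    (by linarith) (fun w => by
      rw [colMat_loss hp _ _ hx₀z (fun k => xw_zero h ct st w hp k) hx₀1 (hxw1 w), hx0w, hct2]
      linarith) hs (2 ^ m * q ^ (m / 2)) (fun w₀ => by
      refine (Finset.card_le_card ?_).trans (card_close hq w₀)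
      intro w hw
      simp only [Finset.mem_filter, Finset.mem_univ, true_and] at hw ⊢
      rw [colMat_loss hp _ _ (fun k => xw_zero h ct st w₀ hp k) (fun k => xw_zero h ct st w hp k)
        (hxw1 w₀) (hxw1 w), xw_dot h ct st w₀ w hm, hst2, hct2] at hw
      set D := (Finset.univ.filter fun i => w i ≠ w₀ i).card
      have hD : (D:ℝ) ≤ m := by
        exact_mod_cast (Finset.card_le_univ _).trans (by simp)
      set y := (D:ℝ) / m with hy
      have hy0 : 0 ≤ y := by positivity
      have hy1 : y ≤ 1 := (div_le_one hm').2 hD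
      have h3 : y < 1 / 2 := by
        have h4 : 1 - σ + σ * (1 - y) = 1 - σ * y := by ring
        rw [h4] at hw
        have h6 : σ * y ≤ 1 := by nlinarith
        have h5 : 0 ≤ σ * y := by positivity
        nlinarith
      rw [hy, div_lt_iff₀ hm'] at h3
      have : (2 * D : ℝ) < m := by linarith
      exact_mod_cast this) (by
      push_cast; simp only [Fintype.card_fun, Fintype.card_fin]; push_cast; exact hE) f hf ho
  refine ⟨V w, ⟨hV w, ?_, fun _ _ _ => le_rfl, fun _ => ⟨hl, le_rfl, ?_⟩⟩, ?_⟩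
  · refine weakLq_backward ((Finset.univ.image (Fin.castLE (by omega : r' + 1 ≤ p)))
      ∪ (Finset.univ.image fun i => phi h (i, w i))) ?_ ?_
    · refine (Finset.card_union_le _ _).trans (add_le_add ?_ ?_) <;>
      · refine Finset.card_image_le.trans ?_
        simp
    · intro j hj k
      simp only [Finset.mem_union, Finset.mem_image, Finset.mem_univ, true_and, not_or,
        not_exists] at hj
      change (Fin.snoc (α := fun _ => Fin p → ℝ)
        (fun k : Fin r' => Pi.single (Fin.castLE hp k) (1 : ℝ)) (xw h ct st w) k : Fin p → ℝ) j = 0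
      refine Fin.lastCases ?_ (fun k => ?_) k
      · rw [Fin.snoc_last]
        unfold xw
        simp only [Pi.add_apply, Finset.sum_apply]
        rw [Pi.single_eq_of_ne (show j ≠ (⟨r', by omega⟩ : Fin p) from
          fun e => hj.1 (Fin.last r') e.symm), Finset.sum_eq_zero, add_zero]
        intro i _
        rw [Pi.single_eq_of_ne (fun e => hj.2 i e.symm)]
      · rw [Fin.snoc_castSucc]
        exact Pi.single_eq_of_ne (i := Fin.castLE hp k) (fun e => hj.1 k.castSucc e.symm) _
  · nlinarith
  · linarith

lemma L_ge_one {p s : ℕ} (hs : 1 ≤ s) (hsp : s ≤ p) : 1 ≤ Real.log (Real.exp 1 * p / s) := by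
  have hs' : (0:ℝ) < s := by exact_mod_cast hs
  have hsp' : (s:ℝ) ≤ p := by exact_mod_cast hsp
  rw [Real.le_log_iff_exp_le (by have : (0:ℝ) < p := by linarith
                                 positivity)]
  rw [le_div_iff₀ hs']
  have := Real.exp_pos 1
  nlinarith

lemma L_le_of {s r : ℕ} {L c₂ : ℝ} (hr : 1 ≤ r) (hrs : r ≤ s) (hc₂ : 1 ≤ c₂)
    (h : c₂ * min (s : ℝ) L ≤ (s : ℝ) - r) : L < s ∧ c₂ * L ≤ (s:ℝ) - r := by
  have hr' : (1:ℝ) ≤ r := by exact_mod_cast hr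
  have hrs' : (r:ℝ) ≤ s := by exact_mod_cast hrs
  rcases le_total (s:ℝ) L with h1 | h1
  · rw [min_eq_left h1] at h
    nlinarith
  · rw [min_eq_right h1] at h
    rcases h1.eq_or_lt with h2 | h2
    · rw [h2] at h; nlinarith
    · exact ⟨h2, h⟩

lemma hE_aux {m q : ℕ} {L : ℝ} (hL24 : 24 < L) (hmL : (48:ℝ) < m) (hq2 : exp (L / 2) ≤ q) :
    exp (m * L / 16) * (2 ^ m * (q:ℝ) ^ (m / 2)) ≤ (q:ℝ) ^ m / 4 := by
    have hq0 : (1:ℝ) ≤ q := le_trans (Real.one_le_exp (by linarith)) hq2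
    have e1 : (q:ℝ) ^ m = q ^ (m - m / 2) * q ^ (m / 2) := by
      rw [← pow_add]; congr 1; omega
    have e2 : exp (L * m / 4) ≤ (q:ℝ) ^ (m - m / 2) := by
      refine le_trans ?_ (pow_le_pow_left₀ (Real.exp_pos _).le hq2 _)
      rw [← Real.exp_nat_mul]
      apply Real.exp_le_exp.2
      have : (m:ℝ) / 2 ≤ ((m - m / 2 : ℕ) : ℝ) := by
        have : m ≤ 2 * (m - m / 2) := by omega
        have : (m:ℝ) ≤ 2 * ((m - m / 2 : ℕ) : ℝ) := by exact_mod_cast this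
        linarith
      have h9 : (m:ℝ) / 2 * (L / 2) ≤ ((m - m / 2 : ℕ) : ℝ) * (L / 2) :=
        mul_le_mul_of_nonneg_right this (by linarith)
      linarith
    have e3 : (2:ℝ) ^ m ≤ exp m := by
      have : (2:ℝ) ≤ exp 1 := by have := Real.add_one_le_exp 1; linarith
      refine (pow_le_pow_left₀ (by norm_num) this m).trans (le_of_eq ?_)
      rw [← Real.exp_nat_mul]; simp
    have e4 : (4:ℝ) ≤ exp m := by
      have := Real.add_one_le_exp (m:ℝ); linarith
    have e5 : exp (m * L / 16) * exp m * exp m ≤ exp (L * m / 4) := by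
      rw [← Real.exp_add, ← Real.exp_add]
      apply Real.exp_le_exp.2
      have : (m:ℝ) * 24 ≤ m * L := mul_le_mul_of_nonneg_left hL24.le (by linarith)
      linarith
    have hpos : (0:ℝ) < q ^ (m / 2) := by positivity
    rw [e1]
    have e6 : exp (m * L / 16) * 2 ^ m * 4 ≤ exp (m * L / 16) * exp m * exp m := by
      gcongr
    have e7 : exp (m * L / 16) * 2 ^ m ≤ (q:ℝ) ^ (m - m / 2) / 4 := by linarith
    calc exp (m * L / 16) * (2 ^ m * q ^ (m / 2))
        = exp (m * L / 16) * 2 ^ m * q ^ (m / 2) := by ring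
      _ ≤ (q:ℝ) ^ (m - m / 2) / 4 * q ^ (m / 2) := by gcongr
      _ = _ := by ring

set_option maxHeartbeats 1000000 in
lemma lower_B {n p r s : ℕ} (κ lam : ℝ) (hκ : 1 < κ) (hr : 1 ≤ r) (hrs : r ≤ s) (hsp : s ≤ p)
    (hl : 0 < lam) (L : ℝ) (hL : L = Real.log (Real.exp 1 * p / s))
    (h2 : 2 * L ≤ (s : ℝ) - r) (hn : s * L ≤ n)
    (hR : ((r : ℝ) * (s - r) + s * L) / (n * hfun lam) ≤ 1) (hB : 24 * r < L)
    (f : (Fin n → Fin p → ℝ) → (Fin p → Fin r → ℝ)) (hf : Measurable f)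
    (ho : ∀ x, IsOrthonormalCols (Matrix.of (f x))) :
    ∃ V, InTheta 0 s p r lam κ V (fun _ => lam) ∧
      ((r : ℝ) * (s - r) + s * L) / (n * hfun lam) / 1000 ≤ ∫ x, loss (Matrix.of (f x)) V
        ∂(spikedMeasure n p r (fun _ => lam) V 1) := by
  obtain ⟨r', rfl⟩ : ∃ r', r = r' + 1 := ⟨r - 1, by omega⟩
  have hr1 : (1:ℝ) ≤ ((r' + 1 : ℕ) : ℝ) := by exact_mod_cast hr
  have hL24 : 24 < L := by linarith
  have hs0 : (0:ℝ) < s := by exact_mod_cast (by omega : 0 < s)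
  have hsp' : (s:ℝ) ≤ p := by exact_mod_cast hsp
  have hp0 : (0:ℝ) < p := by linarith
  obtain ⟨m, rfl⟩ : ∃ m, s = r' + 1 + m := ⟨s - (r' + 1), by omega⟩
  have hm : ((r' + 1 + m : ℕ) : ℝ) - ((r' + 1 : ℕ) : ℝ) = m := by push_cast; ring
  rw [hm] at h2 hR ⊢
  have hmL : (48:ℝ) < m := by linarith
  have hm1 : 1 ≤ m := by
    have : (0:ℝ) < m := by linarith
    exact_mod_cast this
  set s := r' + 1 + m with hs
  have hsm : (s:ℝ) = ((r' + 1 : ℕ) : ℝ) + m := by rw [hs]; push_cast; ring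
  generalize ((r' + 1 : ℕ) : ℝ) = rr at *
  have hn0 : (0:ℝ) < n := lt_of_lt_of_le (by positivity) hn
  have hh := hfun_pos hl
  set q := (p - (r' + 1)) / m with hq
  have hmq : r' + 1 + m * q ≤ p := by
    have := Nat.mul_div_le (p - (r' + 1)) m
    rw [← hq] at this
    omega
  -- lower bound on q
  have hps : exp L = exp 1 * p / s := by rw [hL, Real.exp_log (by positivity)]
  have hx : exp (L - 1) = p / s := by rw [Real.exp_sub, hps]; field_simp
  have hqlt : p < r' + 1 + m * (q + 1) := by
    have := Nat.lt_mul_div_succ (p - (r' + 1)) hm1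
    rw [← hq] at this
    omega
  have hqlt' : (p:ℝ) < r' + 1 + m * (q + 1) := by exact_mod_cast hqlt
  have hm0 : (0:ℝ) < m := by linarith
  have hrr : (r':ℝ) + 1 + m = s := by rw [hs]; push_cast; ring
  have hq1 : exp (L - 1) < q + 1 := by
    rw [hx, div_lt_iff₀ hs0]
    have : (p:ℝ) - (r' + 1) < m * (q + 1) := by linarith
    have h3 : (0:ℝ) ≤ (r':ℝ) + 1 := by positivity
    have hsum : (p:ℝ) * m + p * (r' + 1) = p * s := by rw [← hrr]; ring
    -- (p - r) s ≥ p m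
    have h4 : (p:ℝ) * m ≤ (p - (r' + 1)) * s := by nlinarith
    have h5 : (p - ((r':ℝ) + 1)) * s < m * (q + 1) * s := by
      exact mul_lt_mul_of_pos_right this hs0
    have h6 : (p:ℝ) * m < ((q + 1) * s) * m := by linarith
    exact lt_of_mul_lt_mul_right h6 hm0.le
  have hq2 : exp (L / 2) ≤ q := by
    have e : exp (L - 1) = exp (L / 2) * exp (L / 2 - 1) := by rw [← Real.exp_add]; ring_nf
    have h3 : (2:ℝ) ≤ exp (L / 2 - 1) := by
      have := Real.add_one_le_exp (L / 2 - 1); linarith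
    have h4 : (1:ℝ) ≤ exp (L / 2) := Real.one_le_exp (by linarith)
    rw [e] at hq1
    nlinarith
  have hq0 : (1:ℝ) ≤ q := le_trans (Real.one_le_exp (by linarith)) hq2
  have hq1' : 1 ≤ q := by exact_mod_cast hq0
  set σ := m * L / (32 * (n * hfun lam)) with hσ
  have hσ0 : 0 < σ := by positivity
  have hnh : 0 < n * hfun lam := by positivity
  rw [div_le_one hnh] at hR
  have hsL : m * L ≤ s * L := by rw [hsm]; nlinarith
  have hσ1 : σ ≤ 1 := by
    rw [hσ, div_le_one (by positivity)]
    nlinarith [mul_pos (by linarith : 0 < rr) hm0]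
  have hh2 : n * (hfun lam * (2 * σ)) = m * L / 16 := by rw [hσ]; field_simp; ring
  have hs1 : hfun lam * (2 * σ) ≤ 1 / 2 := by
    have : n * (hfun lam * (2 * σ)) ≤ n * (1 / 2) := by rw [hh2]; linarith
    exact le_of_mul_le_mul_left this hn0
  have hE : exp (n * (hfun lam * (2 * σ))) * (2 ^ m * q ^ (m / 2)) ≤ q ^ m / 4 := by
    rw [hh2]
    exact hE_aux hL24 hmL hq2
  obtain ⟨V, hV, hVr⟩ := lower_B_core (n := n) κ lam hκ hl hm1 hq1' hmq σ hσ0 hσ1 hs1 hE f hf ho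
  refine ⟨V, hV, le_trans ?_ hVr⟩
  rw [hσ, div_div, div_div, div_le_div_iff₀ (by positivity) (by positivity)]
  have h3 : rr * m ≤ m * L / 24 := by nlinarith
  have h4 : rr * L ≤ m * L / 24 := by nlinarith
  have h5 : rr * m + s * L ≤ 3 * (m * L) := by
    rw [hsm]; nlinarith
  have h6 : (rr * m + s * L) * (32 * (n * hfun lam) * 8) ≤ 3 * (m * L) * (32 * (n * hfun lam) * 8) :=
    mul_le_mul_of_nonneg_right h5 (by positivity)
  have h7 : 0 ≤ (m * L) * (n * hfun lam) := by positivity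
  linarith

open scoped MatrixOrder in
lemma exists_T {r : ℕ} (M : Matrix (Fin r) (Fin r) ℝ) (hM : M.PosDef) :
    ∃ T : Matrix (Fin r) (Fin r) ℝ, Tᵀ * M * T = 1 ∧ T * Tᵀ * M = 1 := by
  obtain ⟨N, hN⟩ := CStarAlgebra.nonneg_iff_eq_star_mul_self.mp hM.posSemidef.nonneg
  have hN' : M = Nᵀ * N := by rw [hN, star_eq_conjTranspose, conjTranspose_eq_transpose_of_trivial]
  have hu : IsUnit M.det := (isUnit_iff_isUnit_det _).1 hM.isUnit
  have huN : IsUnit N.det := by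
    rw [hN', det_mul] at hu
    exact isUnit_of_mul_isUnit_right hu
  have h1 : (N⁻¹)ᵀ * M * N⁻¹ = 1 := by
    rw [hN', ← Matrix.mul_assoc, ← transpose_mul, Matrix.mul_assoc, Matrix.mul_nonsing_inv _ huN]
    simp
  refine ⟨N⁻¹, h1, ?_⟩
  rw [Matrix.mul_assoc]
  exact mul_eq_one_comm.1 h1

lemma frobSq_mul_le {a b c : Type*} [Fintype a] [Fintype b] [Fintype c] (A : Matrix a b ℝ)
    (B : Matrix b c ℝ) : frobSq (A * B) ≤ frobSq A * frobSq B := by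
  unfold frobSq
  rw [Finset.sum_mul]
  refine Finset.sum_le_sum fun i _ => ?_
  rw [Finset.sum_comm (f := fun i j => B i j ^ 2), Finset.mul_sum]
  refine Finset.sum_le_sum fun j _ => ?_
  rw [Matrix.mul_apply]
  exact Finset.sum_mul_sq_le_sq_mul_sq _ _ _

lemma frobSq_resid_le {p r : ℕ} {k : Type*} [Fintype k] {V : Matrix (Fin p) (Fin r) ℝ}
    (hV : IsOrthonormalCols V)
    (W : Matrix (Fin p) k ℝ) : frobSq (W - V * (Vᵀ * W)) ≤ frobSq W := by
  unfold IsOrthonormalCols at *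
  have e : frobSq W = frobSq (W - V * (Vᵀ * W)) + frobSq (Vᵀ * W) := by
    rw [frobSq_eq_trace, frobSq_eq_trace, frobSq_eq_trace, ← trace_add]
    congr 1
    have a1 : (V * (Vᵀ * W))ᵀ * W = (Vᵀ * W)ᵀ * (Vᵀ * W) := by
      simp only [transpose_mul, transpose_transpose, Matrix.mul_assoc]
    have a2 : Wᵀ * (V * (Vᵀ * W)) = (Vᵀ * W)ᵀ * (Vᵀ * W) := by
      simp only [transpose_mul, transpose_transpose, Matrix.mul_assoc]
    have a3 : (V * (Vᵀ * W))ᵀ * (V * (Vᵀ * W)) = (Vᵀ * W)ᵀ * (Vᵀ * W) := by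
      rw [transpose_mul, Matrix.mul_assoc, ← Matrix.mul_assoc Vᵀ V, hV, Matrix.one_mul]
    rw [transpose_sub, Matrix.sub_mul, Matrix.mul_sub, Matrix.mul_sub, a1, a2, a3]; abel
  linarith [frobSq_nonneg (Vᵀ * W)]

/-- the coordinate embedding matrix -/
def emb {p k : ℕ} (φ : Fin k → Fin p) : Matrix (Fin p) (Fin k) ℝ :=
  (1 : Matrix (Fin p) (Fin p) ℝ).submatrix id φ

lemma emb_tmul {p k : ℕ} {c : Type*} (φ : Fin k → Fin p) (X : Matrix (Fin p) c ℝ) :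
    (emb φ)ᵀ * X = X.submatrix φ id := by
  ext i j
  simp [emb, Matrix.mul_apply, Matrix.one_apply]

lemma mul_emb {p k : ℕ} {c : Type*} (φ : Fin k → Fin p) (X : Matrix c (Fin p) ℝ) :
    X * (emb φ) = X.submatrix id φ := by
  ext i j
  simp [emb, Matrix.mul_apply, Matrix.one_apply]

lemma emb_self {p k : ℕ} (φ : Fin k → Fin p) (hφ : Function.Injective φ) :
    (emb φ)ᵀ * emb φ = 1 := by
  rw [emb_tmul]
  ext i j
  simp [emb, Matrix.one_apply, hφ.eq_iff]

lemma emb_disj {p k l : ℕ} (φ : Fin k → Fin p) (ψ : Fin l → Fin p) (h : ∀ i j, φ i ≠ ψ j) :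
    (emb φ)ᵀ * emb ψ = 0 := by
  rw [emb_tmul]
  ext i j
  simp [emb, h]

/-- Assouad building block -/
lemma exists_VE {p r m : ℕ} (φ : Fin r → Fin p) (ψ : Fin m → Fin p) (hφ : Function.Injective φ)
    (hψ : Function.Injective ψ) (hd : ∀ i j, φ i ≠ ψ j) (E : Matrix (Fin m) (Fin r) ℝ) :
    ∃ T : Matrix (Fin r) (Fin r) ℝ,
      IsOrthonormalCols ((emb φ + emb ψ * E) * T) ∧ T * Tᵀ + T * Tᵀ * (Eᵀ * E) = 1 := by
  have hM : (1 + Eᵀ * E).PosDef := by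
    apply Matrix.PosDef.add_posSemidef Matrix.PosDef.one
    have := posSemidef_conjTranspose_mul_self E
    rwa [conjTranspose_eq_transpose_of_trivial] at this
  obtain ⟨T, h1, h2⟩ := exists_T _ hM
  refine ⟨T, ?_, ?_⟩
  · unfold IsOrthonormalCols
    have hF : (emb φ + emb ψ * E)ᵀ * (emb φ + emb ψ * E) = 1 + Eᵀ * E := by
      have hd' : (emb ψ)ᵀ * emb φ = 0 := emb_disj _ _ fun i j => (hd j i).symm
      rw [transpose_add, Matrix.add_mul, Matrix.mul_add, Matrix.mul_add, transpose_mul,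
        emb_self φ hφ, ← Matrix.mul_assoc (emb φ)ᵀ, emb_disj _ _ hd, Matrix.mul_assoc Eᵀ, hd',
        Matrix.mul_assoc Eᵀ, ← Matrix.mul_assoc (emb ψ)ᵀ, emb_self ψ hψ]
      simp
    rw [transpose_mul, Matrix.mul_assoc, ← Matrix.mul_assoc _ _ T, hF, ← Matrix.mul_assoc, h1]
  · rw [Matrix.mul_add, Matrix.mul_one] at h2; exact h2

lemma S_diag_le {r m : ℕ} {T : Matrix (Fin r) (Fin r) ℝ} {E : Matrix (Fin m) (Fin r) ℝ}
    (h : T * Tᵀ + T * Tᵀ * (Eᵀ * E) = 1) (j : Fin r) : (T * Tᵀ) j j ≤ 1 := by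
  set S := T * Tᵀ with hS
  have hSt : Sᵀ = S := by rw [hS, transpose_mul, transpose_transpose]
  have h1 : S = Sᵀ * S + (E * S)ᵀ * (E * S) := by
    have : (S + S * (Eᵀ * E)) * S = S := by rw [h, Matrix.one_mul]
    rw [Matrix.add_mul] at this
    nth_rewrite 1 [← this]
    rw [transpose_mul E S, hSt]
    simp only [Matrix.mul_assoc]
  have h2 : S j j = ∑ i, S i j ^ 2 + ∑ i, (E * S) i j ^ 2 := by
    have := congrFun (congrFun h1 j) j
    rw [Matrix.add_apply, Matrix.mul_apply, Matrix.mul_apply] at this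
    simpa [pow_two] using this
  have h3 : S j j ^ 2 ≤ ∑ i, S i j ^ 2 :=
    Finset.single_le_sum (f := fun i => S i j ^ 2) (fun i _ => sq_nonneg _) (Finset.mem_univ j)
  have h4 : 0 ≤ ∑ i, (E * S) i j ^ 2 := Finset.sum_nonneg fun _ _ => sq_nonneg _
  nlinarith

lemma Q_close {r m : ℕ} {T : Matrix (Fin r) (Fin r) ℝ} {E : Matrix (Fin m) (Fin r) ℝ}
    (h : T * Tᵀ + T * Tᵀ * (Eᵀ * E) = 1) (θ : ℝ) (hθ : frobSq E = θ) (hθ1 : θ ≤ 1 / 2) :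
    frobSq (E * (T * Tᵀ) - E) ≤ 4 * θ ^ 3 := by
  have h0 := frobSq_nonneg E
  rw [hθ] at h0
  set S := T * Tᵀ with hS
  have hSt : Sᵀ = S := by rw [hS, transpose_mul, transpose_transpose]
  have h' : S + Eᵀ * E * S = 1 := by
    have := congrArg transpose h
    rw [transpose_add, transpose_mul S, transpose_mul Eᵀ, hSt, transpose_transpose, transpose_one] at this
    exact this
  have e1 : E - E * S = (E * Eᵀ) * (E * S) := by
    have : E * (S + Eᵀ * E * S) = E := by rw [h', Matrix.mul_one]
    nth_rewrite 1 [← this]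
    rw [Matrix.mul_add]
    simp only [Matrix.mul_assoc]
    abel
  have e2 : frobSq (E - E * S) ≤ θ ^ 2 * frobSq (E * S) := by
    rw [e1]
    refine (frobSq_mul_le _ _).trans ?_
    refine mul_le_mul_of_nonneg_right ?_ (frobSq_nonneg _)
    refine (frobSq_mul_le _ _).trans ?_
    rw [frobSq_transpose, hθ, pow_two]
  have e3 : frobSq (E * S - E) = frobSq (E - E * S) := by
    unfold frobSq
    refine Finset.sum_congr rfl fun i _ => Finset.sum_congr rfl fun j _ => ?_
    simp only [Matrix.sub_apply]; ring
  have e4 : frobSq (E * S) ≤ 2 * frobSq (E * S - E) + 2 * θ := by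
    have := frobSq_add_le (E * S - E) E
    rw [sub_add_cancel, hθ] at this
    exact this
  rw [e3] at e4 ⊢
  have hn := frobSq_nonneg (E * S)
  have hθ2 : θ ^ 2 ≤ 1 / 4 := by nlinarith
  have e6 := mul_le_mul_of_nonneg_right hθ2 hn
  have e5 : frobSq (E * S) ≤ 4 * θ := by linarith
  nlinarith [sq_nonneg θ]

lemma frobSq_isom {p m : ℕ} {k : Type*} [Fintype k] {V : Matrix (Fin p) (Fin m) ℝ}
    (hV : Vᵀ * V = 1) (X : Matrix (Fin m) k ℝ) : frobSq (V * X) = frobSq X := by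
  rw [frobSq_eq_trace, frobSq_eq_trace, transpose_mul, Matrix.mul_assoc, ← Matrix.mul_assoc Vᵀ,
    hV, Matrix.one_mul]

lemma adj_loss {p r m : ℕ} {F₀ : Matrix (Fin p) (Fin r) ℝ} {Ψ : Matrix (Fin p) (Fin m) ℝ}
    (hΨ : Ψᵀ * Ψ = 1) {E₀ E₁ : Matrix (Fin m) (Fin r) ℝ} {T₀ T₁ : Matrix (Fin r) (Fin r) ℝ}
    (hV₀ : IsOrthonormalCols ((F₀ + Ψ * E₀) * T₀)) (hV₁ : IsOrthonormalCols ((F₀ + Ψ * E₁) * T₁))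
    (h₀ : T₀ * T₀ᵀ + T₀ * T₀ᵀ * (E₀ᵀ * E₀) = 1) (h₁ : T₁ * T₁ᵀ + T₁ * T₁ᵀ * (E₁ᵀ * E₁) = 1)
    (i : Fin m) (k : Fin r) (c : ℝ) (hE : E₁ - E₀ = Matrix.single i k c) :
    loss ((F₀ + Ψ * E₀) * T₀) ((F₀ + Ψ * E₁) * T₁) ≤ 2 * c ^ 2 := by
  rw [loss_eq_resid hV₀ hV₁]
  set V₀ := (F₀ + Ψ * E₀) * T₀ with hV
  obtain ⟨K, hK⟩ : ∃ K, T₀ * K = 1 := ⟨T₀ᵀ * (1 + E₀ᵀ * E₀), by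
    rw [← Matrix.mul_assoc, Matrix.mul_add, Matrix.mul_one]; exact h₀⟩
  have hF : F₀ + Ψ * E₀ = V₀ * K := by rw [hV, Matrix.mul_assoc, hK, Matrix.mul_one]
  have hD : (F₀ + Ψ * E₁) * T₁ = V₀ * (K * T₁) + Ψ * (Matrix.single i k c * T₁) := by
    rw [← Matrix.mul_assoc V₀, ← hF, ← hE, Matrix.sub_mul, Matrix.mul_sub, Matrix.add_mul,
      Matrix.add_mul, Matrix.mul_assoc, Matrix.mul_assoc]
    abel
  have hres : (F₀ + Ψ * E₁) * T₁ - V₀ * (V₀ᵀ * ((F₀ + Ψ * E₁) * T₁))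
      = Ψ * (Matrix.single i k c * T₁) - V₀ * (V₀ᵀ * (Ψ * (Matrix.single i k c * T₁))) := by
    rw [hD, Matrix.mul_add, ← Matrix.mul_assoc V₀ᵀ V₀]
    rw [show V₀ᵀ * V₀ = 1 from hV₀, Matrix.one_mul, Matrix.mul_add]
    abel
  rw [hres]
  have h2 := frobSq_resid_le hV₀ (Ψ * (Matrix.single i k c * T₁))
  rw [frobSq_isom hΨ (Matrix.single i k c * T₁)] at h2
  have h3 : frobSq (Matrix.single i k c * T₁) = c ^ 2 * (T₁ * T₁ᵀ) k k := by
    unfold frobSq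
    rw [Finset.sum_eq_single i]
    · rw [Matrix.mul_apply, Finset.mul_sum]
      refine Finset.sum_congr rfl fun l _ => ?_
      rw [Matrix.single_mul_apply_same, transpose_apply]; ring
    · intro j _ hj
      refine Finset.sum_eq_zero fun l _ => ?_
      rw [Matrix.single_mul_apply_of_ne _ _ _ _ _ hj]; simp
    · simp
  have h4 := S_diag_le h₁ k
  rw [h3] at h2
  have : c ^ 2 * (T₁ * T₁ᵀ) k k ≤ c ^ 2 * 1 := mul_le_mul_of_nonneg_left h4 (sq_nonneg _)
  linarith

lemma assouad {n p r : ℕ} {ι : Type*} [Fintype ι] [DecidableEq ι]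
    (V : (ι → Bool) → Matrix (Fin p) (Fin r) ℝ) (hV : ∀ b, IsOrthonormalCols (V b))
    (lam : ℝ) (hl : 0 < lam) (τ : ℝ) (hτ : hfun lam * τ ≤ 1 / 2)
    (hτ2 : exp (n * (hfun lam * τ)) ≤ 2)
    (hadj : ∀ b a, loss (V b) (V (Function.update b a (!b a))) ≤ τ)
    (g : ι → (Fin n → Fin p → ℝ) → Bool) (hg : ∀ a, MeasurableSet {x | g a x = true}) :
    ∃ b, (Fintype.card ι : ℝ) / 4 ≤
      ∑ a, (spikedMeasure n p r (fun _ => lam) (V b) 1).real {x | g a x ≠ b a} := by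
  have hg' : ∀ a (c : Bool), MeasurableSet {x | g a x ≠ c} := by
    intro a c
    cases c
    · convert hg a using 2; simp
    · exact (hg a).compl
  by_contra hcon
  push Not at hcon
  have hlt : ∑ b : ι → Bool, ∑ a, (spikedMeasure n p r (fun _ => lam) (V b) 1).real {x | g a x ≠ b a}
      < ∑ b : ι → Bool, (Fintype.card ι : ℝ) / 4 :=
    Finset.sum_lt_sum_of_nonempty Finset.univ_nonempty fun b _ => hcon b
  rw [Finset.sum_comm] at hlt
  have hge : ∀ a, (Fintype.card (ι → Bool) : ℝ) / 4 ≤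
      ∑ b : ι → Bool, (spikedMeasure n p r (fun _ => lam) (V b) 1).real {x | g a x ≠ b a} := by
    intro a
    have hinv : Function.Involutive (fun b : ι → Bool => Function.update b a (!b a)) := by
      intro b; simp
    have hflip : ∑ b : ι → Bool, (spikedMeasure n p r (fun _ => lam) (V b) 1).real {x | g a x ≠ b a}
        = ∑ b : ι → Bool, (spikedMeasure n p r (fun _ => lam) (V (Function.update b a (!b a))) 1).real
          {x | g a x ≠ (Function.update b a (!b a)) a} :=
      (Equiv.sum_comp (hinv.toPerm _) (fun b => (spikedMeasure n p r (fun _ => lam) (V b) 1).real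
        {x | g a x ≠ b a})).symm
    have hpair : ∀ b : ι → Bool, (1:ℝ) / 2 ≤
        (spikedMeasure n p r (fun _ => lam) (V b) 1).real {x | g a x ≠ b a} +
        (spikedMeasure n p r (fun _ => lam) (V (Function.update b a (!b a))) 1).real
          {x | g a x ≠ (Function.update b a (!b a)) a} := by
      intro b
      have hh := hfun_pos hl
      have hle : hfun lam * loss (V b) (V (Function.update b a (!b a))) ≤ hfun lam * τ :=
        mul_le_mul_of_nonneg_left (hadj b a) hh.le
      have h1 := chi_cmp (n := n) (hV b) (hV (Function.update b a (!b a))) lam hl (hle.trans hτ) 2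
        two_pos {x | g a x ≠ b a} (hg' a _)
      have h2 : exp (n * (hfun lam * loss (V b) (V (Function.update b a (!b a))))) ≤ 2 :=
        le_trans (Real.exp_le_exp.2 (mul_le_mul_of_nonneg_left hle (Nat.cast_nonneg _))) hτ2
      have h3 : {x : Fin n → Fin p → ℝ | g a x ≠ (Function.update b a (!b a)) a}
          = {x | g a x ≠ b a}ᶜ := by
        ext x
        simp only [Function.update_self, Set.mem_ofPred_eq, Set.mem_compl_iff]
        cases g a x <;> cases b a <;> simp
      have : IsProbabilityMeasure
          (spikedMeasure n p r (fun _ => lam) (V (Function.update b a (!b a))) 1) := inferInstance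
      rw [h3, probReal_compl_eq_one_sub (hg' a _)]
      linarith
    have h5 : ∑ b : ι → Bool, (1:ℝ) / 2 ≤ ∑ b : ι → Bool,
        ((spikedMeasure n p r (fun _ => lam) (V b) 1).real {x | g a x ≠ b a} +
        (spikedMeasure n p r (fun _ => lam) (V (Function.update b a (!b a))) 1).real
          {x | g a x ≠ (Function.update b a (!b a)) a}) := Finset.sum_le_sum fun b _ => hpair b
    rw [Finset.sum_add_distrib, ← hflip] at h5
    simp only [Finset.sum_const, Finset.card_univ, nsmul_eq_mul] at h5
    linarith
  have h6 := Finset.sum_le_sum fun a (_ : a ∈ Finset.univ) => hge a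
  have h7 := h6.trans_lt hlt
  simp only [Finset.sum_const, Finset.card_univ, nsmul_eq_mul] at h7
  linarith

/-- sign matrix -/
def Eb {m r : ℕ} (ε : ℝ) (b : Fin m × Fin r → Bool) : Matrix (Fin m) (Fin r) ℝ :=
  Matrix.of fun i k => if b (i, k) then ε else -ε

lemma Eb_update {m r : ℕ} (ε : ℝ) (b : Fin m × Fin r → Bool) (a : Fin m × Fin r) :
    Eb ε (Function.update b a (!b a)) - Eb ε b
      = Matrix.single a.1 a.2 (if b a then -(2 * ε) else 2 * ε) := by
  ext i k
  rw [Matrix.sub_apply, Matrix.single_apply]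
  unfold Eb
  simp only [Matrix.of_apply]
  by_cases h : a = (i, k)
  · subst h
    simp only [Function.update_self, and_self, if_true]
    cases b (i, k) <;> simp <;> ring
  · have h1 : (i, k) ≠ a := fun h' => h h'.symm
    have h2 : ¬ (a.1 = i ∧ a.2 = k) := fun h' => h (Prod.ext h'.1 h'.2)
    rw [Function.update_of_ne h1, if_neg h2, sub_self]

lemma Eb_frob {m r : ℕ} (ε : ℝ) (b : Fin m × Fin r → Bool) : frobSq (Eb ε b) = m * r * ε ^ 2 := by
  unfold frobSq Eb
  have : ∀ i k, (Matrix.of (fun (i : Fin m) (k : Fin r) => if b (i, k) then ε else -ε) i k) ^ 2 = ε ^ 2 := by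
    intro i k
    rw [Matrix.of_apply]
    split_ifs <;> ring
  simp only [this]
  simp; ring

lemma block_le {p k l : ℕ} (A : Matrix (Fin p) (Fin p) ℝ) (ψ : Fin k → Fin p) (φ : Fin l → Fin p)
    (hψ : Function.Injective ψ) (hφ : Function.Injective φ) :
    frobSq (A.submatrix ψ φ) ≤ frobSq A := by
  classical
  unfold frobSq
  simp only [Matrix.submatrix_apply]
  have h1 : ∀ i, ∑ j, A i (φ j) ^ 2 ≤ ∑ j, A i j ^ 2 := by
    intro i
    rw [← Finset.sum_image (f := fun j => A i j ^ 2) (s := Finset.univ) (g := φ) (fun x _ y _ h => hφ h)]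
    exact Finset.sum_le_sum_of_subset_of_nonneg (Finset.subset_univ _) fun _ _ _ => sq_nonneg _
  refine (Finset.sum_le_sum fun i _ => h1 (ψ i)).trans ?_
  rw [← Finset.sum_image (f := fun i => ∑ j, A i j ^ 2) (s := Finset.univ) (g := ψ)
    (fun x _ y _ h => hψ h)]
  exact Finset.sum_le_sum_of_subset_of_nonneg (Finset.subset_univ _)
    fun _ _ _ => Finset.sum_nonneg fun _ _ => sq_nonneg _

lemma wrong_sq (ε y : ℝ) (hε : 0 < ε) (b : Bool) (h : decide (0 < y) ≠ b) :
    ε ^ 2 ≤ (y - if b then ε else -ε) ^ 2 := by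
  cases b
  · have : 0 < y := by simpa using h
    simp only [Bool.false_eq_true, if_false]
    nlinarith
  · have : y ≤ 0 := by simpa using h
    simp only [if_true]
    nlinarith

lemma lower_A_core {n p r m : ℕ} (κ lam : ℝ) (hκ : 1 < κ) (hl : 0 < lam) (hn : 1 ≤ n)
    (hrm : r + m ≤ p) (ε : ℝ) (hε : 0 < ε)
    (hε2 : n * (hfun lam * (8 * ε ^ 2)) ≤ 1 / 2) (hθ : m * r * ε ^ 2 ≤ 1 / 8)
    (f : (Fin n → Fin p → ℝ) → (Fin p → Fin r → ℝ)) (hf : Measurable f)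
    (ho : ∀ x, IsOrthonormalCols (Matrix.of (f x))) :
    ∃ V, InTheta 0 ((r + m : ℕ) : ℝ) p r lam κ V (fun _ => lam) ∧
      m * r * ε ^ 2 / 16 ≤ ∫ x, loss (Matrix.of (f x)) V
        ∂(spikedMeasure n p r (fun _ => lam) V 1) := by
  let φ : Fin r → Fin p := fun i => ⟨i, by omega⟩
  let ψ : Fin m → Fin p := fun i => ⟨r + i, by omega⟩
  have hφ : Function.Injective φ := by
    intro i j h; simp only [φ, Fin.mk.injEq] at h; exact Fin.ext h
  have hψ : Function.Injective ψ := by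
    intro i j h; simp only [ψ, Fin.mk.injEq] at h; exact Fin.ext (by omega)
  have hd : ∀ i j, φ i ≠ ψ j := by
    intro i j h; simp only [φ, ψ, Fin.mk.injEq] at h; omega
  choose T hT1 hT2 using fun b : Fin m × Fin r → Bool => exists_VE φ ψ hφ hψ hd (Eb ε b)
  set V : (Fin m × Fin r → Bool) → Matrix (Fin p) (Fin r) ℝ :=
    fun b => (emb φ + emb ψ * Eb ε b) * T b with hVdef
  have hadj : ∀ b a, loss (V b) (V (Function.update b a (!b a))) ≤ 8 * ε ^ 2 := by
    intro b a
    have := adj_loss (emb_self ψ hψ) (hT1 b) (hT1 (Function.update b a (!b a))) (hT2 b)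
      (hT2 _) a.1 a.2 _ (Eb_update ε b a)
    refine this.trans (le_of_eq ?_)
    split_ifs <;> ring
  have hn0 : (1:ℝ) ≤ n := by exact_mod_cast hn
  have hh := hfun_pos hl
  have hε3 : hfun lam * (8 * ε ^ 2) ≤ 1 / 2 := by
    have : 0 ≤ hfun lam * (8 * ε ^ 2) := by positivity
    nlinarith
  have hexp : exp (n * (hfun lam * (8 * ε ^ 2))) ≤ 2 := by
    refine (Real.exp_le_exp.2 hε2).trans ?_
    have h1 := Real.exp_one_lt_d9
    have h2 : exp (1 / 2) * exp (1 / 2) = exp 1 := by rw [← Real.exp_add]; norm_num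
    nlinarith [Real.exp_pos (1 / 2)]
  -- the estimated projection block
  let Y : (Fin n → Fin p → ℝ) → Matrix (Fin p) (Fin p) ℝ :=
    fun x => Matrix.of (f x) * (Matrix.of (f x))ᵀ
  have hY : ∀ i j, Measurable (fun x => Y x i j) := by
    intro i j
    have hf' : ∀ i j, Measurable (fun x => f x i j) := fun i j => by fun_prop
    simp only [Y, Matrix.mul_apply, Matrix.transpose_apply, Matrix.of_apply]
    fun_prop
  let g : Fin m × Fin r → (Fin n → Fin p → ℝ) → Bool := fun a x => decide (0 < Y x (ψ a.1) (φ a.2))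
  have hg : ∀ a, MeasurableSet {x | g a x = true} := by
    intro a
    simp only [g, decide_eq_true_eq]
    exact measurableSet_lt measurable_const (hY _ _)
  obtain ⟨b, hb⟩ := assouad V hT1 lam hl (8 * ε ^ 2) hε3 hexp hadj g hg
  refine ⟨V b, ⟨hT1 b, ?_, fun _ _ _ => le_rfl, fun i => ⟨hl, le_rfl, by nlinarith⟩⟩, ?_⟩
  · classical
    refine weakLq_backward (Finset.univ.filter fun j : Fin p => (j : ℕ) < r + m) ?_ ?_
    · rw [Fin.card_filter_val_lt]; omega
    · intro j hj k
      have hj' : ¬ (j : ℕ) < r + m := by simpa using hj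
      have : ∀ k, (emb φ + emb ψ * Eb ε b) j k = 0 := by
        intro k
        have e1 : ∀ k, emb φ j k = 0 := by
          intro k
          simp only [emb, Matrix.submatrix_apply, id, Matrix.one_apply]
          rw [if_neg]; intro h; apply hj'; rw [h]; simp only [φ]; omega
        have e2 : ∀ k, emb ψ j k = 0 := by
          intro k
          simp only [emb, Matrix.submatrix_apply, id, Matrix.one_apply]
          rw [if_neg]; intro h; apply hj'; rw [h]; simp only [ψ]; omega
        rw [Matrix.add_apply, Matrix.mul_apply, e1]
        simp [e2]
      simp only [hVdef]
      rw [Matrix.mul_apply]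
      simp [this]
  · set P := spikedMeasure n p r (fun _ => lam) (V b) 1 with hP
    have hPp : IsProbabilityMeasure P := by rw [hP]; infer_instance
    have hθ0 := Eb_frob ε b
    set θ := (m:ℝ) * r * ε ^ 2 with hθdef
    have hθnn : 0 ≤ θ := by positivity
    have hQ : ∀ x, frobSq ((Y x).submatrix ψ φ - Eb ε b) ≤ 2 * loss (Matrix.of (f x)) (V b) + 8 * θ ^ 3 := by
      intro x
      have hblock : (V b * (V b)ᵀ).submatrix ψ φ = Eb ε b * (T b * (T b)ᵀ) := by
        have h1 : (V b * (V b)ᵀ).submatrix ψ φ = (emb ψ)ᵀ * (V b * (V b)ᵀ) * emb φ := by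
          rw [emb_tmul, mul_emb]; rfl
        have h2 : (emb ψ)ᵀ * V b = Eb ε b * T b := by
          simp only [hVdef]
          rw [← Matrix.mul_assoc, Matrix.mul_add, emb_disj ψ φ fun i j => (hd j i).symm,
            ← Matrix.mul_assoc, emb_self ψ hψ]
          simp
        have h3 : (V b)ᵀ * emb φ = (T b)ᵀ := by
          simp only [hVdef]
          rw [transpose_mul, transpose_add, transpose_mul, Matrix.mul_assoc, Matrix.add_mul,
            emb_self φ hφ, Matrix.mul_assoc, emb_disj ψ φ fun i j => (hd j i).symm]
          simp
        rw [h1, ← Matrix.mul_assoc, h2, Matrix.mul_assoc, h3, Matrix.mul_assoc]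
      have h4 := Q_close (hT2 b) θ hθ0 (by linarith)
      have h5 := block_le (Y x - V b * (V b)ᵀ) ψ φ hψ hφ
      have h6 : (Y x - V b * (V b)ᵀ).submatrix ψ φ = (Y x).submatrix ψ φ - Eb ε b * (T b * (T b)ᵀ) := by
        rw [← hblock]; rfl
      rw [h6] at h5
      have h7 : frobSq (Y x - V b * (V b)ᵀ) = loss (Matrix.of (f x)) (V b) := rfl
      have h8 := frobSq_add_le ((Y x).submatrix ψ φ - Eb ε b * (T b * (T b)ᵀ))
        (Eb ε b * (T b * (T b)ᵀ) - Eb ε b)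
      rw [sub_add_sub_cancel] at h8
      linarith
    have hcount : ∀ x, ∑ a, ε ^ 2 * Set.indicator {x | g a x ≠ b a} (fun _ => (1:ℝ)) x
        ≤ 2 * loss (Matrix.of (f x)) (V b) + 8 * θ ^ 3 := by
      intro x
      refine le_trans ?_ (hQ x)
      unfold frobSq
      rw [← Finset.sum_product']
      refine Finset.sum_le_sum fun a _ => ?_
      by_cases hx : g a x ≠ b a
      · rw [Set.indicator_of_mem (by exact hx), mul_one]
        exact wrong_sq ε _ hε (b a) hx
      · rw [Set.indicator_of_notMem (by exact hx), mul_zero]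
        exact sq_nonneg _
    have hms : ∀ a, MeasurableSet {x | g a x ≠ b a} := by
      intro a
      cases b a
      · convert hg a using 2; simp
      · exact (hg a).compl
    have hInteg : ∀ a, Integrable (fun x => ε ^ 2 * Set.indicator {x | g a x ≠ b a} (fun _ => (1:ℝ)) x) P := by
      intro a
      exact ((integrable_const (1:ℝ)).indicator (hms a)).const_mul _
    have hI := integral_mono (integrable_finsetSum Finset.univ fun a _ => hInteg a)
      (((integrable_loss hf ho (hT1 b) P).const_mul 2).add (integrable_const (8 * θ ^ 3))) hcount
    rw [integral_finsetSum _ fun a _ => hInteg a] at hI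
    simp only [Pi.add_apply] at hI
    rw [integral_add ((integrable_loss hf ho (hT1 b) P).const_mul 2) (integrable_const _)] at hI
    simp only [integral_const_mul, integral_const, probReal_univ, smul_eq_mul, one_mul] at hI
    have h9 : ∀ a, ∫ x, Set.indicator {x | g a x ≠ b a} (fun _ => (1:ℝ)) x ∂P = P.real {x | g a x ≠ b a} := by
      intro a
      rw [integral_indicator_const _ (hms a)]; simp
    simp only [h9] at hI
    rw [← Finset.mul_sum] at hI
    have h10 := mul_le_mul_of_nonneg_left hb (sq_nonneg ε)
    have h11 : ε ^ 2 * ((Fintype.card (Fin m × Fin r) : ℝ) / 4) = θ / 4 := by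
      rw [hθdef]; simp; ring
    rw [h11] at h10
    have h12 : θ ^ 3 ≤ θ / 64 := by
      have : θ ^ 2 ≤ 1 / 64 := by nlinarith
      nlinarith
    have hI' : ε ^ 2 * ∑ a, P.real {x | g a x ≠ b a} ≤
      2 * ∫ x, loss (Matrix.of (f x)) (V b) ∂P + 8 * θ ^ 3 := hI
    linarith

lemma lower_A {n p r s : ℕ} (κ lam : ℝ) (hκ : 1 < κ) (hr : 1 ≤ r) (hrs : r ≤ s) (hsp : s ≤ p)
    (hl : 0 < lam) (L : ℝ) (hL1 : 1 ≤ L) (hn : 1 ≤ n)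
    (h2 : 2 * L ≤ (s : ℝ) - r)
    (hR : ((r : ℝ) * (s - r) + s * L) / (n * hfun lam) ≤ 1) (hA : L ≤ 24 * r)
    (f : (Fin n → Fin p → ℝ) → (Fin p → Fin r → ℝ)) (hf : Measurable f)
    (ho : ∀ x, IsOrthonormalCols (Matrix.of (f x))) :
    ∃ V, InTheta 0 s p r lam κ V (fun _ => lam) ∧
      ((r : ℝ) * (s - r) + s * L) / (n * hfun lam) / 7000 ≤ ∫ x, loss (Matrix.of (f x)) V
        ∂(spikedMeasure n p r (fun _ => lam) V 1) := by
  obtain ⟨m, rfl⟩ : ∃ m, s = r + m := ⟨s - r, by omega⟩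
  have hm : ((r + m : ℕ) : ℝ) - (r : ℝ) = m := by push_cast; ring
  rw [hm] at h2 hR ⊢
  have hr1 : (1:ℝ) ≤ r := by exact_mod_cast hr
  have hn1 : (1:ℝ) ≤ n := by exact_mod_cast hn
  have hh := hfun_pos hl
  have hnh : 0 < n * hfun lam := by positivity
  set ε := Real.sqrt (1 / (16 * (n * hfun lam))) with hε
  have hε0 : 0 < ε := Real.sqrt_pos.2 (by positivity)
  have hεs : ε ^ 2 = 1 / (16 * (n * hfun lam)) := Real.sq_sqrt (by positivity)
  rw [div_le_one hnh] at hR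
  have hsL : 0 ≤ ((r + m : ℕ) : ℝ) * L := by positivity
  obtain ⟨V, hV, hVr⟩ := lower_A_core (n := n) κ lam hκ hl hn hsp ε hε0
    (by rw [hεs]; apply le_of_eq; field_simp; norm_num)
    (by rw [hεs, mul_one_div, div_le_iff₀ (by positivity)]; nlinarith) f hf ho
  refine ⟨V, hV, le_trans ?_ hVr⟩
  rw [hεs, mul_one_div, div_div, div_div, div_le_div_iff₀ (by positivity) (by positivity)]
  have h3 : (m:ℝ) * L ≤ 24 * (r * m) := by nlinarith
  have h4 : (r:ℝ) * L ≤ r * m / 2 := by nlinarith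
  have h5 : (r:ℝ) * m + (r + m : ℕ) * L ≤ 26 * (r * m) := by
    push_cast
    have : (0:ℝ) ≤ r * m := by positivity
    linarith
  have h6 := mul_le_mul_of_nonneg_right h5 (by positivity : 0 ≤ 16 * (n * hfun lam) * 16)
  have h7 : 0 ≤ (m * r : ℝ) * (n * hfun lam) := by positivity
  linarith

/-- The set of orthonormal `s`-row-sparse matrices. -/
def SpSet (p r s : ℕ) : Set (Fin p → Fin r → ℝ) :=
  {V | IsOrthonormalCols (Matrix.of V) ∧
    ∃ B : Finset (Fin p), B.card = s ∧ ∀ j, j ∉ B → ∀ k, V j k = 0}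

lemma SpSet_nonempty {p r s : ℕ} (hrs : r ≤ s) (hsp : s ≤ p) : (SpSet p r s).Nonempty := by
  have hrp : r ≤ p := hrs.trans hsp
  refine ⟨fun j k => if j = Fin.castLE hrp k then 1 else 0, ?_, ?_⟩
  · unfold IsOrthonormalCols
    ext i j
    simp [Matrix.mul_apply, Matrix.one_apply, eq_comm]
  · obtain ⟨B, hB1, hB2⟩ := Finset.exists_subsuperset_card_eq
      (s := (Finset.univ : Finset (Fin r)).image (Fin.castLE hrp))
      (t := Finset.univ) (n := s) (Finset.subset_univ _)
      (by refine Finset.card_image_le.trans ?_; simpa using hrs) (by simpa using hsp)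
    refine ⟨B, hB2.2, fun j hj k => ?_⟩
    simp only [ite_eq_right_iff, one_ne_zero, imp_false]
    rintro rfl
    exact hj (hB1 (by simp))

lemma frobSq_orth {p r : ℕ} {V : Matrix (Fin p) (Fin r) ℝ} (hV : IsOrthonormalCols V) :
    frobSq V = r := by
  rw [frobSq_eq_trace, hV]; simp

lemma exists_est (n : ℕ) {p r s : ℕ} (hrs : r ≤ s) (hsp : s ≤ p) {ε : ℝ} (hε : 0 < ε) :
    ∃ f : (Fin n → Fin p → ℝ) → (Fin p → Fin r → ℝ), Measurable f ∧
      (∀ x, f x ∈ SpSet p r s) ∧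
      ∀ x, ∀ V ∈ SpSet p r s, frobSq (Matrix.of x * Matrix.of V) - ε
        ≤ frobSq (Matrix.of x * Matrix.of (f x)) := by
  classical
  have : Nonempty (SpSet p r s) := (SpSet_nonempty hrs hsp).to_subtype
  set v : ℕ → SpSet p r s := TopologicalSpace.denseSeq (SpSet p r s) with hv
  have hd : closure (Set.range v) = Set.univ :=
    (TopologicalSpace.denseRange_denseSeq (SpSet p r s)).closure_range
  clear_value v
  set Φ : (Fin n → Fin p → ℝ) → (Fin p → Fin r → ℝ) → ℝ :=
    fun x V => frobSq (Matrix.of x * Matrix.of V) with hΦ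
  have hΦm : ∀ V, Measurable (fun x => Φ x V) := by
    intro V
    simp only [hΦ, frobSq, Matrix.mul_apply, Matrix.of_apply]
    fun_prop
  have hΦc : ∀ x, Continuous (fun V => Φ x V) := by
    intro x
    simp only [hΦ, frobSq, Matrix.mul_apply, Matrix.of_apply]
    fun_prop
  let P : (Fin n → Fin p → ℝ) → ℕ → Prop := fun x m => ∀ i, Φ x (v i) - ε ≤ Φ x (v m)
  have hex : ∀ x, ∃ N, P x N := by
    intro x
    have hb : BddAbove (Set.range fun i => Φ x (v i)) := by
      refine ⟨frobSq (Matrix.of x) * r, ?_⟩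
      rintro _ ⟨i, rfl⟩
      have h := frobSq_mul_le (Matrix.of x) (Matrix.of (v i : Fin p → Fin r → ℝ))
      rwa [frobSq_orth (v i).2.1] at h
    obtain ⟨N, hN⟩ := exists_lt_of_lt_ciSup
      (show (⨆ i, Φ x (v i)) - ε < ⨆ i, Φ x (v i) by linarith)
    refine ⟨N, fun i => ?_⟩
    have := le_ciSup hb i
    linarith
  have hPm : ∀ k, MeasurableSet {x | P x k} := by
    intro k
    have : {x | P x k} = ⋂ i, {x | Φ x (v i) - ε ≤ Φ x (v k)} := by
      ext x; simp [P]
    rw [this]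
    exact MeasurableSet.iInter fun i =>
      measurableSet_le ((hΦm _).sub_const _) (hΦm _)
  refine ⟨fun x => v (Nat.find (hex x)), ?_, fun x => (v _).2, ?_⟩
  · exact (measurable_from_nat (f := fun i => (v i : Fin p → Fin r → ℝ))).comp
      (measurable_find hex hPm)
  · intro x V hV
    have hspec : P x (Nat.find (hex x)) := Nat.find_spec (hex x)
    show Φ x V - ε ≤ Φ x (v (Nat.find (hex x)))
    generalize Nat.find (hex x) = N at hspec ⊢
    have hspec' : ∀ i, Φ x (v i) - ε ≤ Φ x (v N) := hspec
    clear hspec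
    clear_value Φ
    have hcl : IsClosed {V : SpSet p r s | Φ x V - ε ≤ Φ x (v N)} :=
      isClosed_le (((hΦc x).comp continuous_subtype_val).sub continuous_const) continuous_const
    have hsub : Set.range v ⊆ {V : SpSet p r s | Φ x V - ε ≤ Φ x (v N)} := by
      rintro _ ⟨i, rfl⟩
      exact hspec' i
    have h3 := closure_minimal hsub hcl
    have h4 : (⟨V, hV⟩ : SpSet p r s) ∈ closure (Set.range v) := by
      rw [hd]; exact Set.mem_univ _
    exact h3 h4

lemma frobSq_pyth {p r : ℕ} {k : Type*} [Fintype k] {V : Matrix (Fin p) (Fin r) ℝ}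
    (hV : IsOrthonormalCols V) (W : Matrix (Fin p) k ℝ) :
    frobSq W = frobSq (W - V * (Vᵀ * W)) + frobSq (Vᵀ * W) := by
  unfold IsOrthonormalCols at *
  rw [frobSq_eq_trace, frobSq_eq_trace, frobSq_eq_trace, ← trace_add]
  congr 1
  have a1 : (V * (Vᵀ * W))ᵀ * W = (Vᵀ * W)ᵀ * (Vᵀ * W) := by
    simp only [transpose_mul, transpose_transpose, Matrix.mul_assoc]
  have a2 : Wᵀ * (V * (Vᵀ * W)) = (Vᵀ * W)ᵀ * (Vᵀ * W) := by
    simp only [transpose_mul, transpose_transpose, Matrix.mul_assoc]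
  have a3 : (V * (Vᵀ * W))ᵀ * (V * (Vᵀ * W)) = (Vᵀ * W)ᵀ * (Vᵀ * W) := by
    rw [transpose_mul, Matrix.mul_assoc, ← Matrix.mul_assoc Vᵀ V, hV, Matrix.one_mul]
  rw [transpose_sub, Matrix.sub_mul, Matrix.mul_sub, Matrix.mul_sub, a1, a2, a3]; abel

lemma frobSq_contr {p r : ℕ} {k : Type*} [Fintype k] {V : Matrix (Fin p) (Fin r) ℝ}
    (hV : IsOrthonormalCols V) (W : Matrix (Fin p) k ℝ) : frobSq (Vᵀ * W) ≤ frobSq W := by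
  rw [frobSq_pyth hV W]; linarith [frobSq_nonneg (W - V * (Vᵀ * W))]

lemma frobSq_add_eq {m k : Type*} [Fintype m] [Fintype k] (A B : Matrix m k ℝ) :
    frobSq (A + B) = frobSq A + 2 * trace (Aᵀ * B) + frobSq B := by
  rw [frobSq_eq_trace, frobSq_eq_trace, frobSq_eq_trace, transpose_add, Matrix.add_mul,
    Matrix.mul_add, Matrix.mul_add, trace_add, trace_add, trace_add]
  have : trace (Bᵀ * A) = trace (Aᵀ * B) := by
    rw [← trace_transpose, transpose_mul, transpose_transpose]
  rw [this]; ring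

lemma two_trace_le {m k : Type*} [Fintype m] [Fintype k] (A B : Matrix m k ℝ) {c : ℝ}
    (hc : 0 < c) : 2 * trace (Aᵀ * B) ≤ c⁻¹ * frobSq A + c * frobSq B := by
  have h := frobSq_nonneg (A - c • B)
  have e : A - c • B = A + (-c) • B := by ext i j; simp; ring
  have h2 : frobSq ((-c) • B) = c ^ 2 * frobSq B := by
    unfold frobSq
    simp only [Finset.mul_sum]
    refine Finset.sum_congr rfl fun i _ => Finset.sum_congr rfl fun j _ => ?_
    simp; ring
  rw [e, frobSq_add_eq, h2] at h
  simp only [Matrix.mul_smul, trace_smul, smul_eq_mul] at h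
  have h3 : 0 ≤ c⁻¹ * (frobSq A + 2 * (-c * trace (Aᵀ * B)) + c ^ 2 * frobSq B) := by positivity
  have h4 : c⁻¹ * (frobSq A + 2 * (-c * trace (Aᵀ * B)) + c ^ 2 * frobSq B)
      = c⁻¹ * frobSq A - 2 * trace (Aᵀ * B) + c * frobSq B := by field_simp; ring
  linarith

lemma det_bound {n p r d : ℕ} {V W : Matrix (Fin p) (Fin r) ℝ} (hV : IsOrthonormalCols V)
    (hW : IsOrthonormalCols W) {E : Matrix (Fin p) (Fin d) ℝ} (hE : IsOrthonormalCols E)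
    (Y : Matrix (Fin n) (Fin r) ℝ) (Z : Matrix (Fin n) (Fin p) ℝ)
    (hEG : E * (Eᵀ * (W - V * (Vᵀ * W))) = W - V * (Vᵀ * W))
    {a b m ε : ℝ} (hm : 0 < m) (hab : m ≤ a - b)
    (hY : ∀ h : Fin r → ℝ, a * (h ⬝ᵥ h) ≤ (Y *ᵥ h) ⬝ᵥ (Y *ᵥ h))
    (hZ : frobSq (Z * (W - V * (Vᵀ * W))) ≤ b * frobSq (W - V * (Vᵀ * W)))
    (hf : frobSq Y - ε ≤ frobSq (Y * (Vᵀ * W) + Z * (W - V * (Vᵀ * W)))) :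
    m * frobSq (W - V * (Vᵀ * W)) / 2 ≤ 2 / m * frobSq (Eᵀ * Zᵀ * Y) + ε := by
  have hH : frobSq (V - W * (Wᵀ * V)) = frobSq (W - V * (Vᵀ * W)) := by
    have h1 := loss_eq_resid hV hW
    have h2 := loss_eq_resid hW hV
    rw [loss_comm] at h2
    linarith
  have hYd : frobSq Y = frobSq ((V - W * (Wᵀ * V)) * Yᵀ) + frobSq (Y * (Vᵀ * W)) := by
    have h1 := frobSq_isom hV Yᵀ
    rw [frobSq_transpose] at h1
    rw [← h1, frobSq_pyth hW (V * Yᵀ)]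
    congr 1
    · congr 1
      rw [Matrix.sub_mul]; simp only [Matrix.mul_assoc]
    · rw [← frobSq_transpose]
      simp only [transpose_mul, transpose_transpose, Matrix.mul_assoc]
  have hYl : a * frobSq (V - W * (Wᵀ * V)) ≤ frobSq ((V - W * (Wᵀ * V)) * Yᵀ) := by
    generalize V - W * (Wᵀ * V) = H
    unfold frobSq
    rw [Finset.mul_sum]
    refine Finset.sum_le_sum fun j _ => ?_
    have h := hY (H j)
    have e1 : H j ⬝ᵥ H j = ∑ k, H j k ^ 2 := by
      simp only [dotProduct]; exact Finset.sum_congr rfl fun k _ => by ring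
    have e2 : (Y *ᵥ H j) ⬝ᵥ (Y *ᵥ H j) = ∑ i, ((H * Yᵀ) j i) ^ 2 := by
      simp only [dotProduct]
      refine Finset.sum_congr rfl fun i _ => ?_
      have : (H * Yᵀ) j i = (Y *ᵥ H j) i := by
        simp only [Matrix.mul_apply, transpose_apply, mulVec, dotProduct]
        exact Finset.sum_congr rfl fun k _ => by ring
      rw [this]; ring
    rwa [e1, e2] at h
  rw [hH] at hYl
  rw [frobSq_add_eq] at hf
  generalize hG : W - V * (Vᵀ * W) = G at *
  have htr : trace ((Y * (Vᵀ * W))ᵀ * (Z * G))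
      = trace ((Eᵀ * Zᵀ * Y)ᵀ * ((Eᵀ * G) * (Wᵀ * V))) := by
    have e1 : (Eᵀ * Zᵀ * Y)ᵀ * ((Eᵀ * G) * (Wᵀ * V)) = (Yᵀ * Z * (E * (Eᵀ * G))) * (Wᵀ * V) := by
      simp only [transpose_mul, transpose_transpose, Matrix.mul_assoc]
    rw [e1, hEG, trace_mul_comm (Yᵀ * Z * G) (Wᵀ * V)]
    simp only [transpose_mul, transpose_transpose, Matrix.mul_assoc]
  have hB : frobSq ((Eᵀ * G) * (Wᵀ * V)) ≤ frobSq G := by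
    have e1 : frobSq ((Eᵀ * G) * (Wᵀ * V)) = frobSq (Vᵀ * (W * (Eᵀ * G)ᵀ)) := by
      rw [← frobSq_transpose]
      simp only [transpose_mul, transpose_transpose, Matrix.mul_assoc]
    rw [e1]
    refine (frobSq_contr hV _).trans ?_
    rw [frobSq_isom hW, frobSq_transpose]
    exact frobSq_contr hE G
  have hcs := two_trace_le (Eᵀ * Zᵀ * Y) ((Eᵀ * G) * (Wᵀ * V)) (c := m / 2) (by positivity)
  rw [← htr] at hcs
  have h5 : m / 2 * frobSq ((Eᵀ * G) * (Wᵀ * V)) ≤ m / 2 * frobSq G :=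
    mul_le_mul_of_nonneg_left hB (by positivity)
  have h6 : m * frobSq G ≤ (a - b) * frobSq G :=
    mul_le_mul_of_nonneg_right hab (frobSq_nonneg _)
  have h7 : (m / 2)⁻¹ = 2 / m := by rw [inv_div]
  rw [h7] at hcs
  linarith

/-- vectors supported on `S`, orthogonal to the columns of `V` -/
def LSub {p r : ℕ} (V : Matrix (Fin p) (Fin r) ℝ) (S : Finset (Fin p)) :
    Submodule ℝ (EuclideanSpace ℝ (Fin p)) where
  carrier := {x | (∀ j, j ∉ S → x j = 0) ∧ ∀ k, ∑ j, V j k * x j = 0}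
  add_mem' := by
    rintro x y ⟨h1, h2⟩ ⟨h3, h4⟩
    refine ⟨fun j hj => by simp [h1 j hj, h3 j hj], fun k => ?_⟩
    simp [mul_add, Finset.sum_add_distrib, h2 k, h4 k]
  zero_mem' := by constructor <;> simp
  smul_mem' := by
    rintro c x ⟨h1, h2⟩
    refine ⟨fun j hj => by simp [h1 j hj], fun k => ?_⟩
    have : ∑ j, V j k * (c • x) j = c * ∑ j, V j k * x j := by
      rw [Finset.mul_sum]
      exact Finset.sum_congr rfl fun j _ => by simp; ring
    rw [this, h2 k, mul_zero]

lemma exists_E {p r : ℕ} {V : Matrix (Fin p) (Fin r) ℝ} (hV : IsOrthonormalCols V)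
    (S : Finset (Fin p)) (hS : ∀ j, j ∉ S → ∀ k, V j k = 0) :
    ∃ (d : ℕ) (E : Matrix (Fin p) (Fin d) ℝ), IsOrthonormalCols E ∧ r + d ≤ S.card ∧
      ∀ (c : ℕ) (G : Matrix (Fin p) (Fin c) ℝ), (∀ j, j ∉ S → ∀ k, G j k = 0) → Vᵀ * G = 0 →
        E * (Eᵀ * G) = G := by
  classical
  set b := stdOrthonormalBasis ℝ (LSub V S) with hb
  set d := Module.finrank ℝ (LSub V S) with hd
  let E : Matrix (Fin p) (Fin d) ℝ := Matrix.of fun j a => (b a : EuclideanSpace ℝ (Fin p)) j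
  have hE : IsOrthonormalCols E := by
    unfold IsOrthonormalCols
    ext a c
    have h := (orthonormal_iff_ite.1 b.orthonormal) a c
    rw [Submodule.coe_inner, PiLp.inner_apply] at h
    rw [Matrix.mul_apply, Matrix.one_apply, ← h]
    refine Finset.sum_congr rfl fun j _ => ?_
    simp only [E, transpose_apply, Matrix.of_apply, RCLike.inner_apply, conj_trivial]; ring
  have hE0 : ∀ j, j ∉ S → ∀ a, E j a = 0 := fun j hj a => (b a).2.1 j hj
  have hVE : Eᵀ * V = 0 := by
    ext a k
    have := (b a).2.2 k
    rw [Matrix.mul_apply, Matrix.zero_apply, ← this]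
    exact Finset.sum_congr rfl fun j _ => by simp only [transpose_apply, E, Matrix.of_apply]; ring
  refine ⟨d, E, hE, ?_, ?_⟩
  · let D : Matrix (Fin p) (Fin p) ℝ := diagonal fun j => if j ∈ S then 1 else 0
    have hD : frobSq D = S.card := by
      unfold frobSq
      have : ∀ i, ∑ j, D i j ^ 2 = if i ∈ S then 1 else 0 := by
        intro i
        rw [Finset.sum_eq_single i]
        · simp [D]
        · intro j _ hj; simp [D, diagonal_apply_ne _ hj.symm]
        · simp
      simp [this]
    have hT : ∀ {m : ℕ} (F : Matrix (Fin p) (Fin m) ℝ), (∀ j, j ∉ S → ∀ a, F j a = 0) →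
        Fᵀ * D = Fᵀ := by
      intro m F hF
      ext a j
      simp only [D, mul_diagonal, transpose_apply]
      by_cases hj : j ∈ S
      · simp [hj]
      · simp [hj, hF j hj a]
    have h1 := frobSq_pyth hV D
    have h2 := frobSq_contr hE (D - V * (Vᵀ * D))
    have h3 : Eᵀ * (D - V * (Vᵀ * D)) = Eᵀ := by
      rw [Matrix.mul_sub, ← Matrix.mul_assoc Eᵀ V, hVE, Matrix.zero_mul, sub_zero, hT E hE0]
    rw [h3, frobSq_transpose, frobSq_orth hE] at h2
    rw [hD] at h1
    have h4 : frobSq (Vᵀ * D) = r := by rw [hT V hS, frobSq_transpose, frobSq_orth hV]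
    have : (r : ℝ) + d ≤ S.card := by linarith
    exact_mod_cast this
  · intro c G hG hVG
    ext j k
    let x : EuclideanSpace ℝ (Fin p) := WithLp.toLp 2 (fun j => G j k)
    have hx : x ∈ LSub V S := by
      refine ⟨fun j hj => hG j hj k, fun l => ?_⟩
      have := congrFun (congrFun hVG l) k
      rw [Matrix.mul_apply] at this
      simpa [x] using this
    have h := b.sum_repr' ⟨x, hx⟩
    have h2 := congrArg (fun z : LSub V S => (z : EuclideanSpace ℝ (Fin p)) j) h
    simp only [Submodule.coe_sum, Submodule.coe_smul] at h2
    rw [Matrix.mul_apply]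
    have h3 : (∑ a, (inner ℝ (b a) (⟨x, hx⟩ : LSub V S)) • (b a : EuclideanSpace ℝ (Fin p))) j
        = ∑ a, E j a * (Eᵀ * G) a k := by
      rw [WithLp.ofLp_sum, Finset.sum_apply]
      refine Finset.sum_congr rfl fun a _ => ?_
      rw [Submodule.coe_inner, PiLp.inner_apply, Matrix.mul_apply, PiLp.smul_apply, smul_eq_mul,
        mul_comm]
      congr 1
      refine Finset.sum_congr rfl fun i _ => ?_
      simp only [E, x, transpose_apply, Matrix.of_apply, RCLike.inner_apply, conj_trivial]; ring
    rw [← h3]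
    exact h2

/-- extra support is controlled by the loss -/
lemma card_extra {p r : ℕ} {V W : Matrix (Fin p) (Fin r) ℝ}
    (hW : IsOrthonormalCols W) {A B : Finset (Fin p)}
    (hA : ∀ j, j ∉ A → ∀ k, V j k = 0) (hB : ∀ j, j ∉ B → ∀ k, W j k = 0) :
    (r : ℝ) - (A ∩ B).card ≤ frobSq (W - V * (Vᵀ * W)) := by
  classical
  have hrow : ∀ j, ∑ k, W j k ^ 2 ≤ 1 := by
    intro j
    have h := frobSq_contr hW (Matrix.of fun i (_ : Fin 1) => if i = j then (1:ℝ) else 0)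
    unfold frobSq at h
    simpa [Matrix.mul_apply] using h
  have hf : frobSq W = r := frobSq_orth hW
  have h1 : frobSq W = ∑ j ∈ A ∩ B, ∑ k, W j k ^ 2 + ∑ j ∈ (A ∩ B)ᶜ, ∑ k, W j k ^ 2 := by
    unfold frobSq; rw [Finset.sum_add_sum_compl]
  have h2 : ∑ j ∈ A ∩ B, ∑ k, W j k ^ 2 ≤ (A ∩ B).card := by
    refine (Finset.sum_le_sum fun j _ => hrow j).trans ?_
    simp
  have h3 : ∑ j ∈ (A ∩ B)ᶜ, ∑ k, W j k ^ 2 ≤ frobSq (W - V * (Vᵀ * W)) := by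
    unfold frobSq
    refine le_trans ?_ (Finset.sum_le_sum_of_subset_of_nonneg (Finset.subset_univ (A ∩ B)ᶜ)
      (fun j _ _ => Finset.sum_nonneg fun k _ => sq_nonneg _))
    refine Finset.sum_le_sum fun j hj => Finset.sum_le_sum fun k _ => ?_
    by_cases hjB : j ∈ B
    · have hjA : j ∉ A := fun h => by simp [h, hjB] at hj
      have : (V * (Vᵀ * W)) j k = 0 := by
        rw [Matrix.mul_apply]
        exact Finset.sum_eq_zero fun l _ => by rw [hA j hjA l, zero_mul]
      rw [Matrix.sub_apply, this, sub_zero]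
    · rw [hB j hjB k]; simp only [ne_eq, OfNat.ofNat_ne_zero, not_false_eq_true, zero_pow]
      exact sq_nonneg _
  linarith

lemma exists_net (d : ℕ) : ∃ N : Finset (EuclideanSpace ℝ (Fin d)), (∀ y ∈ N, ‖y‖ = 1) ∧
    N.card ≤ 5 ^ d ∧ ∀ x : EuclideanSpace ℝ (Fin d), ‖x‖ = 1 → ∃ y ∈ N, ‖x - y‖ ≤ 1 / 2 := by
  classical
  let P : Finset (EuclideanSpace ℝ (Fin d)) → Prop := fun N => (∀ y ∈ N, ‖y‖ = 1) ∧
    ∀ y ∈ N, ∀ z ∈ N, y ≠ z → 1 / 2 ≤ ‖y - z‖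
  have hbd : ∀ N, P N → N.card ≤ 5 ^ d := by
    rintro N ⟨h1, h2⟩
    have hinj : Function.Injective (fun y : EuclideanSpace ℝ (Fin d) => (2 : ℝ) • y) :=
      smul_right_injective _ two_ne_zero
    have h := Besicovitch.card_le_of_separated (N.image fun y => (2 : ℝ) • y) ?_ ?_
    · rw [Finset.card_image_of_injective _ hinj] at h
      simpa using h
    · intro c hc
      obtain ⟨y, hy, rfl⟩ := Finset.mem_image.1 hc
      rw [norm_smul, h1 y hy]; simp
    · intro c hc c' hc' hne
      obtain ⟨y, hy, rfl⟩ := Finset.mem_image.1 hc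
      obtain ⟨z, hz, rfl⟩ := Finset.mem_image.1 hc'
      have := h2 y hy z hz (fun h => hne (by rw [h]))
      rw [← smul_sub, norm_smul]
      simp only [Real.norm_ofNat]
      linarith
  let K : Set ℕ := {k | ∃ N, P N ∧ N.card = k}
  have hK : sSup K ∈ K := by
    refine Nat.sSup_mem ⟨0, ∅, ⟨by simp, by simp⟩, by simp⟩ ⟨5 ^ d, ?_⟩
    rintro k ⟨N, hN, rfl⟩
    exact hbd N hN
  obtain ⟨N, hN, hcard⟩ := hK
  refine ⟨N, hN.1, hbd N hN, fun x hx => ?_⟩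
  by_contra hcon
  push Not at hcon
  have hxN : x ∉ N := by
    intro h
    have := hcon x h
    simp at this
    linarith
  have hP : P (insert x N) := by
    constructor
    · intro y hy
      rcases Finset.mem_insert.1 hy with rfl | hy
      · exact hx
      · exact hN.1 y hy
    · intro y hy z hz hne
      rcases Finset.mem_insert.1 hy with rfl | hy1 <;> rcases Finset.mem_insert.1 hz with rfl | hz1
      · exact absurd rfl hne
      · exact (hcon z hz1).le
      · rw [norm_sub_rev]; exact (hcon y hy1).le
      · exact hN.2 y hy1 z hz1 hne
  have h1 : (insert x N).card ≤ sSup K := by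
    refine le_csSup ⟨5 ^ d, ?_⟩ ⟨_, hP, rfl⟩
    rintro k ⟨N, hN, rfl⟩
    exact hbd N hN
  rw [Finset.card_insert_of_notMem hxN, ← hcard] at h1
  omega

lemma net_quad {d : ℕ} {N : Finset (EuclideanSpace ℝ (Fin d))}
    (hnet : ∀ x : EuclideanSpace ℝ (Fin d), ‖x‖ = 1 → ∃ y ∈ N, ‖x - y‖ ≤ 1 / 2)
    (hN1 : ∀ y ∈ N, ‖y‖ = 1)
    (q : EuclideanSpace ℝ (Fin d) → ℝ) (hq : Continuous q)
    (hom : ∀ (t : ℝ) x, q (t • x) = t ^ 2 * q x)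
    (hpol : ∀ x y, q ((2 : ℝ) • (x - y) + (1 / 2 : ℝ) • (x + y))
      - q ((2 : ℝ) • (x - y) - (1 / 2 : ℝ) • (x + y)) = 4 * (q x - q y))
    {δ : ℝ} (hN : ∀ y ∈ N, |q y| ≤ δ) (x : EuclideanSpace ℝ (Fin d)) :
    |q x| ≤ 32 * δ * ‖x‖ ^ 2 := by
  by_cases hx : x = 0
  · subst hx
    have := hom 0 0
    simp only [smul_zero] at this
    have h0 : q 0 = 0 := by linarith
    simp [h0]
  set S := Metric.sphere (0 : EuclideanSpace ℝ (Fin d)) 1 with hS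
  have hxn : 0 < ‖x‖ := norm_pos_iff.2 hx
  have hne : S.Nonempty := ⟨‖x‖⁻¹ • x, by
    rw [mem_sphere_zero_iff_norm, norm_smul, norm_inv, norm_norm, inv_mul_cancel₀ hxn.ne']⟩
  obtain ⟨x₀, hx₀, hmax⟩ := (isCompact_sphere (0 : EuclideanSpace ℝ (Fin d)) 1).exists_isMaxOn hne
    (hq.abs.continuousOn)
  set M := |q x₀| with hM
  have hM0 : 0 ≤ M := abs_nonneg _
  have hgen : ∀ z, |q z| ≤ M * ‖z‖ ^ 2 := by
    intro z
    by_cases hz : z = 0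
    · subst hz
      have := hom 0 0
      simp only [smul_zero] at this
      have h0 : q 0 = 0 := by linarith
      simp [h0]
    · have hzn : 0 < ‖z‖ := norm_pos_iff.2 hz
      have h1 : ‖z‖⁻¹ • z ∈ S := by
        rw [mem_sphere_zero_iff_norm, norm_smul, norm_inv, norm_norm, inv_mul_cancel₀ hzn.ne']
      have h2 : |q (‖z‖⁻¹ • z)| ≤ M := hmax h1
      rw [hom, abs_mul, abs_of_nonneg (by positivity)] at h2
      have h3 := mul_le_mul_of_nonneg_right h2 (sq_nonneg ‖z‖)
      have h4 : ‖z‖⁻¹ ^ 2 * |q z| * ‖z‖ ^ 2 = |q z| := by field_simp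
      linarith
  have hx1 : ‖x₀‖ = 1 := mem_sphere_zero_iff_norm.1 hx₀
  obtain ⟨y, hy, hxy⟩ := hnet x₀ hx1
  have hkey : |q x₀ - q y| ≤ 31 / 32 * M := by
    have e := hpol x₀ y
    have h1 := hgen ((2 : ℝ) • (x₀ - y) + (1 / 2 : ℝ) • (x₀ + y))
    have h2 := hgen ((2 : ℝ) • (x₀ - y) - (1 / 2 : ℝ) • (x₀ + y))
    have hp := parallelogram_law_with_norm ℝ ((2 : ℝ) • (x₀ - y)) ((1 / 2 : ℝ) • (x₀ + y))
    have hp2 := parallelogram_law_with_norm ℝ x₀ y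
    rw [norm_smul, norm_smul] at hp
    simp only [Real.norm_ofNat, norm_div, norm_one] at hp
    rw [hx1, hN1 y hy] at hp2
    have hw : ‖x₀ - y‖ ^ 2 ≤ 1 / 4 := by
      have := pow_le_pow_left₀ (norm_nonneg _) hxy 2
      linarith
    have h3 : |4 * (q x₀ - q y)| ≤ M * (31 / 8) := by
      rw [← e]
      refine (abs_sub _ _).trans ?_
      have : ‖(2 : ℝ) • (x₀ - y) + (1 / 2 : ℝ) • (x₀ + y)‖ ^ 2
          + ‖(2 : ℝ) • (x₀ - y) - (1 / 2 : ℝ) • (x₀ + y)‖ ^ 2 ≤ 31 / 8 := by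
        nlinarith
      have := mul_le_mul_of_nonneg_left this hM0
      linarith
    rw [abs_mul] at h3
    norm_num at h3
    linarith
  have h5 : M ≤ 32 * δ := by
    have h6 := hN y hy
    have h7 : |q x₀| ≤ |q x₀ - q y| + |q y| := by
      have := abs_add_le (q x₀ - q y) (q y)
      simpa using this
    linarith
  exact (hgen x).trans (mul_le_mul_of_nonneg_right h5 (sq_nonneg _))

lemma net_mat {n d : ℕ} {N : Finset (EuclideanSpace ℝ (Fin d))}
    (hnet : ∀ x : EuclideanSpace ℝ (Fin d), ‖x‖ = 1 → ∃ y ∈ N, ‖x - y‖ ≤ 1 / 2)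
    (hN1 : ∀ y ∈ N, ‖y‖ = 1) (M : Matrix (Fin n) (Fin d) ℝ) (c : ℝ) {δ : ℝ}
    (hN : ∀ y ∈ N, |(M *ᵥ y.ofLp) ⬝ᵥ (M *ᵥ y.ofLp) - c| ≤ δ) (x : Fin d → ℝ) :
    |(M *ᵥ x) ⬝ᵥ (M *ᵥ x) - c * (x ⬝ᵥ x)| ≤ 32 * δ * (x ⬝ᵥ x) := by
  have hdot : ∀ y : EuclideanSpace ℝ (Fin d), y.ofLp ⬝ᵥ y.ofLp = ‖y‖ ^ 2 := by
    intro y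
    rw [EuclideanSpace.real_norm_sq_eq]
    simp only [dotProduct]
    exact Finset.sum_congr rfl fun i _ => by ring
  have h := net_quad hnet hN1
    (fun y => (M *ᵥ y.ofLp) ⬝ᵥ (M *ᵥ y.ofLp) - c * (y.ofLp ⬝ᵥ y.ofLp)) ?_ ?_ ?_
    (δ := δ) ?_ (WithLp.toLp 2 x)
  · have h2 := hdot (WithLp.toLp 2 x)
    simp only at h2
    rw [h2] at h ⊢
    exact h
  · simp only [dotProduct, mulVec]
    fun_prop
  · intro t y
    simp only [WithLp.ofLp_smul, mulVec_smul, smul_dotProduct, dotProduct_smul, smul_eq_mul]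
    ring
  · intro y z
    simp only [WithLp.ofLp_smul, WithLp.ofLp_add, WithLp.ofLp_sub, mulVec_smul, mulVec_add,
      mulVec_sub, smul_dotProduct, dotProduct_smul, add_dotProduct, dotProduct_add,
      sub_dotProduct, dotProduct_sub, smul_eq_mul]
    rw [dotProduct_comm (M *ᵥ z.ofLp) (M *ᵥ y.ofLp), dotProduct_comm z.ofLp y.ofLp]
    ring
  · intro y hy
    have h3 := hN y hy
    have h2 := hdot y
    rw [hN1 y hy] at h2
    simp only [h2]
    simpa using h3

lemma sqrt_inv_le {τ : ℝ} (hτ : |τ| ≤ 1 / 8) : √((1 - 2 * τ)⁻¹) ≤ exp (τ + 2 * τ ^ 2) := by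
  have hb := abs_le.1 hτ
  have h := Real.abs_log_sub_add_sum_range_le (x := 2 * τ) (by
    rw [abs_mul]; norm_num; linarith) 2
  have hx : |2 * τ| ≤ 1 / 4 := by rw [abs_mul]; norm_num; linarith
  set x := 2 * τ with hxd
  have h1 : |x| ^ (2 + 1) / (1 - |x|) ≤ x ^ 2 / 3 := by
    rw [div_le_div_iff₀ (by linarith) (by norm_num)]
    have e : |x| ^ (2 + 1) = x ^ 2 * |x| := by rw [pow_succ, sq_abs]
    rw [e]
    have := sq_nonneg x
    nlinarith
  have h2 := (abs_le.1 (h.trans h1)).1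
  simp [Finset.sum_range_succ] at h2
  rw [Real.sqrt_le_left (exp_pos _).le, ← Real.exp_nat_mul]
  have h3 : (1 - x)⁻¹ = exp (-log (1 - x)) := by
    rw [Real.exp_neg, Real.exp_log (by linarith [(abs_le.1 hx).2])]
  rw [h3]
  refine Real.exp_le_exp.2 ?_
  have : τ = x / 2 := by rw [hxd]; ring
  rw [this]; push_cast
  nlinarith [sq_nonneg x]

lemma chi_mgf {n : ℕ} {τ : ℝ} (hτ : |τ| ≤ 1 / 8) :
    ∫⁻ w, ENNReal.ofReal (exp (τ * ∑ i, w i ^ 2)) ∂(stdGaussian (Fin n))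
      ≤ ENNReal.ofReal (exp (n * (τ + 2 * τ ^ 2))) := by
  have h := gauss_master_vec (ι := Fin n) (fun _ => 0) τ (by linarith [(abs_le.1 hτ).2])
  simp only [zero_mul, zero_add, ← Finset.mul_sum] at h
  rw [h]
  refine ENNReal.ofReal_le_ofReal ?_
  simp only [ne_eq, OfNat.ofNat_ne_zero, not_false_eq_true, zero_pow, Finset.sum_const_zero,
    zero_div, exp_zero, mul_one, Fintype.card_fin]
  rw [Real.exp_nat_mul]
  exact pow_le_pow_left₀ (Real.sqrt_nonneg _) (sqrt_inv_le hτ) n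

lemma chi_half {n : ℕ} {τ a : ℝ} (hτ : |τ| ≤ 1 / 8) :
    stdGaussian (Fin n) {w | a ≤ τ * (∑ i, w i ^ 2 - n)}
      ≤ ENNReal.ofReal (exp (n * (2 * τ ^ 2) - a)) := by
  have hm : Measurable fun w : Fin n → ℝ => ENNReal.ofReal (exp (τ * ∑ i, w i ^ 2)) := by fun_prop
  have h := mul_meas_ge_le_lintegral (μ := stdGaussian (Fin n)) hm
    (ENNReal.ofReal (exp (a + τ * n)))
  have hs : {w : Fin n → ℝ | a ≤ τ * (∑ i, w i ^ 2 - n)} ⊆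
      {w | ENNReal.ofReal (exp (a + τ * n)) ≤ ENNReal.ofReal (exp (τ * ∑ i, w i ^ 2))} := by
    intro w hw
    have hw' : a ≤ τ * (∑ i, w i ^ 2 - n) := hw
    refine ENNReal.ofReal_le_ofReal (Real.exp_le_exp.2 ?_)
    linarith
  refine (measure_mono hs).trans ?_
  have h2 := h.trans (chi_mgf hτ)
  have h3 : ENNReal.ofReal (exp (n * (τ + 2 * τ ^ 2)))
      = ENNReal.ofReal (exp (a + τ * n)) * ENNReal.ofReal (exp (n * (2 * τ ^ 2) - a)) := by
    rw [← ENNReal.ofReal_mul (exp_pos _).le, ← Real.exp_add]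
    congr 2; ring
  rw [h3] at h2
  exact (ENNReal.mul_le_mul_iff_right (by simp [exp_pos]) ENNReal.ofReal_ne_top).1 h2

lemma chi_tail {n m : ℕ} (y : Fin m → ℝ) (hy : y ⬝ᵥ y = 1) {δ : ℝ} (h0 : 0 < δ) (h1 : δ ≤ 1 / 2) :
    gaussianMatrix n m {z | ¬ |(Matrix.of z *ᵥ y) ⬝ᵥ (Matrix.of z *ᵥ y) - n| ≤ n * δ}
      ≤ ENNReal.ofReal (2 * exp (-(n * δ ^ 2 / 8))) := by
  have hmap := map_unit_vec (n := n) y hy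
  have hms : MeasurableSet {w : Fin n → ℝ | ¬ |∑ i, w i ^ 2 - (n : ℝ)| ≤ n * δ} := by
    have hmf : Measurable fun w : Fin n → ℝ => |∑ i, w i ^ 2 - (n : ℝ)| := by fun_prop
    exact (measurableSet_le hmf measurable_const).compl
  have hmm : Measurable (fun (z : Fin n → Fin m → ℝ) i => z i ⬝ᵥ y) := by
    simp only [dotProduct]; fun_prop
  have e : gaussianMatrix n m {z | ¬ |(Matrix.of z *ᵥ y) ⬝ᵥ (Matrix.of z *ᵥ y) - n| ≤ n * δ}
      = stdGaussian (Fin n) {w | ¬ |∑ i, w i ^ 2 - (n : ℝ)| ≤ n * δ} := by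
    rw [← hmap, Measure.map_apply hmm hms]
    congr 1
    ext z
    simp only [Set.mem_ofPred_eq, Set.mem_preimage, not_le, mulVec, Matrix.of_apply,
      dotProduct, ← sq]
  rw [e]
  have hsub : {w : Fin n → ℝ | ¬ |∑ i, w i ^ 2 - (n : ℝ)| ≤ n * δ} ⊆
      {w | n * (δ ^ 2 / 4) ≤ (δ / 4) * (∑ i, w i ^ 2 - n)} ∪
      {w | n * (δ ^ 2 / 4) ≤ (-(δ / 4)) * (∑ i, w i ^ 2 - n)} := by
    intro w hw
    have hw' : n * δ < |∑ i, w i ^ 2 - (n : ℝ)| := not_le.1 hw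
    rcases lt_abs.1 hw' with h | h
    · left
      simp only [Set.mem_ofPred_eq]
      nlinarith
    · right
      simp only [Set.mem_ofPred_eq]
      nlinarith
  refine (measure_mono hsub).trans ((measure_union_le _ _).trans ?_)
  have a1 := chi_half (n := n) (τ := δ / 4) (a := n * (δ ^ 2 / 4)) (by
    rw [abs_of_pos (by positivity)]; linarith)
  have a2 := chi_half (n := n) (τ := -(δ / 4)) (a := n * (δ ^ 2 / 4)) (by
    rw [abs_neg, abs_of_pos (by positivity)]; linarith)
  refine (add_le_add a1 a2).trans ?_
  rw [← ENNReal.ofReal_add (exp_pos _).le (exp_pos _).le]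
  refine ENNReal.ofReal_le_ofReal (le_of_eq ?_)
  rw [show n * (2 * (δ / 4) ^ 2) - n * (δ ^ 2 / 4) = -(n * δ ^ 2 / 8) by ring,
    show n * (2 * (-(δ / 4)) ^ 2) - n * (δ ^ 2 / 4) = -(n * δ ^ 2 / 8) by ring]
  ring

lemma good_event (n : ℕ) {m d : ℕ} {E : Matrix (Fin m) (Fin d) ℝ} (hE : IsOrthonormalCols E)
    {δ : ℝ} (h0 : 0 < δ) (h1 : δ ≤ 1) :
    ∃ Ω : Set (Fin n → Fin m → ℝ), MeasurableSet Ω ∧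
      (∀ z ∈ Ω, ∀ x : Fin d → ℝ, |((Matrix.of z * E) *ᵥ x) ⬝ᵥ ((Matrix.of z * E) *ᵥ x)
        - n * (x ⬝ᵥ x)| ≤ n * δ * (x ⬝ᵥ x)) ∧
      gaussianMatrix n m Ωᶜ ≤ ENNReal.ofReal (5 ^ d * (2 * exp (-(n * δ ^ 2 / 8192)))) := by
  obtain ⟨N, hN1, hcard, hnet⟩ := exists_net d
  let Bad : EuclideanSpace ℝ (Fin d) → Set (Fin n → Fin m → ℝ) := fun y =>
    {z | ¬ |(Matrix.of z *ᵥ (E *ᵥ y.ofLp)) ⬝ᵥ (Matrix.of z *ᵥ (E *ᵥ y.ofLp)) - n| ≤ n * (δ / 32)}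
  have hBm : ∀ y, MeasurableSet (Bad y) := by
    intro y
    have hmf : Measurable fun z : Fin n → Fin m → ℝ =>
        |(Matrix.of z *ᵥ (E *ᵥ y.ofLp)) ⬝ᵥ (Matrix.of z *ᵥ (E *ᵥ y.ofLp)) - (n : ℝ)| := by
      simp only [dotProduct, mulVec, Matrix.of_apply]
      fun_prop
    exact (measurableSet_le hmf measurable_const).compl
  refine ⟨(⋃ y ∈ N, Bad y)ᶜ, ?_, ?_, ?_⟩
  · exact (Finset.measurableSet_biUnion N fun y _ => hBm y).compl
  · intro z hz x
    have h := net_mat hnet hN1 (Matrix.of z * E) (n : ℝ) (δ := n * (δ / 32)) ?_ x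
    · refine h.trans (le_of_eq ?_); ring
    · intro y hy
      by_contra hcon
      refine hz (Set.mem_iUnion₂.2 ⟨y, hy, ?_⟩)
      simp only [Bad, Set.mem_ofPred_eq]
      rwa [mulVec_mulVec]
  · rw [compl_compl]
    refine (measure_biUnion_finset_le N Bad).trans ?_
    have hb : ∀ y ∈ N, gaussianMatrix n m (Bad y)
        ≤ ENNReal.ofReal (2 * exp (-(n * δ ^ 2 / 8192))) := by
      intro y hy
      have hu : (E *ᵥ y.ofLp) ⬝ᵥ (E *ᵥ y.ofLp) = 1 := by
        rw [dot_mulVec_mulVec hE]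
        have := hN1 y hy
        have h2 := EuclideanSpace.real_norm_sq_eq y
        rw [this] at h2
        simp only [dotProduct, ← sq]
        linarith
      refine (chi_tail (n := n) _ hu (δ := δ / 32) (by positivity) (by linarith)).trans ?_
      refine ENNReal.ofReal_le_ofReal (le_of_eq ?_)
      congr 3; ring
    refine (Finset.sum_le_sum hb).trans ?_
    rw [Finset.sum_const, nsmul_eq_mul, ENNReal.ofReal_mul (show (0:ℝ) ≤ 5 ^ d by positivity)]
    have hc5 : (N.card : ℝ≥0∞) ≤ ENNReal.ofReal (5 ^ d) := by
      rw [← ENNReal.ofReal_natCast]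
      refine ENNReal.ofReal_le_ofReal ?_
      exact_mod_cast hcard
    exact mul_le_mul' hc5 le_rfl

lemma noise_mgf {n p r d : ℕ} {E : Matrix (Fin p) (Fin d) ℝ} (hE : IsOrthonormalCols E)
    (Y : Matrix (Fin n) (Fin r) ℝ) {t M : ℝ} (ht : 0 ≤ t) (htM : t * M ≤ 1 / 4)
    (hY : ∀ h : Fin r → ℝ, (Y *ᵥ h) ⬝ᵥ (Y *ᵥ h) ≤ M * (h ⬝ᵥ h)) :
    ∫⁻ z, ENNReal.ofReal (exp (t * frobSq (Eᵀ * (Matrix.of z)ᵀ * Y))) ∂(gaussianMatrix n p)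
      ≤ ENNReal.ofReal (exp (r * d / 2)) := by
  have e1 : ∀ z : Fin n → Fin p → ℝ, ENNReal.ofReal (exp (t * frobSq (Eᵀ * (Matrix.of z)ᵀ * Y)))
      = ∫⁻ ξ, ENNReal.ofReal (exp (∑ i, ∑ j,
          (√(2 * t) * (Y * (Matrix.of ξ)ᵀ * Eᵀ) i j * z i j + 0 * z i j ^ 2)))
          ∂(gaussianMatrix d r) := by
    intro z
    have h := lin_mat (n := d) (m := r) (Eᵀ * (Matrix.of z)ᵀ * Y) t ht
    unfold frobSq
    rw [h]
    refine lintegral_congr fun ξ => ?_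
    congr 2
    simp only [zero_mul, add_zero]
    have : ∑ i, ∑ j, (Eᵀ * (Matrix.of z)ᵀ * Y) i j * ξ i j
        = ∑ i, ∑ j, (Y * (Matrix.of ξ)ᵀ * Eᵀ) i j * z i j := by
      have a1 : ∑ i, ∑ j, (Eᵀ * (Matrix.of z)ᵀ * Y) i j * ξ i j
          = trace ((Eᵀ * (Matrix.of z)ᵀ * Y) * (Matrix.of ξ)ᵀ) := by
        simp only [trace, diag_apply]
        refine Finset.sum_congr rfl fun i _ => ?_
        rw [Matrix.mul_apply]; rfl
      have a2 : ∑ i, ∑ j, (Y * (Matrix.of ξ)ᵀ * Eᵀ) i j * z i j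
          = trace ((Y * (Matrix.of ξ)ᵀ * Eᵀ) * (Matrix.of z)ᵀ) := by
        simp only [trace, diag_apply]
        refine Finset.sum_congr rfl fun i _ => ?_
        rw [Matrix.mul_apply]; rfl
      rw [a1, a2, Matrix.mul_assoc (Eᵀ * (Matrix.of z)ᵀ), trace_mul_comm (Eᵀ * (Matrix.of z)ᵀ),
        Matrix.mul_assoc _ Eᵀ]
    rw [this, Finset.mul_sum]
    refine Finset.sum_congr rfl fun i _ => ?_
    rw [Finset.mul_sum]
    exact Finset.sum_congr rfl fun j _ => by ring
  simp_rw [e1]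
  rw [lintegral_lintegral_swap]
  swap
  · refine Measurable.aemeasurable ?_
    simp only [Function.uncurry_def, Matrix.mul_apply, transpose_apply, Matrix.of_apply]
    fun_prop
  have e2 : ∀ ξ : Fin d → Fin r → ℝ, ∫⁻ z, ENNReal.ofReal (exp (∑ i, ∑ j,
          (√(2 * t) * (Y * (Matrix.of ξ)ᵀ * Eᵀ) i j * z i j + 0 * z i j ^ 2)))
          ∂(gaussianMatrix n p) ≤ ENNReal.ofReal (exp (∑ i, ∑ j,
            (0 * ξ i j + (1 / 4) * ξ i j ^ 2))) := by
    intro ξ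
    rw [gauss_master_mat (fun i j => √(2 * t) * (Y * (Matrix.of ξ)ᵀ * Eᵀ) i j) 0 (by norm_num)]
    refine ENNReal.ofReal_le_ofReal ?_
    have b1 : ∑ i, ∑ j, (√(2 * t) * (Y * (Matrix.of ξ)ᵀ * Eᵀ) i j) ^ 2
        = 2 * t * frobSq (Y * (Matrix.of ξ)ᵀ) := by
      have : frobSq (Y * (Matrix.of ξ)ᵀ) = frobSq (Y * (Matrix.of ξ)ᵀ * Eᵀ) := by
        rw [← frobSq_transpose, ← frobSq_isom hE, ← frobSq_transpose]
        simp only [transpose_mul, transpose_transpose]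
      rw [this]
      unfold frobSq
      simp only [Finset.mul_sum, mul_pow, Real.sq_sqrt (show 0 ≤ 2 * t by positivity)]
    have b2 : frobSq (Y * (Matrix.of ξ)ᵀ) ≤ M * ∑ i, ∑ j, ξ i j ^ 2 := by
      rw [← frobSq_transpose]
      unfold frobSq
      rw [Finset.mul_sum]
      refine Finset.sum_le_sum fun a _ => ?_
      have h := hY (ξ a)
      have c1 : (Y *ᵥ ξ a) ⬝ᵥ (Y *ᵥ ξ a) = ∑ j, (Y * (Matrix.of ξ)ᵀ)ᵀ a j ^ 2 := by
        simp only [dotProduct, ← sq]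
        rfl
      have c2 : ξ a ⬝ᵥ ξ a = ∑ j, ξ a j ^ 2 := by simp only [dotProduct, ← sq]
      rwa [c1, c2] at h
    rw [b1]
    simp only [mul_zero, sub_zero, inv_one, Real.sqrt_one, one_pow, one_mul, zero_mul, zero_add,
      mul_one]
    refine Real.exp_le_exp.2 ?_
    have hnn : 0 ≤ ∑ i, ∑ j, ξ i j ^ 2 :=
      Finset.sum_nonneg fun _ _ => Finset.sum_nonneg fun _ _ => sq_nonneg _
    have b3 := mul_le_mul_of_nonneg_left b2 ht
    have b4 := mul_le_mul_of_nonneg_right htM hnn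
    simp only [← Finset.mul_sum]
    linarith
  refine (lintegral_mono e2).trans ?_
  rw [gauss_master_mat (fun _ _ => 0) (1 / 4) (by norm_num)]
  refine ENNReal.ofReal_le_ofReal ?_
  have hs : √((1 - 2 * (1 / 4 : ℝ))⁻¹) ≤ exp (1 / 2) := by
    rw [Real.sqrt_le_left (exp_pos _).le, ← Real.exp_nat_mul]
    norm_num
    have := Real.add_one_le_exp 1
    linarith
  have hp := pow_le_pow_left₀ (Real.sqrt_nonneg _) hs (d * r)
  rw [← Real.exp_nat_mul] at hp
  simp only [ne_eq, OfNat.ofNat_ne_zero, not_false_eq_true, zero_pow, Finset.sum_const_zero,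
    zero_div, exp_zero, mul_one]
  refine hp.trans (le_of_eq ?_)
  congr 1; push_cast; ring

/-- the signal matrix -/
def Ymat {n r : ℕ} (d : Fin r → ℝ) (U : Fin n → Fin r → ℝ) : Matrix (Fin n) (Fin r) ℝ :=
  Matrix.of fun i k => d k * U i k

lemma Trep_mat {n p r : ℕ} (d : Fin r → ℝ) (V : Matrix (Fin p) (Fin r) ℝ)
    (w : (Fin n → Fin r → ℝ) × (Fin n → Fin p → ℝ)) :
    Matrix.of (Trep d V w) = Ymat d w.1 * Vᵀ + (Matrix.of w.2 - Matrix.of w.2 * V * Vᵀ) := by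
  ext i j
  simp only [Trep, rs, Matrix.of_apply, Matrix.add_apply, Matrix.sub_apply, Pi.add_apply,
    Pi.sub_apply, Matrix.mul_apply, mulVec, vecMul, dotProduct, transpose_apply, Ymat,
    Pi.mul_apply]
  congr 1
  · exact Finset.sum_congr rfl fun k _ => by ring
  · congr 1
    exact Finset.sum_congr rfl fun k _ => by ring

lemma Trep_mul {n p r : ℕ} (d : Fin r → ℝ) (V : Matrix (Fin p) (Fin r) ℝ)
    (w : (Fin n → Fin r → ℝ) × (Fin n → Fin p → ℝ)) (W : Matrix (Fin p) (Fin r) ℝ) :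
    Matrix.of (Trep d V w) * W
      = Ymat d w.1 * (Vᵀ * W) + Matrix.of w.2 * (W - V * (Vᵀ * W)) := by
  rw [Trep_mat, Matrix.add_mul, Matrix.sub_mul, Matrix.mul_sub]
  simp only [Matrix.mul_assoc]

lemma Trep_mul_self {n p r : ℕ} (d : Fin r → ℝ) {V : Matrix (Fin p) (Fin r) ℝ}
    (hV : IsOrthonormalCols V)
    (w : (Fin n → Fin r → ℝ) × (Fin n → Fin p → ℝ)) :
    Matrix.of (Trep d V w) * V = Ymat d w.1 := by
  have hV' : Vᵀ * V = 1 := hV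
  rw [Trep_mul, hV', Matrix.mul_one, Matrix.mul_one, sub_self, Matrix.mul_zero, add_zero]

lemma Ymat_mulVec {n r : ℕ} (d : Fin r → ℝ) (U : Fin n → Fin r → ℝ) (h : Fin r → ℝ) :
    Ymat d U *ᵥ h = Matrix.of U *ᵥ (fun k => d k * h k) := by
  ext i
  simp only [Ymat, mulVec, dotProduct, Matrix.of_apply]
  exact Finset.sum_congr rfl fun k _ => by ring

lemma frobSq_mul_ge {n p d k : ℕ} (Z : Matrix (Fin n) (Fin p) ℝ) (E : Matrix (Fin p) (Fin d) ℝ)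
    (hE : IsOrthonormalCols E) (G : Matrix (Fin p) (Fin k) ℝ) (hG : E * (Eᵀ * G) = G) {b : ℝ}
    (hZ : ∀ x : Fin d → ℝ, ((Z * E) *ᵥ x) ⬝ᵥ ((Z * E) *ᵥ x) ≤ b * (x ⬝ᵥ x)) :
    frobSq (Z * G) ≤ b * frobSq G := by
  have h1 : frobSq G = frobSq (Eᵀ * G) := by
    conv_lhs => rw [← hG]
    exact frobSq_isom hE _
  have h2 : Z * G = (Z * E) * (Eᵀ * G) := by
    conv_lhs => rw [← hG]
    simp only [Matrix.mul_assoc]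
  rw [h1, h2]
  generalize Eᵀ * G = F
  rw [← frobSq_transpose, ← frobSq_transpose F]
  unfold frobSq
  rw [Finset.mul_sum]
  refine Finset.sum_le_sum fun a _ => ?_
  have h := hZ (fun c => F c a)
  have c1 : ((Z * E) *ᵥ fun c => F c a) ⬝ᵥ ((Z * E) *ᵥ fun c => F c a)
      = ∑ j, ((Z * E) * F)ᵀ a j ^ 2 := by
    simp only [dotProduct, ← sq]
    rfl
  have c2 : (fun c => F c a) ⬝ᵥ (fun c => F c a) = ∑ j, Fᵀ a j ^ 2 := by
    simp only [dotProduct, ← sq]; rfl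
  rwa [c1, c2] at h

lemma Ymat_bounds {n r : ℕ} {Λ : Fin r → ℝ} {lam κ δ : ℝ} (hl : 0 < lam)
    (hΛ : ∀ k, lam ≤ Λ k ∧ Λ k ≤ κ * lam) (hδ0 : 0 < δ) (hδ1 : δ ≤ 1)
    {U : Fin n → Fin r → ℝ}
    (hU : ∀ x : Fin r → ℝ, |(Matrix.of U *ᵥ x) ⬝ᵥ (Matrix.of U *ᵥ x)
        - n * (x ⬝ᵥ x)| ≤ n * δ * (x ⬝ᵥ x)) (h : Fin r → ℝ) :
    n * (1 - δ) * (1 + lam) * (h ⬝ᵥ h)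
      ≤ (Ymat (fun k => √(1 + Λ k)) U *ᵥ h) ⬝ᵥ (Ymat (fun k => √(1 + Λ k)) U *ᵥ h) ∧
    (Ymat (fun k => √(1 + Λ k)) U *ᵥ h) ⬝ᵥ (Ymat (fun k => √(1 + Λ k)) U *ᵥ h)
      ≤ 2 * (κ * lam + 1) * n * (h ⬝ᵥ h) := by
  set x : Fin r → ℝ := fun k => √(1 + Λ k) * h k with hx
  have e := Ymat_mulVec (fun k => √(1 + Λ k)) U h
  rw [e]
  have hu := abs_le.1 (hU x)
  have exx : x ⬝ᵥ x = ∑ k, (1 + Λ k) * h k ^ 2 := by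
    simp only [dotProduct, hx]
    refine Finset.sum_congr rfl fun k _ => ?_
    have := Real.sq_sqrt (show 0 ≤ 1 + Λ k by linarith [(hΛ k).1])
    calc √(1 + Λ k) * h k * (√(1 + Λ k) * h k) = √(1 + Λ k) ^ 2 * h k ^ 2 := by ring
      _ = _ := by rw [this]
  have ehh : h ⬝ᵥ h = ∑ k, h k ^ 2 := by simp only [dotProduct, ← sq]
  have l1 : (1 + lam) * (h ⬝ᵥ h) ≤ x ⬝ᵥ x := by
    rw [exx, ehh, Finset.mul_sum]
    exact Finset.sum_le_sum fun k _ =>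
      mul_le_mul_of_nonneg_right (by linarith [(hΛ k).1]) (sq_nonneg _)
  have l2 : x ⬝ᵥ x ≤ (κ * lam + 1) * (h ⬝ᵥ h) := by
    rw [exx, ehh, Finset.mul_sum]
    exact Finset.sum_le_sum fun k _ =>
      mul_le_mul_of_nonneg_right (by linarith [(hΛ k).2]) (sq_nonneg _)
  have hxx : 0 ≤ x ⬝ᵥ x := by
    rw [exx]
    exact Finset.sum_nonneg fun k _ => mul_nonneg (by linarith [(hΛ k).1]) (sq_nonneg _)
  have hn : (0 : ℝ) ≤ n := Nat.cast_nonneg n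
  have m1 := mul_le_mul_of_nonneg_left l1 (mul_nonneg hn (sub_nonneg.2 hδ1))
  have m2 := mul_le_mul_of_nonneg_left l2 (show 0 ≤ (n : ℝ) * 2 by positivity)
  have m3 := mul_le_mul_of_nonneg_right hδ1 (mul_nonneg hn hxx)
  constructor
  · linarith
  · linarith

set_option maxHeartbeats 1000000 in
lemma pointwise {n p r s : ℕ} (hn : 1 ≤ n) {Λ : Fin r → ℝ} {lam κ : ℝ} (hκ : 1 < κ) (hl : 0 < lam)
    (hΛ : ∀ k, lam ≤ Λ k ∧ Λ k ≤ κ * lam) {V : Matrix (Fin p) (Fin r) ℝ}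
    (hV : IsOrthonormalCols V) {A : Finset (Fin p)} (hAs : A.card = s)
    (hA : ∀ j, j ∉ A → ∀ k, V j k = 0) (D : Finset (Fin p) → ℕ)
    (E : ∀ B, Matrix (Fin p) (Fin (D B)) ℝ) (hE : ∀ B, IsOrthonormalCols (E B))
    (hD : ∀ B, r + D B ≤ (A ∪ B).card)
    (hEG : ∀ (B : Finset (Fin p)) (c : ℕ) (G : Matrix (Fin p) (Fin c) ℝ),
      (∀ j, j ∉ A ∪ B → ∀ k, G j k = 0) → Vᵀ * G = 0 → E B * ((E B)ᵀ * G) = G)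
    (hrs : r ≤ s) {δ ε a : ℝ} (ha : 0 ≤ a) (hδ0 : 0 < δ) (hδ1 : δ ≤ 1) (hδ : δ * (2 + lam) ≤ lam / 2)
    (hsmall : 128 * κ * (lam + 1) * r ≤ n * lam ^ 2)
    {w : (Fin n → Fin r → ℝ) × (Fin n → Fin p → ℝ)} {W : Fin p → Fin r → ℝ}
    (hW : W ∈ SpSet p r s)
    (hf : frobSq (Matrix.of (Trep (fun k => √(1 + Λ k)) V w) * V) - ε
      ≤ frobSq (Matrix.of (Trep (fun k => √(1 + Λ k)) V w) * Matrix.of W))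
    (hU : ∀ x : Fin r → ℝ, |(Matrix.of w.1 *ᵥ x) ⬝ᵥ (Matrix.of w.1 *ᵥ x)
        - n * (x ⬝ᵥ x)| ≤ n * δ * (x ⬝ᵥ x))
    (hZ : ∀ B : Finset (Fin p), B.card = s → ∀ x : Fin (D B) → ℝ,
      |((Matrix.of w.2 * E B) *ᵥ x) ⬝ᵥ ((Matrix.of w.2 * E B) *ᵥ x)
        - n * (x ⬝ᵥ x)| ≤ n * δ * (x ⬝ᵥ x)) :
    loss (Matrix.of W) V ≤ 512 * κ * (lam + 1) / (n * lam ^ 2) * (r * ((s : ℝ) - r) + a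
      + exp (-a) * ∑ B ∈ Finset.powersetCard s Finset.univ,
        exp (1 / (8 * (κ * lam + 1) * n) *
          frobSq ((E B)ᵀ * (Matrix.of w.2)ᵀ * Ymat (fun k => √(1 + Λ k)) w.1) - r * D B / 2))
      + 16 * ε / (n * lam) := by
  obtain ⟨hWo, B, hBs, hB⟩ := hW
  have hn0 : (0 : ℝ) < n := by exact_mod_cast hn
  have hr0 : (0 : ℝ) ≤ r := Nat.cast_nonneg r
  set Wm : Matrix (Fin p) (Fin r) ℝ := Matrix.of W with hWm
  set Y := Ymat (fun k => √(1 + Λ k)) w.1 with hYd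
  set G := Wm - V * (Vᵀ * Wm) with hG
  rw [Trep_mul_self _ hV, Trep_mul] at hf
  have hVo : Vᵀ * V = 1 := hV
  have hG0 : ∀ j, j ∉ A ∪ B → ∀ k, G j k = 0 := by
    intro j hj k
    rw [Finset.mem_union, not_or] at hj
    rw [hG, Matrix.sub_apply, Matrix.mul_apply]
    have h1 : Wm j k = 0 := hB j hj.2 k
    rw [h1, Finset.sum_eq_zero fun l _ => by rw [hA j hj.1 l, zero_mul], sub_zero]
  have hVG : Vᵀ * G = 0 := by
    rw [hG, Matrix.mul_sub, ← Matrix.mul_assoc Vᵀ V, hVo, Matrix.one_mul, sub_self]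
  have hEGB := hEG B r G hG0 hVG
  have hZG : frobSq (Matrix.of w.2 * G) ≤ n * (1 + δ) * frobSq G := by
    refine frobSq_mul_ge _ (E B) (hE B) G hEGB fun x => ?_
    have := (abs_le.1 (hZ B hBs x)).2
    linarith
  have hYb := fun h => (Ymat_bounds (κ := κ) hl hΛ hδ0 hδ1 hU h).1
  have hdet := det_bound hV hWo (hE B) Y (Matrix.of w.2) hEGB (a := n * (1 - δ) * (1 + lam))
    (b := n * (1 + δ)) (m := n * lam / 2) (ε := ε) (by positivity) (by
      have := mul_le_mul_of_nonneg_left hδ hn0.le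
      linarith) hYb hZG hf
  have hlossG : loss Wm V = 2 * frobSq G := by rw [loss_comm]; exact loss_eq_resid hV hWo
  set g := frobSq G with hg
  have hg0 : 0 ≤ g := frobSq_nonneg _
  set N := frobSq ((E B)ᵀ * (Matrix.of w.2)ᵀ * Y) with hN
  -- support count
  have hcard : (D B : ℝ) ≤ 2 * ((s : ℝ) - r) + g := by
    have h1 := card_extra (V := V) hWo hA (B := B) (fun j hj k => hB j hj k)
    have h2 : ((A ∪ B).card : ℝ) + (A ∩ B).card = 2 * s := by
      have := Finset.card_union_add_card_inter A B
      rw [hAs, hBs] at this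
      have h3 : (((A ∪ B).card + (A ∩ B).card : ℕ) : ℝ) = ((s + s : ℕ) : ℝ) := by rw [this]
      push_cast at h3; linarith
    have h3 : (r : ℝ) + D B ≤ (A ∪ B).card := by exact_mod_cast hD B
    have h4 : (r : ℝ) - (A ∩ B).card ≤ g := h1
    linarith
  set t := 1 / (8 * (κ * lam + 1) * n) with ht
  have hκl : 0 < κ * lam := by positivity
  have ht0 : 0 < t := by positivity
  set Ξ := ∑ B ∈ Finset.powersetCard s Finset.univ,
        exp (t * frobSq ((E B)ᵀ * (Matrix.of w.2)ᵀ * Y) - r * D B / 2) with hΞ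
  have hXi : exp (t * N - r * D B / 2) ≤ Ξ := by
    refine Finset.single_le_sum (f := fun B => exp (t * frobSq ((E B)ᵀ * (Matrix.of w.2)ᵀ * Y)
      - r * D B / 2)) (fun _ _ => (exp_pos _).le) ?_
    exact Finset.mem_powersetCard.2 ⟨Finset.subset_univ _, hBs⟩
  have htN : t * N ≤ r * D B / 2 + a + exp (-a) * Ξ := by
    have h1 := Real.add_one_le_exp (t * N - r * D B / 2 - a)
    have h2 : exp (t * N - r * D B / 2 - a) = exp (-a) * exp (t * N - r * D B / 2) := by
      rw [← Real.exp_add]; congr 1; ring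
    have h3 := mul_le_mul_of_nonneg_left hXi (exp_pos (-a)).le
    linarith
  have hrD : r * (D B : ℝ) / 2 ≤ r * ((s : ℝ) - r) + r * g / 2 := by
    have := mul_le_mul_of_nonneg_left hcard hr0
    linarith
  set Q := r * ((s : ℝ) - r) + a + exp (-a) * Ξ with hQ
  have hNQ : N ≤ 8 * (κ * lam + 1) * n * (Q + r * g / 2) := by
    have h1 : t * N ≤ Q + r * g / 2 := by linarith
    have h2 : N = 8 * (κ * lam + 1) * n * (t * N) := by
      rw [ht]; field_simp
    rw [h2]
    exact mul_le_mul_of_nonneg_left h1 (by positivity)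
  have hfin : g ≤ 128 * (κ * lam + 1) / (n * lam ^ 2) * (Q + r * g / 2) + 4 * ε / (n * lam) := by
    have h1 : 2 / (n * lam / 2) * N ≤ 2 / (n * lam / 2) *
        (8 * (κ * lam + 1) * n * (Q + r * g / 2)) := mul_le_mul_of_nonneg_left hNQ (by positivity)
    have h2 : n * lam / 2 * g / 2 ≤ 2 / (n * lam / 2) *
        (8 * (κ * lam + 1) * n * (Q + r * g / 2)) + ε := by linarith
    have h3 := mul_le_mul_of_nonneg_left h2 (show 0 ≤ 4 / (n * lam) by positivity)
    have h4 : 4 / (n * lam) * (n * lam / 2 * g / 2) = g := by field_simp; ring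
    have h5 : 4 / (n * lam) * (2 / (n * lam / 2) *
        (8 * (κ * lam + 1) * n * (Q + r * g / 2)) + ε)
        = 128 * (κ * lam + 1) / (n * lam ^ 2) * (Q + r * g / 2) + 4 * ε / (n * lam) := by
      field_simp; ring
    linarith
  have hκ1 : κ * lam + 1 ≤ κ * (lam + 1) := by linarith
  have hcoef : 128 * (κ * lam + 1) / (n * lam ^ 2) * r ≤ 1 := by
    rw [div_mul_eq_mul_div, div_le_one (by positivity)]
    have := mul_le_mul_of_nonneg_right hκ1 (show (0:ℝ) ≤ 128 * r by positivity)
    linarith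
  have h6 : 128 * (κ * lam + 1) / (n * lam ^ 2) * (r * g / 2) ≤ g / 2 := by
    have := mul_le_mul_of_nonneg_right hcoef hg0
    linarith
  have hsum : g ≤ 256 * (κ * lam + 1) / (n * lam ^ 2) * Q + 8 * ε / (n * lam) := by
    have e1 : 256 * (κ * lam + 1) / (n * lam ^ 2) * Q
      = 2 * (128 * (κ * lam + 1) / (n * lam ^ 2) * Q) := by ring
    have e2 : 8 * ε / (n * lam) = 2 * (4 * ε / (n * lam)) := by ring
    linarith
  have hΞ0 : 0 ≤ Ξ := Finset.sum_nonneg fun _ _ => (exp_pos _).le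
  have hrs' : (0:ℝ) ≤ (s : ℝ) - r := sub_nonneg.2 (by exact_mod_cast hrs)
  have hQ0 : 0 ≤ Q := by
    have := mul_nonneg hr0 hrs'
    have := mul_nonneg (exp_pos (-a)).le hΞ0
    linarith
  have h7 : 512 * (κ * lam + 1) / (n * lam ^ 2) * Q
      ≤ 512 * κ * (lam + 1) / (n * lam ^ 2) * Q := by
    refine mul_le_mul_of_nonneg_right ?_ hQ0
    refine div_le_div_of_nonneg_right ?_ (by positivity)
    linarith
  rw [hlossG]
  have e1 : 512 * (κ * lam + 1) / (n * lam ^ 2) * Q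
      = 2 * (256 * (κ * lam + 1) / (n * lam ^ 2) * Q) := by ring
  have e2 : 16 * ε / (n * lam) = 2 * (8 * ε / (n * lam)) := by ring
  linarith

lemma choose_le_exp {p s : ℕ} (hs : 1 ≤ s) (hsp : s ≤ p) :
    (p.choose s : ℝ) ≤ exp (s * Real.log (Real.exp 1 * p / s)) := by
  have hs0 : (0 : ℝ) < s := by exact_mod_cast hs
  have hp0 : (0 : ℝ) < p := by exact_mod_cast (hs.trans hsp)
  have h1 : (p.choose s : ℝ) ≤ (p : ℝ) ^ s / s.factorial := Nat.choose_le_pow_div s p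
  have h2 := Real.pow_div_factorial_le_exp (s : ℝ) hs0.le s
  have h3 : exp (s * Real.log (Real.exp 1 * p / s)) = (Real.exp 1 * p / s) ^ s := by
    rw [← Real.rpow_natCast, Real.rpow_def_of_pos (by positivity), mul_comm]
  have h4 : exp (s : ℝ) = (Real.exp 1) ^ s := by
    rw [← Real.exp_nat_mul, mul_one]
  rw [h3]
  refine h1.trans ?_
  have h5 : (Real.exp 1 * p / s) ^ s = (p / s : ℝ) ^ s * exp (s : ℝ) := by
    rw [h4, ← mul_pow]; congr 1; ring
  have h6 : (p : ℝ) ^ s / s.factorial = (p / s : ℝ) ^ s * ((s : ℝ) ^ s / s.factorial) := by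
    rw [div_pow]; field_simp
  rw [h5, h6]
  exact mul_le_mul_of_nonneg_left h2 (by positivity)

lemma lint_abs {α β : Type*} [MeasurableSpace α] [MeasurableSpace β] (μ : Measure α)
    (ν : Measure β) [IsProbabilityMeasure μ] [IsProbabilityMeasure ν]
    {g : α × β → ℝ≥0∞} {Ω1 : Set α} {Ω2 : Set β} (hΩ1 : MeasurableSet Ω1) (hΩ2 : MeasurableSet Ω2)
    {Ξ : α × β → ℝ≥0∞} (hΞm : Measurable Ξ) {q k m N : ℝ≥0∞}
    (h : ∀ a ∈ Ω1, ∀ b ∈ Ω2, g (a, b) ≤ q + k * Ξ (a, b)) (h2 : ∀ w, g w ≤ m)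
    (hΞ : ∀ a ∈ Ω1, ∫⁻ b, Ξ (a, b) ∂ν ≤ N) :
    ∫⁻ w, g w ∂(μ.prod ν) ≤ q + k * N + m * (μ Ω1ᶜ + ν Ω2ᶜ) := by
  have hS : MeasurableSet (Prod.fst ⁻¹' Ω1 : Set (α × β)) := measurable_fst hΩ1
  have hS1 : MeasurableSet (Prod.fst ⁻¹' Ω1ᶜ : Set (α × β)) := measurable_fst hΩ1.compl
  have hS2 : MeasurableSet (Prod.snd ⁻¹' Ω2ᶜ : Set (α × β)) := measurable_snd hΩ2.compl
  have hm1 : Measurable ((Prod.fst ⁻¹' Ω1 : Set (α × β)).indicator Ξ) := hΞm.indicator hS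
  have hpt : ∀ w, g w ≤ q + k * (Prod.fst ⁻¹' Ω1 : Set (α × β)).indicator Ξ w
      + m * ((Prod.fst ⁻¹' Ω1ᶜ : Set (α × β)).indicator 1 w
        + (Prod.snd ⁻¹' Ω2ᶜ : Set (α × β)).indicator 1 w) := by
    rintro ⟨a, b⟩
    by_cases ha : a ∈ Ω1
    · by_cases hb : b ∈ Ω2
      · have e1 : (Prod.fst ⁻¹' Ω1 : Set (α × β)).indicator Ξ (a, b) = Ξ (a, b) :=
          Set.indicator_of_mem (show (a, b) ∈ Prod.fst ⁻¹' Ω1 from ha) _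
        rw [e1]
        exact (h a ha b hb).trans le_self_add
      · have e1 : (Prod.snd ⁻¹' Ω2ᶜ : Set (α × β)).indicator (1 : α × β → ℝ≥0∞) (a, b) = 1 :=
          Set.indicator_of_mem (show (a, b) ∈ Prod.snd ⁻¹' Ω2ᶜ from hb) _
        rw [e1, mul_add, mul_one, ← add_assoc]
        exact (h2 _).trans le_add_self
    · have e1 : (Prod.fst ⁻¹' Ω1ᶜ : Set (α × β)).indicator (1 : α × β → ℝ≥0∞) (a, b) = 1 :=
        Set.indicator_of_mem (show (a, b) ∈ Prod.fst ⁻¹' Ω1ᶜ from ha) _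
      rw [e1, add_comm (1 : ℝ≥0∞), mul_add, mul_one, ← add_assoc]
      exact (h2 _).trans le_add_self
  have i1 : ∫⁻ w, (Prod.fst ⁻¹' Ω1 : Set (α × β)).indicator Ξ w ∂(μ.prod ν) ≤ N := by
    rw [lintegral_prod _ hm1.aemeasurable]
    have : ∀ a, ∫⁻ b, (Prod.fst ⁻¹' Ω1 : Set (α × β)).indicator Ξ (a, b) ∂ν ≤ N := by
      intro a
      by_cases ha : a ∈ Ω1
      · refine le_trans (lintegral_mono fun b => ?_) (hΞ a ha)
        exact Set.indicator_le_self _ _ _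
      · have : ∀ b, (Prod.fst ⁻¹' Ω1 : Set (α × β)).indicator Ξ (a, b) = 0 := fun b =>
          Set.indicator_of_notMem (show (a, b) ∉ Prod.fst ⁻¹' Ω1 from ha) _
        simp [this]
    refine (lintegral_mono this).trans ?_
    simp
  have i2 : ∫⁻ w, (Prod.fst ⁻¹' Ω1ᶜ : Set (α × β)).indicator 1 w ∂(μ.prod ν) = μ Ω1ᶜ := by
    rw [lintegral_indicator_one hS1, ← Set.prod_univ, Measure.prod_prod]; simp
  have i3 : ∫⁻ w, (Prod.snd ⁻¹' Ω2ᶜ : Set (α × β)).indicator 1 w ∂(μ.prod ν) = ν Ω2ᶜ := by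
    rw [lintegral_indicator_one hS2, ← Set.univ_prod, Measure.prod_prod]; simp
  have mo1 : Measurable fun w => (Prod.fst ⁻¹' Ω1ᶜ : Set (α × β)).indicator (1 : α × β → ℝ≥0∞) w :=
    measurable_one.indicator hS1
  have mo2 : Measurable fun w => (Prod.snd ⁻¹' Ω2ᶜ : Set (α × β)).indicator (1 : α × β → ℝ≥0∞) w :=
    measurable_one.indicator hS2
  have mo3 : Measurable fun w => (Prod.fst ⁻¹' Ω1ᶜ : Set (α × β)).indicator (1 : α × β → ℝ≥0∞) w
      + (Prod.snd ⁻¹' Ω2ᶜ : Set (α × β)).indicator (1 : α × β → ℝ≥0∞) w := mo1.add mo2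
  refine (lintegral_mono hpt).trans ?_
  rw [lintegral_add_right _ (mo3.const_mul m), lintegral_const_mul _ mo3,
    lintegral_add_left measurable_const, lintegral_const_mul _ hm1, lintegral_add_left mo1, i2, i3]
  simp only [lintegral_const, measure_univ, mul_one]
  gcongr

/-- Numerical control of the contribution of the exceptional event. -/
lemma tail_num {n r s : ℕ} {lam L δ Nc : ℝ} (hr : 1 ≤ r) (hrs : r ≤ s) (hl : 0 < lam) (hL : 1 ≤ L)
    (hδ : δ = min lam 1 / 6) (hn1 : 2949120 * (s * L) ≤ n) (hn2 : 2949120 * Real.log lam ≤ n)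
    (hR : (lam + 1) / (n * lam ^ 2) * (r * ((s : ℝ) - r) + s * L) ≤ 1 / 2949120)
    (hNc : Nc ≤ exp (s * L)) :
    2 * r * (5 ^ r * (2 * exp (-(n * δ ^ 2 / 8192)))
      + Nc * (25 ^ s * (2 * exp (-(n * δ ^ 2 / 8192)))))
      ≤ 9437184 * ((lam + 1) / (n * lam ^ 2) * (r * ((s : ℝ) - r) + s * L)) := by
  have hr0 : (1 : ℝ) ≤ r := by exact_mod_cast hr
  have hrs0 : (r : ℝ) ≤ s := by exact_mod_cast hrs
  have hs0 : (1 : ℝ) ≤ s := hr0.trans hrs0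
  have hsL : (s : ℝ) ≤ s * L := le_mul_of_one_le_right (by linarith) hL
  have hn0 : (0 : ℝ) < n := by nlinarith
  have hT : (0 : ℝ) ≤ r * ((s : ℝ) - r) := mul_nonneg (by linarith) (by linarith)
  have hK : 0 < n * lam ^ 2 := by positivity
  have hE0 := exp_pos (-(n * δ ^ 2 / 8192))
  have h25 : (25 : ℝ) ≤ exp 4 := by
    have := Real.exp_one_gt_d9
    have e : exp 4 = (exp 1) ^ 4 := by rw [← Real.exp_nat_mul]; norm_num
    rw [e]
    calc (25 : ℝ) ≤ (2.7 : ℝ) ^ 4 := by norm_num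
      _ ≤ _ := by gcongr; linarith
  have h25s : (25 : ℝ) ^ s ≤ exp (4 * (s * L)) := by
    calc (25 : ℝ) ^ s ≤ (exp 4) ^ s := by gcongr
      _ = exp (s * 4) := by rw [← Real.exp_nat_mul]
      _ ≤ _ := by apply exp_le_exp.2; linarith
  have h5r : (5 : ℝ) ^ r ≤ exp (5 * (s * L)) := by
    calc (5 : ℝ) ^ r ≤ 25 ^ r := by gcongr; norm_num
      _ ≤ 25 ^ s := by gcongr; norm_num
      _ ≤ _ := h25s
      _ ≤ _ := by apply exp_le_exp.2; linarith
  have hN25 : Nc * 25 ^ s ≤ exp (5 * (s * L)) := by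
    calc Nc * 25 ^ s ≤ exp (s * L) * exp (4 * (s * L)) := by gcongr
      _ = _ := by rw [← exp_add]; congr 1; ring
  -- the effective sample size
  have hRs : lam ≤ 1 → 2949120 * (s * L) ≤ n * lam ^ 2 := by
    intro h1
    have : (s * L) / (n * lam ^ 2) ≤ 1 / 2949120 := by
      refine le_trans ?_ hR
      rw [div_mul_eq_mul_div]
      refine div_le_div_of_nonneg_right ?_ hK.le
      have h7 : 0 ≤ lam * (r * ((s : ℝ) - r) + s * L) := mul_nonneg hl.le (by linarith)
      linarith
    rw [div_le_div_iff₀ hK (by norm_num)] at this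
    linarith
  have hnd : 81920 * (s * L) ≤ n * δ ^ 2 := by
    rcases le_total lam 1 with h1 | h1
    · rw [hδ, min_eq_left h1]; have := hRs h1; linarith [show (n : ℝ) * (lam / 6) ^ 2 = n * lam ^ 2 / 36 by ring]
    · rw [hδ, min_eq_right h1]; linarith
  have hmain : 5 ^ r * (2 * exp (-(n * δ ^ 2 / 8192)))
      + Nc * (25 ^ s * (2 * exp (-(n * δ ^ 2 / 8192)))) ≤ 4 * exp (-(n * δ ^ 2 / 16384)) := by
    have h1 : exp (5 * (s * L)) * exp (-(n * δ ^ 2 / 8192)) ≤ exp (-(n * δ ^ 2 / 16384)) := by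
      rw [← exp_add]; apply exp_le_exp.2; linarith
    have h2 := mul_le_mul_of_nonneg_right h5r hE0.le
    have h3 := mul_le_mul_of_nonneg_right hN25 hE0.le
    linarith
  have hinv : ∀ x : ℝ, 0 < x → exp (-x) ≤ 1 / x := by
    intro x hx
    rw [Real.exp_neg, ← one_div]
    apply one_div_le_one_div_of_le hx
    linarith [add_one_le_exp x]
  have hfin : 8 * exp (-(n * δ ^ 2 / 16384)) ≤ 9437184 * ((lam + 1) / (n * lam ^ 2)) := by
    rcases le_total lam 1 with h1 | h1
    · rw [hδ, min_eq_left h1]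
      have e : (n : ℝ) * (lam / 6) ^ 2 / 16384 = n * lam ^ 2 / 589824 := by ring
      rw [e]
      have := hinv (n * lam ^ 2 / 589824) (by positivity)
      have h3 : 1 / (n * lam ^ 2 / 589824) = 589824 * (1 / (n * lam ^ 2)) := by
        field_simp
      have h4 : 1 / (n * lam ^ 2) ≤ (lam + 1) / (n * lam ^ 2) := by gcongr; linarith
      have h5 : 0 ≤ (lam + 1) / (n * lam ^ 2) := by positivity
      linarith
    · rw [hδ, min_eq_right h1]
      have e : -((n : ℝ) * (1 / 6) ^ 2 / 16384) = -(n / 1179648) + -(n / 1179648) := by ring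
      rw [e, exp_add]
      have h2 := hinv ((n : ℝ) / 1179648) (by positivity)
      have h3 : exp (-((n : ℝ) / 1179648)) ≤ 1 / lam := by
        rw [Real.exp_neg, ← one_div]
        apply one_div_le_one_div_of_le hl
        rw [← Real.log_le_iff_le_exp hl]
        linarith [Real.log_nonneg h1]
      have h4 : exp (-((n : ℝ) / 1179648)) * exp (-((n : ℝ) / 1179648))
          ≤ 1 / ((n : ℝ) / 1179648) * (1 / lam) := by gcongr
      have h5 : 1 / ((n : ℝ) / 1179648) * (1 / lam) = 1179648 * (lam / (n * lam ^ 2)) := by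
        field_simp
      have h6 : lam / (n * lam ^ 2) ≤ (lam + 1) / (n * lam ^ 2) := by gcongr; linarith
      linarith
  have hX : 0 ≤ (lam + 1) / (n * lam ^ 2) := by positivity
  calc _ ≤ 2 * r * (4 * exp (-(n * δ ^ 2 / 16384))) := by gcongr
    _ = r * (8 * exp (-(n * δ ^ 2 / 16384))) := by ring
    _ ≤ r * (9437184 * ((lam + 1) / (n * lam ^ 2))) := by gcongr
    _ = 9437184 * ((lam + 1) / (n * lam ^ 2) * r) := by ring
    _ ≤ _ := by gcongr; linarith

lemma measurable_noise {n p r d : ℕ} (E : Matrix (Fin p) (Fin d) ℝ) (g : Fin r → ℝ) :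
    Measurable fun w : (Fin n → Fin r → ℝ) × (Fin n → Fin p → ℝ) =>
      frobSq (Eᵀ * (Matrix.of w.2)ᵀ * Ymat g w.1) := by
  simp only [frobSq, Matrix.mul_apply, Matrix.transpose_apply, Ymat, Matrix.of_apply]
  fun_prop

lemma noise_sum {n p r s : ℕ} (D : Finset (Fin p) → ℕ)
    (E : ∀ B, Matrix (Fin p) (Fin (D B)) ℝ) (hE : ∀ B, IsOrthonormalCols (E B))
    {Y : Matrix (Fin n) (Fin r) ℝ} {t M : ℝ} (ht : 0 ≤ t) (htM : t * M ≤ 1 / 4)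
    (hY : ∀ h : Fin r → ℝ, (Y *ᵥ h) ⬝ᵥ (Y *ᵥ h) ≤ M * (h ⬝ᵥ h)) :
    ∫⁻ z, ENNReal.ofReal (∑ B ∈ Finset.powersetCard s Finset.univ,
        exp (t * frobSq ((E B)ᵀ * (Matrix.of z)ᵀ * Y) - r * D B / 2)) ∂(gaussianMatrix n p)
      ≤ ENNReal.ofReal (p.choose s) := by
  have hm : ∀ B, Measurable fun z : Fin n → Fin p → ℝ =>
      ENNReal.ofReal (exp (t * frobSq ((E B)ᵀ * (Matrix.of z)ᵀ * Y))) := by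
    intro B
    simp only [frobSq, Matrix.mul_apply, Matrix.transpose_apply, Matrix.of_apply]
    fun_prop
  have e : ∀ z : Fin n → Fin p → ℝ, ENNReal.ofReal (∑ B ∈ Finset.powersetCard s Finset.univ,
        exp (t * frobSq ((E B)ᵀ * (Matrix.of z)ᵀ * Y) - r * D B / 2))
      = ∑ B ∈ Finset.powersetCard s Finset.univ, ENNReal.ofReal (exp (-(r * D B / 2)))
        * ENNReal.ofReal (exp (t * frobSq ((E B)ᵀ * (Matrix.of z)ᵀ * Y))) := by
    intro z
    rw [ENNReal.ofReal_sum_of_nonneg fun B _ => (exp_pos _).le]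
    refine Finset.sum_congr rfl fun B _ => ?_
    rw [← ENNReal.ofReal_mul (exp_pos _).le, ← Real.exp_add]
    congr 2; ring
  simp only [e]
  rw [lintegral_finsetSum _ fun B _ => (hm B).const_mul _]
  have hb : ∀ B ∈ Finset.powersetCard s (Finset.univ : Finset (Fin p)),
      ∫⁻ z, ENNReal.ofReal (exp (-(r * D B / 2)))
        * ENNReal.ofReal (exp (t * frobSq ((E B)ᵀ * (Matrix.of z)ᵀ * Y))) ∂(gaussianMatrix n p)
        ≤ 1 := by
    intro B _
    rw [lintegral_const_mul _ (hm B)]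
    refine (mul_le_mul' le_rfl (noise_mgf (hE B) Y ht htM hY)).trans (le_of_eq ?_)
    rw [← ENNReal.ofReal_mul (exp_pos _).le, ← Real.exp_add]
    simp
  refine (Finset.sum_le_sum hb).trans (le_of_eq ?_)
  simp

set_option maxHeartbeats 1000000 in
/-- Risk bound for the (approximate) sparse maximum likelihood estimator at a fixed parameter. -/
lemma upper_fixed {n p r s : ℕ} {κ lam L R : ℝ} (hκ : 1 < κ) (hr : 1 ≤ r) (hrs : r ≤ s)
    (hsp : s ≤ p) (hl : 0 < lam) (hL : L = Real.log (Real.exp 1 * p / s))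
    (hn1 : 2949120 * (s * L) ≤ n) (hn2 : 2949120 * Real.log lam ≤ n)
    (hRd : R = (lam + 1) / (n * lam ^ 2) * (r * ((s : ℝ) - r) + s * L))
    (hR : R ≤ 1 / (2949120 * κ)) {ε : ℝ} (hε : ε = n * lam * R / 8)
    {f : (Fin n → Fin p → ℝ) → (Fin p → Fin r → ℝ)} (hf : Measurable f)
    (hfS : ∀ x, f x ∈ SpSet p r s)
    (hfo : ∀ x, ∀ V ∈ SpSet p r s, frobSq (Matrix.of x * Matrix.of V) - ε
        ≤ frobSq (Matrix.of x * Matrix.of (f x)))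
    {V : Matrix (Fin p) (Fin r) ℝ} {Λ : Fin r → ℝ} (hT : InTheta 0 s p r lam κ V Λ) :
    ∫ x, loss (Matrix.of (f x)) V ∂(spikedMeasure n p r Λ V 1)
      ≤ (1024 * κ + 9437186) * R := by
  obtain ⟨hV, hw, -, hΛ0⟩ := hT
  have hΛ : ∀ k, lam ≤ Λ k ∧ Λ k ≤ κ * lam := fun k => (hΛ0 k).2
  obtain ⟨A, hAs, hA⟩ := weakLq_forward hsp hw
  choose D E hE hD hEG using fun B : Finset (Fin p) =>
    exists_E hV (A ∪ B) fun j hj k => hA j (fun h => hj (Finset.mem_union_left _ h)) k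
  have hL1 : 1 ≤ L := by rw [hL]; exact L_ge_one (hr.trans hrs) hsp
  have hr0 : (1 : ℝ) ≤ r := by exact_mod_cast hr
  have hrs0 : (r : ℝ) ≤ s := by exact_mod_cast hrs
  have hs0 : (1 : ℝ) ≤ s := hr0.trans hrs0
  have hsL : (s : ℝ) ≤ s * L := le_mul_of_one_le_right (by linarith) hL1
  have hn0 : (0 : ℝ) < n := by linarith
  have hn : 1 ≤ n := by exact_mod_cast hn0
  have hTn : (0 : ℝ) ≤ r * ((s : ℝ) - r) := mul_nonneg (by linarith) (by linarith)
  have hK : 0 < n * lam ^ 2 := by positivity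
  have hX : 0 < (lam + 1) / (n * lam ^ 2) := by positivity
  have hR0 : 0 < R := by rw [hRd]; exact mul_pos hX (by linarith)
  have hκ0 : 0 < κ := by linarith
  set δ : ℝ := min lam 1 / 6 with hδd
  have hm0 : 0 < min lam 1 := lt_min hl one_pos
  have hδ0 : 0 < δ := by positivity
  have hδ1 : δ ≤ 1 := by have := min_le_right lam 1; linarith
  have hδ : δ * (2 + lam) ≤ lam / 2 := by
    rcases le_total lam 1 with h | h
    · rw [hδd, min_eq_left h]; nlinarith
    · rw [hδd, min_eq_right h]; linarith
  have hRX : (lam + 1) / (n * lam ^ 2) * r ≤ R := by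
    rw [hRd]; exact mul_le_mul_of_nonneg_left (by linarith) hX.le
  have hsmall : 128 * κ * (lam + 1) * r ≤ n * lam ^ 2 := by
    have h1 : (lam + 1) / (n * lam ^ 2) * r ≤ 1 / (2949120 * κ) := hRX.trans hR
    rw [div_mul_eq_mul_div, div_le_div_iff₀ hK (by positivity)] at h1
    have : 0 ≤ κ * (lam + 1) * r := by positivity
    linarith
  have hR' : R ≤ 1 / 2949120 := by
    refine hR.trans (one_div_le_one_div_of_le (by norm_num) ?_)
    linarith
  -- events
  have hone : IsOrthonormalCols (1 : Matrix (Fin r) (Fin r) ℝ) := by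
    unfold IsOrthonormalCols; simp
  obtain ⟨Ω1, hOneMeas, hΩ1, hOneProb⟩ := good_event n hone hδ0 hδ1
  choose ΩB hΩBm hΩB hΩBp using fun B : Finset (Fin p) => good_event n (hE B) hδ0 hδ1
  set Ω2 : Set (Fin n → Fin p → ℝ) := (⋃ B ∈ Finset.powersetCard s Finset.univ, (ΩB B)ᶜ)ᶜ with hTwoDef
  have hTwoMeas : MeasurableSet Ω2 :=
    (Finset.measurableSet_biUnion _ fun B _ => (hΩBm B).compl).compl
  have hTwoProb : gaussianMatrix n p Ω2ᶜ ≤ ENNReal.ofReal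
      ((p.choose s) * (25 ^ s * (2 * exp (-(n * δ ^ 2 / 8192))))) := by
    rw [hTwoDef, compl_compl]
    refine (measure_biUnion_finset_le _ _).trans ?_
    have hb : ∀ B ∈ Finset.powersetCard s (Finset.univ : Finset (Fin p)),
        gaussianMatrix n p (ΩB B)ᶜ ≤ ENNReal.ofReal (25 ^ s * (2 * exp (-(n * δ ^ 2 / 8192)))) := by
      intro B hB
      refine (hΩBp B).trans (ENNReal.ofReal_le_ofReal ?_)
      have hc : D B ≤ 2 * s := by
        have h1 := hD B
        have h2 := Finset.card_union_le A B
        have h3 := (Finset.mem_powersetCard.1 hB).2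
        omega
      refine mul_le_mul_of_nonneg_right ?_ (by positivity)
      calc (5 : ℝ) ^ D B ≤ 5 ^ (2 * s) := pow_le_pow_right₀ (by norm_num) hc
        _ = 25 ^ s := by rw [pow_mul]; norm_num
    refine (Finset.sum_le_sum hb).trans (le_of_eq ?_)
    rw [Finset.sum_const, Finset.card_powersetCard, Finset.card_univ, Fintype.card_fin,
      ENNReal.ofReal_mul (Nat.cast_nonneg _), nsmul_eq_mul, ENNReal.ofReal_natCast]
  have hchoose : (p.choose s : ℝ) ≤ exp (s * L) := by
    rw [hL]; exact choose_le_exp (hr.trans hrs) hsp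
  have htail := tail_num (Nc := (p.choose s : ℝ)) hr hrs hl hL1 hδd hn1 hn2 (by rw [← hRd]; exact hR') hchoose
  rw [← hRd] at htail
  -- representation
  have hΛn : ∀ k, 0 ≤ Λ k := fun k => hl.le.trans (hΛ k).1
  have hmT := measurable_Trep (n := n) (fun k => √(1 + Λ k)) V
  have hlm := measurable_loss hf V
  have hX512 : 0 ≤ 512 * κ * (lam + 1) / (n * lam ^ 2) := by positivity
  have hlint : ∫⁻ w, ENNReal.ofReal (loss (Matrix.of (f (Trep (fun k => √(1 + Λ k)) V w))) V)
      ∂((gaussianMatrix n r).prod (gaussianMatrix n p))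
      ≤ ENNReal.ofReal ((1024 * κ + 9437186) * R) := by
    refine (lint_abs (gaussianMatrix n r) (gaussianMatrix n p) hOneMeas hTwoMeas
      (Ξ := fun w => ENNReal.ofReal (∑ B ∈ Finset.powersetCard s Finset.univ,
        exp (1 / (8 * (κ * lam + 1) * n) *
          frobSq ((E B)ᵀ * (Matrix.of w.2)ᵀ * Ymat (fun k => √(1 + Λ k)) w.1) - r * D B / 2)))
      (q := ENNReal.ofReal (512 * κ * (lam + 1) / (n * lam ^ 2) * (r * ((s : ℝ) - r) + s * L)
        + 16 * ε / (n * lam)))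
      (k := ENNReal.ofReal (512 * κ * (lam + 1) / (n * lam ^ 2) * exp (-(s * L))))
      (m := ENNReal.ofReal (2 * r)) (N := ENNReal.ofReal (p.choose s)) ?_ ?_ ?_ ?_).trans ?_
    · refine ENNReal.measurable_ofReal.comp ?_
      refine Finset.measurable_sum _ fun B _ => ?_
      exact Real.measurable_exp.comp
        (((measurable_noise (E B) (fun k => √(1 + Λ k))).const_mul _).sub_const _)
    · intro U hU Z hZ
      have hUb : ∀ x : Fin r → ℝ, |(Matrix.of U *ᵥ x) ⬝ᵥ (Matrix.of U *ᵥ x)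
          - n * (x ⬝ᵥ x)| ≤ n * δ * (x ⬝ᵥ x) := by
        intro x
        have := hΩ1 U hU x
        rwa [Matrix.mul_one] at this
      have hZb : ∀ B : Finset (Fin p), B.card = s → ∀ x : Fin (D B) → ℝ,
          |((Matrix.of Z * E B) *ᵥ x) ⬝ᵥ ((Matrix.of Z * E B) *ᵥ x)
            - n * (x ⬝ᵥ x)| ≤ n * δ * (x ⬝ᵥ x) := by
        intro B hB
        refine hΩB B Z ?_
        by_contra hcon
        exact hZ (Set.mem_iUnion₂.2 ⟨B, Finset.mem_powersetCard.2 ⟨Finset.subset_univ _, hB⟩, hcon⟩)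
      have hVS : (fun i j => V i j) ∈ SpSet p r s := ⟨hV, A, hAs, hA⟩
      have hp := pointwise hn hκ hl hΛ hV hAs hA D E hE hD hEG hrs (ε := ε) (a := s * L)
        (by linarith) hδ0 hδ1 hδ hsmall (w := (U, Z))
        (hfS (Trep (fun k => √(1 + Λ k)) V (U, Z)))
        (hfo (Trep (fun k => √(1 + Λ k)) V (U, Z)) _ hVS) hUb hZb
      rw [← ENNReal.ofReal_mul (by positivity), ← ENNReal.ofReal_add ?_ ?_]
      · refine ENNReal.ofReal_le_ofReal (hp.trans (le_of_eq ?_))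
        ring
      · refine add_nonneg (mul_nonneg hX512 (by linarith)) ?_
        rw [hε]; positivity
      · exact mul_nonneg (by positivity) (Finset.sum_nonneg fun B _ => (exp_pos _).le)
    · intro w
      exact ENNReal.ofReal_le_ofReal (loss_le (hfS _).1 hV)
    · intro U hU
      have hUb : ∀ x : Fin r → ℝ, |(Matrix.of U *ᵥ x) ⬝ᵥ (Matrix.of U *ᵥ x)
          - n * (x ⬝ᵥ x)| ≤ n * δ * (x ⬝ᵥ x) := by
        intro x
        have := hΩ1 U hU x
        rwa [Matrix.mul_one] at this
      have hkl : 0 < κ * lam + 1 := by positivity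
      have htM : 1 / (8 * (κ * lam + 1) * n) * (2 * (κ * lam + 1) * n) ≤ 1 / 4 := by
        refine le_of_eq ?_
        field_simp; norm_num
      have ht : 0 ≤ 1 / (8 * (κ * lam + 1) * n) := by positivity
      have hns := noise_sum (s := s) D E hE ht htM (Y := Ymat (fun k => √(1 + Λ k)) U)
        (fun h => (Ymat_bounds hl hΛ hδ0 hδ1 hUb h).2)
      exact hns
    · have h1 : gaussianMatrix n r Ω1ᶜ + gaussianMatrix n p Ω2ᶜ
          ≤ ENNReal.ofReal (5 ^ r * (2 * exp (-(n * δ ^ 2 / 8192)))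
            + (p.choose s) * (25 ^ s * (2 * exp (-(n * δ ^ 2 / 8192))))) := by
        rw [ENNReal.ofReal_add (by positivity) (by positivity)]
        exact add_le_add hOneProb hTwoProb
      refine (add_le_add le_rfl (mul_le_mul' le_rfl h1)).trans ?_
      rw [← ENNReal.ofReal_mul (by positivity), ← ENNReal.ofReal_mul (by positivity),
        ← ENNReal.ofReal_add ?_ (by positivity), ← ENNReal.ofReal_add ?_ (by positivity)]
      · refine ENNReal.ofReal_le_ofReal ?_
        have h2 : 512 * κ * (lam + 1) / (n * lam ^ 2) * (r * ((s : ℝ) - r) + s * L) = 512 * κ * R := by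
          rw [hRd]; ring
        have h3 : 16 * ε / (n * lam) = 2 * R := by
          rw [hε]; field_simp; norm_num
        have h4 : 512 * κ * (lam + 1) / (n * lam ^ 2) * exp (-(s * L)) * (p.choose s)
            ≤ 512 * κ * R := by
          have h5 : exp (-(s * L)) * (p.choose s) ≤ 1 := by
            calc exp (-(s * L)) * (p.choose s) ≤ exp (-(s * L)) * exp (s * L) :=
                  mul_le_mul_of_nonneg_left hchoose (exp_pos _).le
              _ = 1 := by rw [← Real.exp_add]; simp
          rw [mul_assoc]
          refine (mul_le_mul_of_nonneg_left h5 hX512).trans ?_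
          rw [← h2]
          exact mul_le_mul_of_nonneg_left (by linarith) hX512
        rw [h2, h3]
        linarith
      all_goals
        first
        | (refine add_nonneg (mul_nonneg hX512 (by linarith)) ?_
           rw [hε]; positivity)
        | (refine add_nonneg (add_nonneg (mul_nonneg hX512 (by linarith)) ?_) (by positivity)
           rw [hε]; positivity)
  rw [spiked_rep hΛn hV, integral_map hmT.aemeasurable hlm.aestronglyMeasurable]
  rw [integral_eq_lintegral_of_nonneg_ae (Filter.Eventually.of_forall fun w => loss_nonneg _ _)
    (hlm.comp hmT).aestronglyMeasurable]
  refine (ENNReal.toReal_mono ENNReal.ofReal_ne_top hlint).trans (le_of_eq ?_)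
  exact ENNReal.toReal_ofReal (by positivity)

lemma risk_scale {n p r : ℕ} {Λ : Fin r → ℝ} {V : Matrix (Fin p) (Fin r) ℝ} {σ2 : ℝ} (hσ : 0 < σ2)
    {f : (Fin n → Fin p → ℝ) → (Fin p → Fin r → ℝ)} (hf : Measurable f) :
    ∫ x, loss (Matrix.of (f x)) V ∂(spikedMeasure n p r Λ V σ2)
      = ∫ x, loss (Matrix.of (f (fun i j => √σ2 * x i j))) V
        ∂(spikedMeasure n p r (fun k => Λ k / σ2) V 1) := by
  rw [spiked_scale σ2 hσ]
  have hm : Measurable fun (x : Fin n → Fin p → ℝ) (i : Fin n) (j : Fin p) => √σ2 * x i j := by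
    fun_prop
  rw [integral_map hm.aemeasurable (measurable_loss hf V).aestronglyMeasurable]

lemma risk_le {n p r : ℕ} {Λ : Fin r → ℝ} {V : Matrix (Fin p) (Fin r) ℝ} {σ2 : ℝ}
    {f : (Fin n → Fin p → ℝ) → (Fin p → Fin r → ℝ)}
    (ho : ∀ x, IsOrthonormalCols (Matrix.of (f x))) (hf : Measurable f)
    (hV : IsOrthonormalCols V) :
    ∫ x, loss (Matrix.of (f x)) V ∂(spikedMeasure n p r Λ V σ2) ≤ 2 * r := by
  refine (integral_mono (integrable_loss hf ho hV _) (integrable_const (2 * (r : ℝ)))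
    fun x => loss_le (ho x) hV).trans (le_of_eq ?_)
  simp

lemma InTheta_div {p r s : ℕ} {lam κ σ2 : ℝ} (hσ : 0 < σ2) {V : Matrix (Fin p) (Fin r) ℝ}
    {Λ : Fin r → ℝ} (h : InTheta 0 s p r lam κ V Λ) :
    InTheta 0 s p r (lam / σ2) κ V (fun k => Λ k / σ2) := by
  obtain ⟨h1, h2, h3, h4⟩ := h
  refine ⟨h1, h2, fun a b hab => div_le_div_of_nonneg_right (h3 hab) hσ.le, fun i => ?_⟩
  obtain ⟨a, b, c⟩ := h4 i
  refine ⟨div_pos a hσ, div_le_div_of_nonneg_right b hσ.le, ?_⟩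
  rw [← mul_div_assoc]
  exact div_le_div_of_nonneg_right c hσ.le

lemma upper_assembly {n p r s : ℕ} {lam σ2 κ b : ℝ} (hσ : 0 < σ2) (hb : 0 ≤ b)
    {f : (Fin n → Fin p → ℝ) → (Fin p → Fin r → ℝ)} (hf : Measurable f)
    (ho : ∀ x, IsOrthonormalCols (Matrix.of (f x)))
    (h : ∀ V Λ, InTheta 0 s p r (lam / σ2) κ V Λ →
      ∫ x, loss (Matrix.of (f x)) V ∂(spikedMeasure n p r Λ V 1) ≤ b) :
    minimaxRisk0 n p r s lam σ2 κ ≤ b := by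
  have hm : Measurable fun (x : Fin n → Fin p → ℝ) (i : Fin n) (j : Fin p) => (√σ2)⁻¹ * x i j := by
    fun_prop
  unfold minimaxRisk0
  refine (ciInf_le ?_ (⟨fun x => f (fun i j => (√σ2)⁻¹ * x i j), hf.comp hm, fun x => ho _⟩ :
    {f : (Fin n → Fin p → ℝ) → (Fin p → Fin r → ℝ) //
      Measurable f ∧ ∀ x, IsOrthonormalCols (Matrix.of (f x))})).trans ?_
  · refine ⟨0, ?_⟩
    rintro _ ⟨g, rfl⟩
    refine Real.iSup_nonneg fun V => Real.iSup_nonneg fun Λ => Real.iSup_nonneg fun _ => ?_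
    exact integral_nonneg fun x => loss_nonneg _ _
  · refine Real.iSup_le (fun V => Real.iSup_le (fun Λ => Real.iSup_le (fun hT => ?_) hb) hb) hb
    have e := risk_scale (Λ := Λ) (V := V) hσ (hf.comp hm)
    refine (le_of_eq e).trans ?_
    have hs : √σ2 ≠ 0 := (Real.sqrt_pos.2 hσ).ne'
    have e2 : ∀ x : Fin n → Fin p → ℝ,
        ((f ∘ fun (x : Fin n → Fin p → ℝ) (i : Fin n) (j : Fin p) => (√σ2)⁻¹ * x i j)
          fun i j => √σ2 * x i j) = f x := by
      intro x
      simp only [Function.comp]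
      congr 1
      funext i j
      rw [← mul_assoc, inv_mul_cancel₀ hs, one_mul]
    simp only [e2]
    exact h V _ (InTheta_div hσ hT)

lemma lower_assembly {n p r s : ℕ} {lam σ2 κ b : ℝ} (hσ : 0 < σ2)
    (hrs : r ≤ s) (hsp : s ≤ p)
    (h : ∀ f : (Fin n → Fin p → ℝ) → (Fin p → Fin r → ℝ), Measurable f →
      (∀ x, IsOrthonormalCols (Matrix.of (f x))) →
      ∃ V, InTheta 0 s p r (lam / σ2) κ V (fun _ => lam / σ2) ∧
        b ≤ ∫ x, loss (Matrix.of (f x)) V ∂(spikedMeasure n p r (fun _ => lam / σ2) V 1))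
    (hl : 0 < lam) (hκ : 1 < κ) :
    b ≤ minimaxRisk0 n p r s lam σ2 κ := by
  obtain ⟨f0, hf0, hf0S, -⟩ := exists_est n hrs hsp one_pos
  unfold minimaxRisk0
  haveI : Nonempty {f : (Fin n → Fin p → ℝ) → (Fin p → Fin r → ℝ) //
      Measurable f ∧ ∀ x, IsOrthonormalCols (Matrix.of (f x))} :=
    ⟨⟨f0, hf0, fun x => (hf0S x).1⟩⟩
  refine le_ciInf fun est => ?_
  obtain ⟨f, hf, ho⟩ := est
  have hm : Measurable fun (x : Fin n → Fin p → ℝ) (i : Fin n) (j : Fin p) => √σ2 * x i j := by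
    fun_prop
  obtain ⟨V, hT, hV⟩ := h _ (hf.comp hm) fun x => ho _
  obtain ⟨h1, h2, h3, h4⟩ := hT
  have hT' : InTheta 0 s p r lam κ V (fun _ => lam) :=
    ⟨h1, h2, fun _ _ _ => le_rfl, fun i => ⟨hl, le_rfl, by nlinarith⟩⟩
  have h2r : (0 : ℝ) ≤ 2 * r := by positivity
  have hbd : ∀ (V : Matrix (Fin p) (Fin r) ℝ) (Λ : Fin r → ℝ),
      (⨆ (_ : InTheta 0 s p r lam κ V Λ),
        ∫ x, loss (Matrix.of (f x)) V ∂ spikedMeasure n p r Λ V σ2) ≤ 2 * r := fun V Λ =>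
    Real.iSup_le (fun hT => risk_le ho hf hT.1) h2r
  refine le_trans ?_ (le_ciSup (f := fun V : Matrix (Fin p) (Fin r) ℝ => ⨆ (Λ : Fin r → ℝ)
      (_ : InTheta 0 s p r lam κ V Λ),
      ∫ x, loss (Matrix.of (f x)) V ∂ spikedMeasure n p r Λ V σ2) ⟨2 * r, ?_⟩ V)
  · refine le_trans ?_ (le_ciSup (f := fun Λ : Fin r → ℝ => ⨆
      (_ : InTheta 0 s p r lam κ V Λ),
      ∫ x, loss (Matrix.of (f x)) V ∂ spikedMeasure n p r Λ V σ2) ⟨2 * r, ?_⟩ (fun _ => lam))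
    · simp only [ciSup_pos hT']
      rw [risk_scale hσ hf]
      exact hV
    · rintro _ ⟨Λ, rfl⟩
      exact hbd V Λ
  · rintro _ ⟨V, rfl⟩
    exact Real.iSup_le (hbd V) h2r

lemma main_thm (κ : ℝ) (hκ : 1 < κ) :
    ∃ c₁ c₂ c₃ c C R₀ : ℝ, 0 < c₁ ∧ 0 < c₂ ∧ 0 < c₃ ∧ 0 < c ∧ 0 < C ∧ 0 < R₀ ∧
      ∀ (n p r s : ℕ) (lam σ2 : ℝ), 1 ≤ r → r ≤ s → s ≤ p → 0 < lam → 0 < σ2 →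
        c₁ * Real.sqrt (Real.log n / n) ≤ lam / σ2 →
        c₂ * min (s : ℝ) (Real.log (Real.exp 1 * p / s)) ≤ (s : ℝ) - r →
        c₃ * max ((s : ℝ) * Real.log (Real.exp 1 * p / s)) (Real.log (lam / σ2)) ≤ (n : ℝ) →
        (lam / σ2 + 1) / ((n : ℝ) * (lam / σ2) ^ 2) *
            ((r : ℝ) * ((s : ℝ) - r) + s * Real.log (Real.exp 1 * p / s)) ≤ R₀ →
        c * ((lam / σ2 + 1) / ((n : ℝ) * (lam / σ2) ^ 2) *
              ((r : ℝ) * ((s : ℝ) - r) + s * Real.log (Real.exp 1 * p / s)))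
            ≤ minimaxRisk0 n p r s lam σ2 κ ∧
          minimaxRisk0 n p r s lam σ2 κ
            ≤ C * ((lam / σ2 + 1) / ((n : ℝ) * (lam / σ2) ^ 2) *
              ((r : ℝ) * ((s : ℝ) - r) + s * Real.log (Real.exp 1 * p / s))) := by
  have hκ0 : 0 < κ := by linarith
  refine ⟨1, 2, 2949120, 1 / 7000, 1024 * κ + 9437186, 1 / (2949120 * κ), one_pos, two_pos,
    by norm_num, by norm_num, by positivity, by positivity, ?_⟩
  intro n p r s lam σ2 hr hrs hsp hl0 hσ _ hs2 hn hR
  have hl : 0 < lam / σ2 := div_pos hl0 hσ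
  set L := Real.log (Real.exp 1 * p / s) with hL
  have hL1 : 1 ≤ L := L_ge_one (hr.trans hrs) hsp
  set R := (lam / σ2 + 1) / ((n : ℝ) * (lam / σ2) ^ 2) * ((r : ℝ) * ((s : ℝ) - r) + s * L) with hRd
  have hr0 : (1 : ℝ) ≤ r := by exact_mod_cast hr
  have hrs0 : (r : ℝ) ≤ s := by exact_mod_cast hrs
  have hs0 : (1 : ℝ) ≤ s := hr0.trans hrs0
  have hsL : (s : ℝ) ≤ s * L := le_mul_of_one_le_right (by linarith) hL1
  have hn1 : 2949120 * (s * L) ≤ n := by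
    have := le_max_left ((s : ℝ) * L) (Real.log (lam / σ2))
    linarith
  have hn2 : 2949120 * Real.log (lam / σ2) ≤ n := by
    have := le_max_right ((s : ℝ) * L) (Real.log (lam / σ2))
    linarith
  have hn0 : (0 : ℝ) < n := by linarith
  have hn' : 1 ≤ n := by exact_mod_cast hn0
  have hTn : (0 : ℝ) ≤ r * ((s : ℝ) - r) := mul_nonneg (by linarith) (by linarith)
  have hR0 : 0 < R := mul_pos (by positivity) (by linarith)
  obtain ⟨-, h2L⟩ := L_le_of hr hrs one_le_two hs2
  have hRe : ((r : ℝ) * (s - r) + s * L) / (n * hfun (lam / σ2)) = R := by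
    rw [hRd]
    unfold hfun
    have : lam / σ2 + 1 ≠ 0 := by positivity
    generalize lam / σ2 = l at *
    field_simp
  have hR1 : R ≤ 1 := by
    refine hR.trans ?_
    rw [div_le_one (by positivity)]
    linarith
  constructor
  · refine lower_assembly hσ hrs hsp (fun f hf ho => ?_) hl0 hκ
    rcases le_or_gt L (24 * r) with hA | hB
    · obtain ⟨V, hT, h⟩ := lower_A κ (lam / σ2) hκ hr hrs hsp hl L hL1 hn' h2L
        (by rw [hRe]; exact hR1) hA f hf ho
      rw [hRe] at h
      exact ⟨V, hT, le_trans (by linarith) h⟩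
    · obtain ⟨V, hT, h⟩ := lower_B κ (lam / σ2) hκ hr hrs hsp hl L hL h2L (by linarith)
        (by rw [hRe]; exact hR1) hB f hf ho
      rw [hRe] at h
      exact ⟨V, hT, le_trans (by linarith) h⟩
  · have hε : 0 < n * (lam / σ2) * R / 8 := by positivity
    obtain ⟨f, hf, hfS, hfo⟩ := exists_est n hrs hsp hε
    refine upper_assembly hσ (by positivity) hf (fun x => (hfS x).1) fun V Λ hT => ?_
    exact upper_fixed hκ hr hrs hsp hl hL hn1 hn2 hRd hR rfl hf hfS hfo hT

/-- **Theorem 1** (optimal rates, exact sparsity `q = 0`).  Under the stated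
conditions on the parameters, the minimax risk for estimating the principal
subspace is, up to constants, equal to
`R = ((λ/σ² + 1)/(n (λ/σ²)²)) (r(s-r) + s log(ep/s))`. -/
theorem minimax_rate_sparse_pca_q0 (κ : ℝ) (hκ : 1 < κ) :
    ∃ c₁ c₂ c₃ c C R₀ : ℝ, 0 < c₁ ∧ 0 < c₂ ∧ 0 < c₃ ∧ 0 < c ∧ 0 < C ∧ 0 < R₀ ∧
      ∀ (n p r s : ℕ) (lam σ2 : ℝ), 1 ≤ r → r ≤ s → s ≤ p → 0 < lam → 0 < σ2 →
        c₁ * Real.sqrt (Real.log n / n) ≤ lam / σ2 →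
        c₂ * min (s : ℝ) (Real.log (Real.exp 1 * p / s)) ≤ (s : ℝ) - r →
        c₃ * max ((s : ℝ) * Real.log (Real.exp 1 * p / s)) (Real.log (lam / σ2)) ≤ (n : ℝ) →
        (lam / σ2 + 1) / ((n : ℝ) * (lam / σ2) ^ 2) *
            ((r : ℝ) * ((s : ℝ) - r) + s * Real.log (Real.exp 1 * p / s)) ≤ R₀ →
        c * ((lam / σ2 + 1) / ((n : ℝ) * (lam / σ2) ^ 2) *
              ((r : ℝ) * ((s : ℝ) - r) + s * Real.log (Real.exp 1 * p / s)))
            ≤ minimaxRisk0 n p r s lam σ2 κ ∧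
          minimaxRisk0 n p r s lam σ2 κ
            ≤ C * ((lam / σ2 + 1) / ((n : ℝ) * (lam / σ2) ^ 2) *
              ((r : ℝ) * ((s : ℝ) - r) + s * Real.log (Real.exp 1 * p / s))) := by
  exact main_thm κ hκ

end SparsePCA
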